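/- Let G be a connected finite simple graph with at least 3 vertices and N_G = 2h_G which is denominator reducible up to the penultimate stage: there is an edge ordering for which a denominator reduction D⁵, …, D^{N_G−2} exists. Then either [X_G]_q ≡ 0 (mod q³) for every prime power q, or there exists a finite set S of primes such that for every prime p ∉ S and every integer n ≥ 1, setting q = p^{2n}, one has [X_G]_q ≡ −q² (mod q³). In other words, c2(G) is either 0 or quasi −1. -/

import Mathlib

open scoped Classical
open Matrix

/-- The graph polynomial (Kirchhoff polynomial) of a finite simple graph `G`:
`Ψ_G = Σ_T Π_{e ∉ T} x_e`, summed over spanning trees `T` of `G`. -/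
noncomputable def graphPoly {V : Type*} [Fintype V] (G : SimpleGraph V) :
    MvPolynomial G.edgeSet ℤ :=
  letI : Fintype G.edgeSet := Fintype.ofFinite _
  ∑ T : Finset G.edgeSet,
    if (SimpleGraph.fromEdgeSet (Subtype.val '' (T : Set G.edgeSet))).IsTree then
      ∏ e ∈ Tᶜ, MvPolynomial.X e
    else 0

/-- `[X_G]_q`: the number of points `x ∈ K^{E(G)}` with `Ψ_G(x) = 0`. -/
noncomputable def Xcount {V : Type*} [Fintype V] (G : SimpleGraph V)
    (K : Type*) [CommRing K] : ℕ :=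
  Nat.card {x : G.edgeSet → K // MvPolynomial.aeval x (graphPoly G) = 0}

/-- `(src, tgt)` is an orientation of the edges of `G`. -/
def IsOrientation {V : Type*} (G : SimpleGraph V) (src tgt : G.edgeSet → V) : Prop :=
  ∀ e : G.edgeSet, (e : Sym2 V) = s(src e, tgt e)

/-- The matrix `M_G` (with the variables of edges in `K` set to `0`), edges enumerated
by `Fin N`, rows/columns of the vertex block indexed by the vertices other than `v₀`. -/
noncomputable def MGmatrix {V : Type*} {N : ℕ} (G : SimpleGraph V)
    (ε : Fin N ≃ G.edgeSet) (src tgt : G.edgeSet → V) (v₀ : V) (K : Finset (Fin N)) :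
    Matrix (Fin N ⊕ {u : V // u ≠ v₀}) (Fin N ⊕ {u : V // u ≠ v₀})
      (MvPolynomial (Fin N) ℤ) :=
  Matrix.fromBlocks
    (Matrix.diagonal fun i => if i ∈ K then 0 else MvPolynomial.X i)
    (Matrix.of fun i (w : {u : V // u ≠ v₀}) =>
      if src (ε i) = ↑w then 1 else if tgt (ε i) = ↑w then -1 else 0)
    (-(Matrix.of fun i (w : {u : V // u ≠ v₀}) =>
      if src (ε i) = ↑w then 1 else if tgt (ε i) = ↑w then -1 else 0)ᵀ)
    0

/-- The determinant of the minor of `M` obtained by deleting the rows indexed by `I`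
and the columns indexed by `J` (rows and columns taken in increasing order). -/
noncomputable def minorDet {R : Type*} [CommRing R] {N : ℕ} {W' : Type*}
    [Fintype W'] [DecidableEq W']
    (M : Matrix (Fin N ⊕ W') (Fin N ⊕ W') R) (I J : Finset (Fin N)) : R :=
  if h : (Jᶜ : Finset (Fin N)).card = (Iᶜ : Finset (Fin N)).card then
    Matrix.det (Matrix.of
      fun (r c : Fin (Iᶜ : Finset (Fin N)).card ⊕ W') =>
        M (Sum.map (fun i => ((Iᶜ.orderIsoOfFin rfl i : {x // x ∈ (Iᶜ : Finset (Fin N))}) : Fin N)) id r)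
          (Sum.map (fun j => ((Jᶜ.orderIsoOfFin h j : {x // x ∈ (Jᶜ : Finset (Fin N))}) : Fin N)) id c))
  else 0

/-- The Dodgson polynomial `Ψ^{I,J}_{G,K} = det M_G(I,J)_K`. -/
noncomputable def dodgson {V : Type*} [Fintype V] [DecidableEq V] {N : ℕ}
    (G : SimpleGraph V) (ε : Fin N ≃ G.edgeSet) (src tgt : G.edgeSet → V) (v₀ : V)
    (I J K : Finset (Fin N)) : MvPolynomial (Fin N) ℤ :=
  minorDet (MGmatrix G ε src tgt v₀ K) I J

/-- The five-invariant `⁵Ψ_G(i,j,k,l,m)`. -/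
noncomputable def fiveInv {V : Type*} [Fintype V] [DecidableEq V] {N : ℕ}
    (G : SimpleGraph V) (ε : Fin N ≃ G.edgeSet) (src tgt : G.edgeSet → V) (v₀ : V)
    (i j k l m : Fin N) : MvPolynomial (Fin N) ℤ :=
  Matrix.det
    !![dodgson G ε src tgt v₀ {i, j} {k, l} {m},
        dodgson G ε src tgt v₀ {i, k} {j, l} {m};
       dodgson G ε src tgt v₀ {i, j, m} {k, l, m} ∅,
        dodgson G ε src tgt v₀ {i, k, m} {j, l, m} ∅]

/-- `D : ℕ → _` is a denominator reduction for `G` of length `n` with respect to the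
edge ordering `ε` (so `e_{k+1}` carries the variable indexed by `k : Fin N`). -/
def IsDenomReduction {V : Type*} [Fintype V] [DecidableEq V] {N : ℕ}
    (G : SimpleGraph V) (ε : Fin N ≃ G.edgeSet) (src tgt : G.edgeSet → V) (v₀ : V)
    (n : ℕ) (D : ℕ → MvPolynomial (Fin N) ℤ) : Prop :=
  5 ≤ n ∧ n ≤ N ∧
  (∃ h5 : 5 ≤ N,
    D 5 = fiveInv G ε src tgt v₀ ⟨0, by omega⟩ ⟨1, by omega⟩ ⟨2, by omega⟩
        ⟨3, by omega⟩ ⟨4, by omega⟩ ∨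
    D 5 = - fiveInv G ε src tgt v₀ ⟨0, by omega⟩ ⟨1, by omega⟩ ⟨2, by omega⟩
        ⟨3, by omega⟩ ⟨4, by omega⟩) ∧
  (∀ k, 5 ≤ k → k ≤ n → ∀ i ∈ (D k).vars, k ≤ (i : ℕ)) ∧
  ∀ k, 5 ≤ k → k < n →
    ∃ (hk : k < N) (a b c d : MvPolynomial (Fin N) ℤ),
      (⟨k, hk⟩ : Fin N) ∉ a.vars ∧ (⟨k, hk⟩ : Fin N) ∉ b.vars ∧
      (⟨k, hk⟩ : Fin N) ∉ c.vars ∧ (⟨k, hk⟩ : Fin N) ∉ d.vars ∧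
      D k = (a * MvPolynomial.X ⟨k, hk⟩ + b) * (c * MvPolynomial.X ⟨k, hk⟩ + d) ∧
      (D (k + 1) = a * d - b * c ∨ D (k + 1) = -(a * d - b * c))

/-! Part A: Ax's theorem. -/

lemma axd_kappa (p e : ℕ) (hp : 2 ≤ p) (he : 1 ≤ e) (k : ℕ) :
    ∃ κ : ℕ → ℕ, (∀ i, κ i ≡ p ^ i * k [MOD (p ^ e - 1)]) ∧
      (∑ i ∈ Finset.range e, κ i) * (p - 1) = (p.digits k).sum * (p ^ e - 1) ∧
      (0 < k → ∀ i, 0 < κ i) ∧ (∀ i, κ (i + e) = κ i) := by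
  induction k using Nat.strong_induction_on with
  | _ k ih =>
    rcases Nat.eq_zero_or_pos k with rfl | hk
    · exact ⟨fun _ => 0, by simp [Nat.ModEq], by simp, by simp, by simp⟩
    obtain ⟨κ, h1, h2, h3, h4⟩ := ih (k / p) (Nat.div_lt_self hk (by omega))
    have hq : 1 ≤ p ^ e := Nat.one_le_pow _ _ (by omega)
    have hpe : p ^ e ≡ 1 [MOD (p ^ e - 1)] := by
      have := (Nat.modEq_iff_dvd' (n := p ^ e - 1) hq).2 (dvd_refl _)
      exact this.symm
    refine ⟨fun i => (k % p) * p ^ (i % e) + κ (i + 1), ?_, ?_, ?_, ?_⟩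
    · intro i
      have hk' : p ^ i * k = (k % p) * p ^ i + p ^ (i + 1) * (k / p) := by
        conv_lhs => rw [← Nat.mod_add_div k p]
        ring
      rw [hk']
      refine Nat.ModEq.add (Nat.ModEq.mul_left _ ?_) (h1 _)
      conv_rhs => rw [← Nat.mod_add_div i e]
      rw [pow_add, pow_mul]
      have := (hpe.pow (i / e)).mul_left (p ^ (i % e))
      simpa using this.symm
    · have hs : ∑ i ∈ Finset.range e, κ (i + 1) = ∑ i ∈ Finset.range e, κ i := by
        have a := Finset.sum_range_succ κ e
        have b := Finset.sum_range_succ' κ e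
        have c := h4 0
        rw [zero_add] at c
        omega
      have hg : (∑ i ∈ Finset.range e, p ^ (i % e)) * (p - 1) = p ^ e - 1 := by
        rw [Finset.sum_congr rfl (g := fun i => p ^ i)
          (fun i hi => by rw [Nat.mod_eq_of_lt (Finset.mem_range.1 hi)])]
        exact Nat.geomSum_eq hp e ▸ Nat.div_mul_cancel (by
          simpa using Nat.sub_dvd_pow_sub_pow p 1 e)
      rw [Finset.sum_add_distrib, ← Finset.mul_sum, hs, add_mul, mul_assoc, hg, h2,
        Nat.digits_def' (by omega) hk, List.sum_cons, add_mul]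
    · intro _ i
      rcases Nat.eq_zero_or_pos (k % p) with h | h
      · have : 0 < k / p := by
          rcases Nat.eq_zero_or_pos (k / p) with h' | h'
          · have := Nat.mod_add_div k p
            rw [h, h'] at this; simp at this; omega
          · exact h'
        exact Nat.add_pos_right _ (h3 this (i + 1))
      · have : 0 < p ^ (i % e) := Nat.pow_pos (by omega)
        positivity
    · intro i
      simp only [Nat.add_mod_right]
      rw [show i + e + 1 = (i + 1) + e by ring, h4]

lemma axd_digits_le (p e : ℕ) (hp : 2 ≤ p) :
    (p.digits ((p ^ e - 1) * p ^ e)).sum ≤ e * (p - 1) := by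
  rcases Nat.eq_zero_or_pos (p ^ e - 1) with h | h
  · simp [h]
  rw [mul_comm, Nat.digits_base_pow_mul (by omega) h]
  simp only [List.sum_append, List.sum_replicate, smul_eq_mul, mul_zero, zero_add]
  have hlen : (p.digits (p ^ e - 1)).length ≤ e := by
    rw [Nat.digits_length_le_iff (by omega)]
    omega
  have := List.sum_le_card_nsmul (p.digits (p ^ e - 1)) (p - 1) (by
    intro x hx
    have := Nat.digits_lt_base (by omega) hx
    omega)
  rw [smul_eq_mul] at this
  exact this.trans (Nat.mul_le_mul_right _ hlen)

lemma axd_multinomial {α σ : Type*} [Fintype σ] (p e : ℕ) [hp : Fact p.Prime] (he : 1 ≤ e)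
    (s : Finset α) (m : α → σ → ℕ) (d : ℕ) (hd : d < Fintype.card σ)
    (hm : ∀ a ∈ s, ∑ j, m a j ≤ d) (k : α → ℕ)
    (hk : ∑ a ∈ s, k a = (p ^ e - 1) * p ^ e)
    (h1 : ∀ j, 0 < ∑ a ∈ s, k a * m a j)
    (h2 : ∀ j, (p ^ e - 1) ∣ ∑ a ∈ s, k a * m a j) :
    p ^ e ∣ Nat.multinomial s k := by
  have hp2 : 2 ≤ p := hp.out.two_le
  have hq : 2 ≤ p ^ e := by
    calc 2 ≤ p := hp2
      _ = p ^ 1 := (pow_one p).symm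
      _ ≤ p ^ e := Nat.pow_le_pow_right (by omega) he
  choose κ c1 c2 c3 _ using fun a => axd_kappa p e hp2 he (k a)
  set Q := p ^ e - 1 with hQ
  have hQ0 : 0 < Q := by omega
  have hA : ∀ i, 2 * Q ≤ ∑ a ∈ s, κ a i := by
    intro i
    have hdvd : Q ∣ ∑ a ∈ s, κ a i := by
      have : ∑ a ∈ s, κ a i ≡ ∑ a ∈ s, p ^ i * k a [MOD Q] :=
        Nat.ModEq.sum fun a _ => c1 a i
      rw [← Finset.mul_sum, hk] at this
      refine (Nat.modEq_zero_iff_dvd).1 (this.trans ?_)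
      exact (Nat.modEq_zero_iff_dvd).2 (Dvd.intro _ (by ring : Q * (p ^ i * p ^ e) = _))
    have hj : ∀ j, Q ≤ ∑ a ∈ s, κ a i * m a j := by
      intro j
      apply Nat.le_of_dvd
      · have := h1 j
        rw [Finset.sum_pos_iff] at this ⊢
        obtain ⟨a, ha, h⟩ := this
        have h' := Nat.pos_of_mul_pos_right h
        have h'' := Nat.pos_of_mul_pos_left h
        exact ⟨a, ha, Nat.mul_pos (c3 a h' i) h''⟩
      · have : ∑ a ∈ s, κ a i * m a j ≡ ∑ a ∈ s, p ^ i * k a * m a j [MOD Q] :=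
          Nat.ModEq.sum fun a _ => (c1 a i).mul_right _
        refine (Nat.modEq_zero_iff_dvd).1 (this.trans ?_)
        refine (Nat.modEq_zero_iff_dvd).2 ?_
        simp_rw [mul_assoc]
        rw [← Finset.mul_sum]
        exact Dvd.dvd.mul_left (h2 j) _
    have hsum : Fintype.card σ * Q ≤ (∑ a ∈ s, κ a i) * d := by
      calc Fintype.card σ * Q = ∑ j : σ, Q := by simp
        _ ≤ ∑ j, ∑ a ∈ s, κ a i * m a j := Finset.sum_le_sum fun j _ => hj j
        _ = ∑ a ∈ s, κ a i * ∑ j, m a j := by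
            rw [Finset.sum_comm]; simp_rw [Finset.mul_sum]
        _ ≤ ∑ a ∈ s, κ a i * d := Finset.sum_le_sum fun a ha => Nat.mul_le_mul_left _ (hm a ha)
        _ = _ := by rw [Finset.sum_mul]
    obtain ⟨z, hz⟩ := hdvd
    have hz2 : 2 ≤ z := by
      by_contra hlt
      have hz1 : z ≤ 1 := by omega
      have : (∑ a ∈ s, κ a i) * d ≤ Q * d := by
        apply Nat.mul_le_mul_right
        rw [hz]
        calc Q * z ≤ Q * 1 := Nat.mul_le_mul_left _ hz1
          _ = Q := mul_one _
      have h3 : d * Q < Fintype.card σ * Q := Nat.mul_lt_mul_of_pos_right hd hQ0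
      have : Fintype.card σ * Q ≤ Q * d := hsum.trans this
      rw [mul_comm Q d] at this
      omega
    rw [hz, mul_comm]
    exact Nat.mul_le_mul_left _ hz2
  have hS : 2 * e * (p - 1) ≤ ∑ a ∈ s, (p.digits (k a)).sum := by
    have h : e * (2 * Q) ≤ ∑ i ∈ Finset.range e, ∑ a ∈ s, κ a i := by
      calc e * (2 * Q) = ∑ i ∈ Finset.range e, 2 * Q := by simp
        _ ≤ _ := Finset.sum_le_sum fun i _ => hA i
    have h' : (∑ i ∈ Finset.range e, ∑ a ∈ s, κ a i) * (p - 1) =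
        (∑ a ∈ s, (p.digits (k a)).sum) * Q := by
      rw [Finset.sum_comm, Finset.sum_mul, Finset.sum_mul]
      exact Finset.sum_congr rfl fun a _ => c2 a
    have h'' := Nat.mul_le_mul_right (p - 1) h
    rw [h'] at h''
    refine Nat.le_of_mul_le_mul_right (c := Q) ?_ hQ0
    calc _ = e * (2 * Q) * (p - 1) := by ring
      _ ≤ _ := h''
  -- valuation
  have hspec := Nat.multinomial_spec s k
  rw [hk] at hspec
  have hpos : Nat.multinomial s k ≠ 0 := (Nat.multinomial_pos s k).ne'
  have hprod : ∏ a ∈ s, (k a).factorial ≠ 0 :=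
    Finset.prod_ne_zero_iff.2 fun a _ => Nat.factorial_ne_zero _
  have hv := congrArg (padicValNat p) hspec
  rw [padicValNat.mul hprod hpos] at hv
  have hvp : padicValNat p (∏ a ∈ s, (k a).factorial) =
      ∑ a ∈ s, padicValNat p (k a).factorial := by
    clear * - hp
    induction s using Finset.induction_on with
    | empty => simp
    | insert a s ha ih =>
      rw [Finset.prod_insert ha, Finset.sum_insert ha, padicValNat.mul (Nat.factorial_ne_zero _)
        (Finset.prod_ne_zero_iff.2 fun a _ => Nat.factorial_ne_zero _), ih]
  rw [hvp] at hv
  have hv2 := congrArg (fun t => (p - 1) * t) hv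
  simp only [mul_add, Finset.mul_sum, sub_one_mul_padicValNat_factorial] at hv2
  have hle := axd_digits_le p e hp2
  rw [← hQ] at hle
  have hsub : ∑ a ∈ s, (k a - (p.digits (k a)).sum) + ∑ a ∈ s, (p.digits (k a)).sum = Q * p ^ e := by
    rw [← Finset.sum_add_distrib, ← hk]
    exact Finset.sum_congr rfl fun a _ => Nat.sub_add_cancel (Nat.digit_sum_le p (k a))
  have hL := Nat.digit_sum_le p (Q * p ^ e)
  have hfin : e * (p - 1) ≤ (p - 1) * padicValNat p (Nat.multinomial s k) := by
    have h2e : 2 * e * (p - 1) = e * (p - 1) + e * (p - 1) := by ring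
    omega
  rw [mul_comm] at hfin
  have := Nat.le_of_mul_le_mul_left hfin (by omega)
  exact (padicValNat_dvd_iff_le hpos).2 this


lemma axd_sum_teich (p : ℕ) [hp : Fact p.Prime] (K : Type*) [Field K] [Fintype K] [CharP K p]
    (a : ℕ) (ha : ¬ (Fintype.card K - 1) ∣ a) :
    ∑ y : K, WittVector.teichmuller p (y ^ a) = 0 := by
  obtain ⟨g, hg⟩ := IsCyclic.exists_generator (α := Kˣ)
  have hord : orderOf g = Fintype.card K - 1 := by
    rw [orderOf_eq_card_of_forall_mem_zpowers hg, Nat.card_eq_fintype_card, Fintype.card_units]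
  have hga : (g : K) ^ a ≠ 1 := by
    intro h
    apply ha
    rw [← hord]
    apply orderOf_dvd_of_pow_eq_one
    ext
    simpa using h
  have hτ : WittVector.teichmuller p ((g : K) ^ a) ≠ 1 := by
    intro h
    apply hga
    have := congrArg (fun w => WittVector.coeff w 0) h
    simpa [WittVector.teichmuller_coeff_zero, -map_pow] using this
  have h1 : ∑ y : K, WittVector.teichmuller p (y ^ a) =
      ∑ y : K, WittVector.teichmuller p (((g : K) * y) ^ a) := by
    refine (Fintype.sum_equiv (Equiv.mulLeft₀ (g : K) g.ne_zero) _ _ ?_).symm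
    intro y; simp
  simp_rw [mul_pow, map_mul] at h1
  rw [← Finset.mul_sum] at h1
  have h2 : (WittVector.teichmuller p ((g : K) ^ a) - 1) *
      ∑ y : K, WittVector.teichmuller p (y ^ a) = 0 := by
    rw [sub_mul, one_mul, ← h1, sub_self]
  rcases mul_eq_zero.1 h2 with h | h
  · exact absurd (sub_eq_zero.1 h) hτ
  · exact h

lemma axd_natCast_dvd (p : ℕ) [hp : Fact p.Prime] (K : Type*) [Field K] [CharP K p]
    (e : ℕ) (z : ℤ) (h : ((p : WittVector p K)) ^ e ∣ (z : WittVector p K)) :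
    (p : ℤ) ^ e ∣ z := by
  have hp0 : (p : WittVector p K) ≠ 0 := (WittVector.irreducible p (k := K)).ne_zero
  induction e generalizing z with
  | zero => simp
  | succ e ih =>
    have h1 : (p : WittVector p K) ∣ (z : WittVector p K) := (dvd_pow_self _ (by omega)).trans h
    obtain ⟨w, hw⟩ := h1
    have h2 := congrArg (WittVector.constantCoeff (p := p) (R := K)) hw
    rw [map_mul, map_intCast, map_natCast, CharP.cast_eq_zero, zero_mul] at h2
    obtain ⟨y, hy⟩ := (CharP.intCast_eq_zero_iff K p z).1 h2
    subst hy
    rw [pow_succ']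
    apply mul_dvd_mul_left
    apply ih
    rw [pow_succ'] at h
    push_cast at h
    exact (mul_dvd_mul_iff_left hp0).1 h

/-- Ax's theorem (weak form): `q` divides the number of zeros when `deg < n`. -/
theorem ax_dvd {σ : Type*} [Fintype σ] (K : Type*) [Field K] [Fintype K]
    (f : MvPolynomial σ K) (hf : f.totalDegree < Fintype.card σ) :
    Fintype.card K ∣ Fintype.card {x : σ → K // MvPolynomial.eval x f = 0} := by
  obtain ⟨p, hpc⟩ := CharP.exists K
  obtain ⟨e, hprime, hcard⟩ := FiniteField.card K p
  haveI : Fact p.Prime := ⟨hprime⟩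
  have he : 1 ≤ (e : ℕ) := e.2
  set q := Fintype.card K with hq
  have hq2 : 2 ≤ q := Fintype.one_lt_card
  let τ := WittVector.teichmuller p (R := K)
  let s := f.support
  let F : (σ → K) → WittVector p K := fun x => ∑ m ∈ s, τ (f.coeff m * ∏ j, x j ^ m j)
  let L := (p ^ (e : ℕ) - 1) * p ^ (e : ℕ)
  have hF0 : ∀ x, WittVector.constantCoeff (F x) = MvPolynomial.eval x f := by
    intro x
    simp only [F, map_sum, MvPolynomial.eval_eq']
    refine Finset.sum_congr rfl fun m _ => ?_
    exact WittVector.teichmuller_coeff_zero p _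
  have hker : ∀ w : WittVector p K, WittVector.constantCoeff w = 0 → (p : WittVector p K) ∣ w := by
    intro w hw
    have : w ∈ RingHom.ker (WittVector.constantCoeff (p := p) (R := K)) := hw
    rw [WittVector.ker_constantCoeff] at this
    exact Ideal.mem_span_singleton.1 this
  have hLe : (e : ℕ) ≤ L := by
    have h1 : (e : ℕ) < p ^ (e : ℕ) := Nat.lt_pow_self hprime.one_lt
    have : 1 * (e : ℕ) ≤ L := Nat.mul_le_mul (by omega) h1.le
    omega
  have hpt : ∀ x, (p : WittVector p K) ^ (e : ℕ) ∣
      F x ^ L - (if MvPolynomial.eval x f = 0 then 0 else 1) := by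
    intro x
    split_ifs with h
    · rw [sub_zero]
      have := hker (F x) (by rw [hF0, h])
      exact (pow_dvd_pow _ hLe).trans (pow_dvd_pow_of_dvd this L)
    · have h1 : (p : WittVector p K) ∣ F x ^ (p ^ (e : ℕ) - 1) - 1 := by
        apply hker
        rw [map_sub, map_pow, map_one, hF0, ← hcard, FiniteField.pow_card_sub_one_eq_one _ h,
          sub_self]
      have h2 := dvd_sub_pow_of_dvd_sub h1 e
      rw [one_pow, ← pow_mul] at h2
      exact (pow_dvd_pow _ (by omega)).trans h2
  have hsum0 : (p : WittVector p K) ^ (e : ℕ) ∣ ∑ x, F x ^ L := by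
    simp only [F]
    simp_rw [Finset.sum_pow_eq_sum_piAntidiag]
    rw [Finset.sum_comm]
    refine Finset.dvd_sum fun k hk => ?_
    rw [← Finset.mul_sum]
    have hkL : ∑ m ∈ s, k m = L := (Finset.mem_piAntidiag.1 hk).1
    have hterm : ∀ x : σ → K, ∏ m ∈ s, τ (f.coeff m * ∏ j, x j ^ m j) ^ k m =
        (∏ m ∈ s, τ (f.coeff m) ^ k m) * ∏ j, τ (x j ^ (∑ m ∈ s, k m * m j)) := by
      intro x
      simp_rw [map_mul, mul_pow]
      rw [Finset.prod_mul_distrib]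
      congr 1
      simp_rw [← map_pow, ← map_prod]
      congr 1
      simp_rw [← Finset.prod_pow, ← Finset.prod_pow_eq_pow_sum]
      rw [Finset.prod_comm]
      refine Finset.prod_congr rfl fun j _ => Finset.prod_congr rfl fun m _ => ?_
      rw [← pow_mul, mul_comm]
    simp_rw [hterm]
    rw [← Finset.mul_sum]
    have hps : ∑ x : σ → K, ∏ j, τ (x j ^ (∑ m ∈ s, k m * m j)) =
        ∏ j, ∑ y : K, τ (y ^ (∑ m ∈ s, k m * m j)) := by
      rw [Finset.prod_univ_sum]
      simp
    rw [hps]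
    by_cases hA : ∀ j, 0 < ∑ m ∈ s, k m * m j ∧ (q - 1) ∣ ∑ m ∈ s, k m * m j
    · apply Dvd.dvd.mul_right
      have := axd_multinomial p e he s (fun m j => m j) f.totalDegree hf (by
        intro m hm
        have := MvPolynomial.le_totalDegree hm
        rwa [Finsupp.sum_fintype _ _ (fun _ => rfl)] at this) k hkL (fun j => (hA j).1) (by
        intro j
        rw [← hcard]
        exact (hA j).2)
      have h3 := (Nat.castRingHom (WittVector p K)).map_dvd this
      simpa using h3
    · push Not at hA
      obtain ⟨j, hj⟩ := hA
      apply Dvd.dvd.mul_left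
      apply Dvd.dvd.mul_left
      refine dvd_trans ?_ (Finset.dvd_prod_of_mem _ (Finset.mem_univ j))
      rcases Nat.eq_zero_or_pos (∑ m ∈ s, k m * m j) with h0 | h0
      · rw [h0]
        simp only [pow_zero, map_one, Finset.sum_const, Finset.card_univ, nsmul_eq_mul, mul_one]
        rw [← hq, hcard]
        simp
      · rw [axd_sum_teich p K _ (hj h0)]
        exact dvd_zero _
  have hdiff : (p : WittVector p K) ^ (e : ℕ) ∣
      ∑ x : σ → K, (if MvPolynomial.eval x f = 0 then (0 : WittVector p K) else 1) := by
    have h1 : (p : WittVector p K) ^ (e : ℕ) ∣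
      ∑ x : σ → K, (F x ^ L - (if MvPolynomial.eval x f = 0 then (0 : WittVector p K) else 1)) :=
      Finset.dvd_sum fun x _ => hpt x
    rw [Finset.sum_sub_distrib] at h1
    exact (dvd_sub_right hsum0).1 h1
  have hcount : ∑ x : σ → K, (if MvPolynomial.eval x f = 0 then (0 : WittVector p K) else 1) =
      ((((q ^ Fintype.card σ : ℕ) : ℤ) -
        (Fintype.card {x : σ → K // MvPolynomial.eval x f = 0} : ℤ) : ℤ) : WittVector p K) := by
    have h1 : ∀ x : σ → K, (if MvPolynomial.eval x f = 0 then (0 : WittVector p K) else 1) =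
       1 - (if MvPolynomial.eval x f = 0 then (1 : WittVector p K) else 0) := by
      intro x; split_ifs <;> simp
    simp_rw [h1]
    rw [Finset.sum_sub_distrib, Finset.sum_boole, Fintype.card_subtype]
    simp [hq]
  rw [hcount] at hdiff
  have := axd_natCast_dvd p K e _ hdiff
  have hq' : ((p : ℤ) ^ (e : ℕ)) = (q : ℤ) := by rw [hcard]; simp
  rw [hq'] at this
  have h4 : (q : ℤ) ∣ ((q ^ Fintype.card σ : ℕ) : ℤ) := by
    push_cast
    exact dvd_pow_self _ (by omega)
  have h5 := (dvd_sub_right h4).1 this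
  exact_mod_cast h5

set_option linter.unusedSectionVars false

/-! Part C1: counting points. -/

section Counting
variable {ι K : Type*} [Fintype ι] [DecidableEq ι] [Field K] [Fintype K]

noncomputable def cbase (K : Type*) [Field K] [Fintype K] (S : Finset ι) : Finset (ι → K) :=
  Finset.univ.filter fun x => ∀ i ∈ S, x i = 0

noncomputable def cnt (S : Finset ι) (P : (ι → K) → Prop) : ℤ :=
  ∑ x ∈ cbase K S, if P x then 1 else 0

lemma mem_cbase {S : Finset ι} {x : ι → K} : x ∈ cbase K S ↔ ∀ i ∈ S, x i = 0 := by
  simp [cbase]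

lemma cnt_congr {S : Finset ι} {P Q : (ι → K) → Prop}
    (h : ∀ x, (∀ i ∈ S, x i = 0) → (P x ↔ Q x)) : cnt S P = cnt S Q := by
  refine Finset.sum_congr rfl fun x hx => ?_
  rw [mem_cbase] at hx
  simp only [h x hx]

lemma card_cbase (S : Finset ι) :
    (cbase K S).card = Fintype.card K ^ (Fintype.card ι - S.card) := by
  have : cbase K S = Fintype.piFinset (fun i => if i ∈ S then {0} else (Finset.univ : Finset K)) := by
    ext x
    simp only [mem_cbase, Fintype.mem_piFinset]
    refine forall_congr' fun i => ?_
    by_cases h : i ∈ S <;> simp [h]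
  rw [this, Fintype.card_piFinset]
  have : ∀ i, (if i ∈ S then {0} else (Finset.univ : Finset K)).card =
      if i ∈ S then 1 else Fintype.card K := by
    intro i; split_ifs <;> simp
  simp_rw [this]
  rw [Finset.prod_ite]
  simp only [Finset.prod_const_one, one_mul, Finset.prod_const]
  congr 1
  rw [Finset.filter_not, Finset.card_sdiff]
  simp

lemma cnt_true (S : Finset ι) : cnt (K := K) S (fun _ => True) =
    (Fintype.card K : ℤ) ^ (Fintype.card ι - S.card) := by
  simp [cnt, card_cbase]

lemma cnt_add_not (S : Finset ι) (P : (ι → K) → Prop) :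
    cnt S P + cnt S (fun x => ¬ P x) = (Fintype.card K : ℤ) ^ (Fintype.card ι - S.card) := by
  rw [← cnt_true, cnt, cnt, cnt, ← Finset.sum_add_distrib]
  refine Finset.sum_congr rfl fun x _ => ?_
  by_cases h : P x <;> simp [h]

lemma cnt_not (S : Finset ι) (P : (ι → K) → Prop) (h : S.card < Fintype.card ι) :
    cnt S (fun x => ¬ P x) ≡ - cnt S P [ZMOD Fintype.card K] := by
  have := cnt_add_not S P
  rw [Int.modEq_iff_dvd]
  have h2 : - cnt S P - cnt S (fun x => ¬ P x) =
      - (Fintype.card K : ℤ) ^ (Fintype.card ι - S.card) := by rw [← this]; ring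
  rw [h2]
  exact (dvd_pow_self _ (by omega)).neg_right

lemma sum_cbase (S : Finset ι) (k : ι) (hk : k ∉ S) (g : (ι → K) → ℤ) :
    ∑ x ∈ cbase K S, g x =
      ∑ x ∈ cbase K (insert k S), ∑ t : K, g (Function.update x k t) := by
  rw [← Finset.sum_product']
  refine Finset.sum_bij' (fun x _ => (Function.update x k 0, x k))
    (fun y _ => Function.update y.1 k y.2) ?_ ?_ ?_ ?_ ?_
  · intro x hx
    rw [mem_cbase] at hx
    simp only [Finset.mem_product, mem_cbase, Finset.mem_univ, and_true, Finset.mem_insert]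
    rintro i (rfl | hi)
    · simp
    · have : i ≠ k := fun h => hk (h ▸ hi)
      simp [this, hx i hi]
  · intro y hy
    simp only [Finset.mem_product, mem_cbase, Finset.mem_univ, and_true, Finset.mem_insert] at hy ⊢
    intro i hi
    have : i ≠ k := fun h => hk (h ▸ hi)
    simp [this, hy i (Or.inr hi)]
  · intro x _; simp
  · intro y hy
    simp only [Finset.mem_product, mem_cbase, Finset.mem_univ, and_true, Finset.mem_insert] at hy
    have : y.1 k = 0 := hy k (Or.inl rfl)
    ext i
    · by_cases h : i = k
      · subst h; simp [this]
      · simp [h]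
    · simp
  · intro x _; simp

lemma root_one (a b : K) : (∑ t : K, if t * a + b = 0 then (1 : ℤ) else 0) =
    (if ¬ a = 0 then 1 else 0) + (Fintype.card K : ℤ) * (if a = 0 ∧ b = 0 then 1 else 0) := by
  by_cases ha : a = 0
  · subst ha
    by_cases hb : b = 0 <;> simp [hb]
  · have : ∀ t : K, t * a + b = 0 ↔ t = - b / a := by
      intro t
      rw [eq_div_iff ha, eq_neg_iff_add_eq_zero]
    simp [this, ha]

lemma root_two (a b c d : K) :
    (∑ t : K, if t * a + b = 0 ∧ t * c + d = 0 then (1 : ℤ) else 0) ≡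
    (if a * d - b * c = 0 then 1 else 0) - (if a = 0 ∧ c = 0 then 1 else 0)
      [ZMOD Fintype.card K] := by
  by_cases ha : a = 0
  · subst ha
    by_cases hc : c = 0
    · subst hc
      by_cases h : b = 0 ∧ d = 0
      · simp [h.1, h.2, Int.ModEq]
      · simp [h]
    · have : ∀ t : K, (t * 0 + b = 0 ∧ t * c + d = 0) ↔ (t = - d / c ∧ b = 0) := by
        intro t
        rw [eq_div_iff hc, eq_neg_iff_add_eq_zero]
        simp [and_comm]
      simp only [this]
      by_cases hb : b = 0 <;> simp [hb, hc]
  · have : ∀ t : K, (t * a + b = 0 ∧ t * c + d = 0) ↔ (t = - b / a ∧ a * d - b * c = 0) := by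
      intro t
      constructor
      · rintro ⟨h1, h2⟩
        refine ⟨?_, ?_⟩
        · rw [eq_div_iff ha, eq_neg_iff_add_eq_zero]; exact h1
        · linear_combination a * h2 - c * h1
      · rintro ⟨rfl, h⟩
        refine ⟨by field_simp; ring, ?_⟩
        field_simp
        linear_combination h
    by_cases h : a * d - b * c = 0 <;> simp [this, ha, h]

lemma root_mul (a b c d : K) :
    (∑ t : K, if (t * a + b) * (t * c + d) = 0 then (1 : ℤ) else 0) ≡
    (if ¬ a * c = 0 then 1 else 0) + (if ¬ a * d - b * c = 0 then 1 else 0)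
      [ZMOD Fintype.card K] := by
  have h1 : (∑ t : K, if (t * a + b) * (t * c + d) = 0 then (1 : ℤ) else 0) =
      (∑ t : K, if t * a + b = 0 then (1 : ℤ) else 0) +
      (∑ t : K, if t * c + d = 0 then (1 : ℤ) else 0) -
      (∑ t : K, if t * a + b = 0 ∧ t * c + d = 0 then (1 : ℤ) else 0) := by
    rw [← Finset.sum_add_distrib, ← Finset.sum_sub_distrib]
    refine Finset.sum_congr rfl fun t _ => ?_
    by_cases hx : t * a + b = 0 <;> by_cases hy : t * c + d = 0 <;> simp [hx, hy]
  rw [h1, root_one, root_one]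
  have h2 := root_two a b c d
  have e : ∀ u : ℤ, (Fintype.card K : ℤ) * u ≡ 0 [ZMOD Fintype.card K] := fun u =>
    Int.modEq_zero_iff_dvd.2 (dvd_mul_right _ _)
  refine ((((Int.ModEq.refl _).add (e _)).add ((Int.ModEq.refl _).add (e _))).sub h2).trans ?_
  by_cases ha : a = 0 <;> by_cases hc : c = 0 <;> by_cases hr : a * d - b * c = 0 <;>
    simp_all

lemma cnt_elim_one (S : Finset ι) (k : ι) (hk : k ∉ S) (F a : (ι → K) → K)
    (hF : ∀ x, x k = 0 → ∀ t, F (Function.update x k t) = t * a x + F x) :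
    cnt S (fun x => F x = 0) = cnt (insert k S) (fun x => ¬ a x = 0) +
      Fintype.card K * cnt (insert k S) (fun x => a x = 0 ∧ F x = 0) := by
  unfold cnt
  rw [sum_cbase (K := K) S k hk, Finset.mul_sum, ← Finset.sum_add_distrib]
  refine Finset.sum_congr rfl fun x hx => ?_
  have hx0 : x k = 0 := (mem_cbase.1 hx) k (Finset.mem_insert_self _ _)
  simp only [hF x hx0]
  convert root_one (a x) (F x)

lemma cnt_elim_two (S : Finset ι) (k : ι) (hk : k ∉ S) (F a G c : (ι → K) → K)
    (hF : ∀ x, x k = 0 → ∀ t, F (Function.update x k t) = t * a x + F x)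
    (hG : ∀ x, x k = 0 → ∀ t, G (Function.update x k t) = t * c x + G x) :
    cnt S (fun x => F x = 0 ∧ G x = 0) ≡
      cnt (insert k S) (fun x => a x * G x - F x * c x = 0) -
      cnt (insert k S) (fun x => a x = 0 ∧ c x = 0) [ZMOD Fintype.card K] := by
  unfold cnt
  rw [sum_cbase (K := K) S k hk, ← Finset.sum_sub_distrib]
  refine Int.ModEq.sum fun x hx => ?_
  have hx0 : x k = 0 := (mem_cbase.1 hx) k (Finset.mem_insert_self _ _)
  simp only [hF x hx0, hG x hx0]
  convert root_two (a x) (F x) (c x) (G x)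

lemma cnt_elim_mul (S : Finset ι) (k : ι) (hk : k ∉ S) (F a G c : (ι → K) → K)
    (hN : S.card + 1 < Fintype.card ι)
    (hF : ∀ x, x k = 0 → ∀ t, F (Function.update x k t) = t * a x + F x)
    (hG : ∀ x, x k = 0 → ∀ t, G (Function.update x k t) = t * c x + G x) :
    cnt S (fun x => F x * G x = 0) ≡
      - cnt (insert k S) (fun x => a x * c x = 0) -
      cnt (insert k S) (fun x => a x * G x - F x * c x = 0) [ZMOD Fintype.card K] := by
  have hc : (insert k S).card < Fintype.card ι := by
    rw [Finset.card_insert_of_notMem hk]; exact hN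
  refine Int.ModEq.trans ?_ ((cnt_not (insert k S) (fun x => a x * c x = 0) hc).add
    (cnt_not (insert k S) (fun x => a x * G x - F x * c x = 0) hc))
  unfold cnt
  rw [sum_cbase (K := K) S k hk, ← Finset.sum_add_distrib]
  refine Int.ModEq.sum fun x hx => ?_
  have hx0 : x k = 0 := (mem_cbase.1 hx) k (Finset.mem_insert_self _ _)
  simp only [hF x hx0, hG x hx0]
  convert root_mul (a x) (F x) (c x) (G x)

/-- `F` is given by a polynomial of total degree at most `d`. -/
def HasDeg (F : (ι → K) → K) (d : ℕ) : Prop :=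
  ∃ f : MvPolynomial ι K, f.totalDegree ≤ d ∧ ∀ x, MvPolynomial.eval x f = F x

lemma HasDeg.mul {F G : (ι → K) → K} {d d' : ℕ} (h : HasDeg F d) (h' : HasDeg G d') :
    HasDeg (fun x => F x * G x) (d + d') := by
  obtain ⟨f, h1, h2⟩ := h
  obtain ⟨g, h3, h4⟩ := h'
  exact ⟨f * g, (MvPolynomial.totalDegree_mul _ _).trans (add_le_add h1 h3), fun x => by
    simp [h2, h4]⟩

lemma HasDeg.mono {F : (ι → K) → K} {d d' : ℕ} (h : HasDeg F d) (hd : d ≤ d') : HasDeg F d' := by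
  obtain ⟨f, h1, h2⟩ := h
  exact ⟨f, h1.trans hd, h2⟩

lemma cnt_ax (S : Finset ι) (F : (ι → K) → K) (d : ℕ) (hF : HasDeg F d)
    (h : d + S.card < Fintype.card ι) :
    cnt S (fun x => F x = 0) ≡ 0 [ZMOD Fintype.card K] := by
  obtain ⟨f, h1, h2⟩ := hF
  let φ : ι → MvPolynomial {i // i ∉ S} K := fun i =>
    if hi : i ∈ S then 0 else MvPolynomial.X ⟨i, hi⟩
  let ex : ({i // i ∉ S} → K) → (ι → K) := fun y i => if hi : i ∈ S then 0 else y ⟨i, hi⟩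
  let g := MvPolynomial.aeval φ f
  have hg : ∀ y, MvPolynomial.eval y g = F (ex y) := by
    intro y
    rw [← h2]
    simp only [g]
    rw [MvPolynomial.aeval_def, MvPolynomial.eval₂_eq', MvPolynomial.eval_eq' (ex y), map_sum]
    refine Finset.sum_congr rfl fun m _ => ?_
    rw [map_mul, map_prod, MvPolynomial.algebraMap_eq, MvPolynomial.eval_C]
    congr 1
    refine Finset.prod_congr rfl fun i _ => ?_
    rw [map_pow]
    congr 1
    by_cases hi : i ∈ S <;> simp [φ, ex, hi]
  have hdeg : g.totalDegree ≤ d := by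
    refine le_trans ?_ h1
    simp only [g, MvPolynomial.aeval_def, MvPolynomial.eval₂_eq']
    refine MvPolynomial.totalDegree_finsetSum_le fun m hm => ?_
    refine (MvPolynomial.totalDegree_mul _ _).trans ?_
    rw [MvPolynomial.algebraMap_eq, MvPolynomial.totalDegree_C, zero_add]
    refine (MvPolynomial.totalDegree_finsetProd _ _).trans ?_
    refine le_trans ?_ (MvPolynomial.le_totalDegree hm)
    rw [Finsupp.sum_fintype _ _ (fun _ => rfl)]
    refine Finset.sum_le_sum fun i _ => ?_
    refine (MvPolynomial.totalDegree_pow _ _).trans ?_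
    have : (φ i).totalDegree ≤ 1 := by
      simp only [φ]
      split_ifs
      · simp
      · simp
    simpa using Nat.mul_le_mul_left (m i) this
  have hcard : Fintype.card {i // i ∉ S} = Fintype.card ι - S.card := by
    simp [Fintype.card_subtype_compl]
  have key := ax_dvd K g (by rw [hcard]; omega)
  have hc : cnt S (fun x => F x = 0) =
      (Fintype.card {y : {i // i ∉ S} → K // MvPolynomial.eval y g = 0} : ℤ) := by
    rw [cnt, Finset.sum_boole, Fintype.card_subtype]
    norm_cast
    refine Finset.card_bij' (fun x _ => fun i => x i.1) (fun y _ => ex y) ?_ ?_ ?_ ?_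
    · intro x hx
      simp only [Finset.mem_filter, mem_cbase, Finset.mem_univ, true_and] at hx ⊢
      rw [hg]
      rw [← hx.2]
      congr 1
      ext i
      simp only [ex]
      split_ifs with hi
      · exact (hx.1 i hi).symm
      · rfl
    · intro y hy
      simp only [Finset.mem_filter, mem_cbase, Finset.mem_univ, true_and] at hy ⊢
      refine ⟨fun i hi => by simp [ex, hi], ?_⟩
      rw [← hg]; exact hy
    · intro x hx
      simp only [Finset.mem_filter, mem_cbase] at hx
      ext i
      simp only [ex]
      split_ifs with hi
      · exact (hx.1 i hi).symm
      · rfl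
    · intro y hy
      ext i
      simp [ex, i.2]
  rw [hc]
  exact Int.modEq_zero_iff_dvd.2 (by exact_mod_cast key)

lemma cnt_and (S : Finset ι) (F G : (ι → K) → K) :
    cnt S (fun x => F x = 0 ∧ G x = 0) = cnt S (fun x => F x = 0) + cnt S (fun x => G x = 0) -
      cnt S (fun x => F x * G x = 0) := by
  rw [cnt, cnt, cnt, cnt, ← Finset.sum_add_distrib, ← Finset.sum_sub_distrib]
  refine Finset.sum_congr rfl fun x _ => ?_
  by_cases h : F x = 0 <;> by_cases h' : G x = 0 <;> simp [h, h']

lemma cnt_ax_two (S : Finset ι) (F G : (ι → K) → K) (d d' : ℕ) (hF : HasDeg F d)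
    (hG : HasDeg G d') (h : d + d' + S.card < Fintype.card ι) :
    cnt S (fun x => F x = 0 ∧ G x = 0) ≡ 0 [ZMOD Fintype.card K] := by
  rw [cnt_and]
  simpa using ((cnt_ax S F d hF (by omega)).add (cnt_ax S G d' hG (by omega))).sub
    (cnt_ax S _ _ (hF.mul hG) h)

end Counting


/-! Part C2: determinant identities. -/

section DetId
variable {n R : Type*} [Fintype n] [DecidableEq n] [CommRing R]

lemma det_updateRow_swap (A : Matrix n n R) {i j : n} (hij : i ≠ j) (v : n → R) :
    ((A.updateRow j v).updateRow i (A j)).det = - (A.updateRow i v).det := by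
  have h := Matrix.det_permute (Equiv.swap i j) (A.updateRow i v)
  rw [Equiv.Perm.sign_swap hij] at h
  have e : (A.updateRow i v).submatrix (Equiv.swap i j) id = (A.updateRow j v).updateRow i (A j) := by
    ext r c
    by_cases hr : r = i
    · subst hr
      simp [Matrix.updateRow_apply, hij.symm]
    · by_cases hr' : r = j
      · subst hr'
        simp [Matrix.updateRow_apply, hij.symm]
      · simp [Matrix.updateRow_apply, hr, hr', Equiv.swap_apply_of_ne_of_ne hr hr']
  rw [e] at h
  rw [h]; simp

lemma det_DJ (A : Matrix n n R) {i j : n} (hij : i ≠ j) (u v : n → R) :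
    ((A.updateRow i u).updateRow j v).det * A.det =
      (A.updateRow i u).det * (A.updateRow j v).det -
      (A.updateRow j u).det * (A.updateRow i v).det := by
  have h1 : A.det • u = ∑ k, (A.updateRow k u).det • A k := by
    have h := Matrix.mulVec_cramer Aᵀ u
    rw [Matrix.det_transpose] at h
    rw [← h]
    ext c
    simp only [Matrix.mulVec, dotProduct, Matrix.transpose_apply, Matrix.cramer_transpose_apply,
      Finset.sum_apply, Pi.smul_apply, smul_eq_mul]
    exact Finset.sum_congr rfl fun k _ => mul_comm _ _
  have h2 : A.det • u = (∑ k, (A.updateRow k u).det • (A.updateRow j v) k) +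
      (A.updateRow j u).det • (A j) - (A.updateRow j u).det • v := by
    rw [h1]
    rw [← Finset.add_sum_erase _ _ (Finset.mem_univ j),
      ← Finset.add_sum_erase (Finset.univ) (fun k => (A.updateRow k u).det • (A.updateRow j v) k)
        (Finset.mem_univ j)]
    have : ∑ k ∈ Finset.univ.erase j, (A.updateRow k u).det • (A.updateRow j v) k =
        ∑ k ∈ Finset.univ.erase j, (A.updateRow k u).det • A k := by
      refine Finset.sum_congr rfl fun k hk => ?_
      rw [Matrix.updateRow_ne (Finset.ne_of_mem_erase hk)]
    rw [this, Matrix.updateRow_self]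
    abel
  rw [Matrix.updateRow_comm _ hij]
  have h3 : ((A.updateRow j v).updateRow i u).det * A.det =
      ((A.updateRow j v).updateRow i (A.det • u)).det := by
    rw [Matrix.det_updateRow_smul, mul_comm]
  rw [h3, h2, sub_eq_add_neg, ← neg_smul, Matrix.det_updateRow_add, Matrix.det_updateRow_add,
    Matrix.det_updateRow_smul, Matrix.det_updateRow_smul, Matrix.det_updateRow_sum,
    det_updateRow_swap A hij]
  have h4 : ((A.updateRow j v).updateRow i v).det = 0 := by
    refine Matrix.det_zero_of_row_eq hij ?_
    ext c
    simp [Matrix.updateRow_apply]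
  rw [h4]
  simp only [smul_eq_mul]
  ring

lemma det_row_symm (A : Matrix n n R) (hA : Aᵀ = A) (i j : n) :
    (A.updateRow i (Pi.single j 1)).det = (A.updateRow j (Pi.single i 1)).det := by
  have h := Matrix.adjugate_transpose A
  rw [hA] at h
  have h2 := congrFun (congrFun h i) j
  rw [Matrix.transpose_apply, Matrix.adjugate_apply, Matrix.adjugate_apply] at h2
  exact h2

lemma plucker_mul (A : Matrix n n R) (hA : Aᵀ = A) (a b c d : n) (hab : a ≠ b) (hac : a ≠ c)
    (had : a ≠ d) :
    (((A.updateRow a (Pi.single c 1)).updateRow b (Pi.single d 1)).det -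
      ((A.updateRow a (Pi.single b 1)).updateRow c (Pi.single d 1)).det +
      ((A.updateRow a (Pi.single b 1)).updateRow d (Pi.single c 1)).det) * A.det = 0 := by
  rw [add_mul, sub_mul, det_DJ A hab, det_DJ A hac, det_DJ A had]
  rw [det_row_symm A hA b c, det_row_symm A hA b d, det_row_symm A hA c d]
  ring

lemma plucker_symm {K : Type*} [Field K] (A : Matrix n n K) (hA : Aᵀ = A) (a b c d : n)
    (hab : a ≠ b) (hac : a ≠ c) (had : a ≠ d) :
    ((A.updateRow a (Pi.single c 1)).updateRow b (Pi.single d 1)).det -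
      ((A.updateRow a (Pi.single b 1)).updateRow c (Pi.single d 1)).det +
      ((A.updateRow a (Pi.single b 1)).updateRow d (Pi.single c 1)).det = 0 := by
  let B : Matrix n n (Polynomial K) := (-A).charmatrix
  have hB : Bᵀ = B := by
    simp [B, Matrix.charmatrix, hA, ← Matrix.transpose_map]
  have h := plucker_mul B hB a b c d hab hac had
  have hne : B.det ≠ 0 := (Matrix.charpoly_monic (-A)).ne_zero
  have h0 := (mul_eq_zero.1 h).resolve_right hne
  have h1 := congrArg (Polynomial.evalRingHom (0 : K)) h0
  have hm : B.map (Polynomial.evalRingHom (0 : K)) = A := by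
    ext i j
    by_cases hij : i = j
    · subst hij; simp [B, Matrix.charmatrix]
    · simp [B, Matrix.charmatrix, hij]
  have hs : ∀ i : n, (Polynomial.evalRingHom (0 : K)) ∘ (Pi.single i (1 : Polynomial K)) = Pi.single i (1 : K) := by
    intro i
    ext j
    by_cases hij : j = i
    · subst hij; simp
    · simp [hij]
  simp only [map_add, map_sub, map_zero, RingHom.map_det, RingHom.mapMatrix_apply,
    Matrix.map_updateRow, hm, hs] at h1
  exact h1

end DetId

set_option linter.unusedSectionVars false
set_option linter.unusedSimpArgs false

/-! Part C3: the updated determinants `Xd`. -/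

section Xd
variable {ι W R : Type*} [Fintype ι] [Fintype W] [DecidableEq ι] [DecidableEq W] [CommRing R]

noncomputable def rowM (E : Matrix ι W R) (P : ι → Option ι) (x : ι → R) :
    Matrix (ι ⊕ W) (ι ⊕ W) R :=
  Matrix.of fun r c =>
    match r with
    | Sum.inl i => match P i with
      | none => Sum.elim (fun j => if i = j then x i else 0) (fun w => E i w) c
      | some j => (Pi.single (Sum.inl j) 1 : ι ⊕ W → R) c
    | Sum.inr w => Sum.elim (fun j => E j w) (fun _ => 0) c

noncomputable def Xd (E : Matrix ι W R) (P : ι → Option ι) (x : ι → R) : R := (rowM E P x).det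

/-- add one row replacement -/
noncomputable def up (P : ι → Option ι) (i j : ι) : ι → Option ι := Function.update P i (some j)

/-- no row replacement -/
def p0 : ι → Option ι := fun _ => none

lemma rowM_up (E : Matrix ι W R) (P : ι → Option ι) (i j : ι) (x : ι → R) :
    rowM E (up P i j) x = (rowM E P x).updateRow (Sum.inl i) (Pi.single (Sum.inl j) 1) := by
  ext r c
  rcases r with r | r
  · by_cases h : r = i
    · subst h; simp [rowM, up]
    · rw [Matrix.updateRow_ne (by simpa using h)]
      simp [rowM, up, Function.update_of_ne h]
  · rw [Matrix.updateRow_ne (by simp)]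
    simp [rowM]

lemma rowM_symm (E : Matrix ι W R) (x : ι → R) : (rowM E p0 x)ᵀ = rowM E p0 x := by
  ext r c
  rcases r with r | r <;> rcases c with c | c <;> simp [rowM, p0]
  by_cases h : r = c
  · subst h; simp
  · simp [h, Ne.symm h]

lemma up_comm (P : ι → Option ι) {i k : ι} (h : i ≠ k) (j l : ι) :
    up (up P i j) k l = up (up P k l) i j := by
  unfold up; rw [Function.update_comm h]

lemma Xd_DJ (E : Matrix ι W R) (P : ι → Option ι) (x : ι → R) {i j : ι} (hij : i ≠ j) (a b : ι) :
    Xd E (up (up P i a) j b) x * Xd E P x =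
      Xd E (up P i a) x * Xd E (up P j b) x - Xd E (up P j a) x * Xd E (up P i b) x := by
  simp only [Xd, rowM_up]
  exact det_DJ _ (by simpa using hij) _ _

lemma Xd_update (E : Matrix ι W R) (P : ι → Option ι) (k : ι) (hk : P k = none) (x : ι → R)
    (hx : x k = 0) (t : R) :
    Xd E P (Function.update x k t) = t * Xd E (up P k k) x + Xd E P x := by
  have h1 : rowM E P (Function.update x k t) =
      (rowM E P x).updateRow (Sum.inl k)
        (t • (Pi.single (Sum.inl k) 1) + (rowM E P x) (Sum.inl k)) := by
    ext r c
    rcases r with r | r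
    · by_cases h : r = k
      · subst h
        rcases c with c | c
        · by_cases hc : r = c
          · subst hc; simp [rowM, hk, hx]
          · simp [rowM, hk, hc, Ne.symm hc]
        · simp [rowM, hk]
      · rw [Matrix.updateRow_ne (by simpa using h)]
        rcases h' : P r with _ | j <;> simp [rowM, h', h]
    · rw [Matrix.updateRow_ne (by simp)]
      simp [rowM]
  unfold Xd
  rw [h1, Matrix.det_updateRow_add, Matrix.det_updateRow_smul, Matrix.updateRow_eq_self, rowM_up]

lemma Xd_indep (E : Matrix ι W R) (P : ι → Option ι) (k : ι) (hk : P k ≠ none) (x : ι → R)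
    (t : R) : Xd E P (Function.update x k t) = Xd E P x := by
  unfold Xd
  congr 1
  ext r c
  rcases r with r | r
  · by_cases h : r = k
    · subst h
      obtain ⟨j, hj⟩ := Option.ne_none_iff_exists'.1 hk
      simp [rowM, hj]
    · rcases h' : P r with _ | j <;> simp [rowM, h', h]
  · simp [rowM]

lemma Xd_diff (E : Matrix ι W R) (P : ι → Option ι) (k : ι) (hk : P k = none) (x : ι → R) :
    Xd E (up P k k) x = Xd E P (Function.update x k 1) - Xd E P (Function.update x k 0) := by
  have h := Xd_update E P k hk (Function.update x k 0) (by simp) 1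
  rw [Function.update_idem, Xd_indep E (up P k k) k (by simp [up])] at h
  rw [h]; ring

/-- diagonal replacement on `Z` -/
noncomputable def dg (Z : Finset ι) : ι → Option ι := fun i => if i ∈ Z then some i else none

lemma dg_empty : dg (∅ : Finset ι) = p0 := by
  ext i; simp [dg, p0]

lemma dg_insert (Z : Finset ι) (k : ι) : dg (insert k Z) = up (dg Z) k k := by
  funext i
  by_cases h : i = k
  · subst h; simp [dg, up]
  · simp [dg, up, h]

lemma Xd_symm (E : Matrix ι W R) (Z : Finset ι) (k l : ι) (hk : k ∉ Z) (hl : l ∉ Z)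
    (x : ι → R) : Xd E (up (dg Z) k l) x = Xd E (up (dg Z) l k) x := by
  induction Z using Finset.induction_on generalizing x with
  | empty =>
    rw [dg_empty]
    simp only [Xd, rowM_up]
    exact det_row_symm _ (rowM_symm E x) _ _
  | insert z Z hz ih =>
    simp only [Finset.mem_insert, not_or] at hk hl
    rw [dg_insert, up_comm _ (Ne.symm hk.1), up_comm _ (Ne.symm hl.1), Xd_diff, Xd_diff, ih hk.2 hl.2,
      ih hk.2 hl.2]
    · simp [up, dg, hz, Ne.symm hl.1]
    · simp [up, dg, hz, Ne.symm hk.1]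

lemma Xd_plucker {K : Type*} [Field K] (E : Matrix ι W K) (Z : Finset ι) (a b c d : ι)
    (ha : a ∉ Z) (hb : b ∉ Z) (hc : c ∉ Z) (hd : d ∉ Z)
    (hab : a ≠ b) (hac : a ≠ c) (had : a ≠ d) (x : ι → K) :
    Xd E (up (up (dg Z) a c) b d) x - Xd E (up (up (dg Z) a b) c d) x +
      Xd E (up (up (dg Z) a b) d c) x = 0 := by
  induction Z using Finset.induction_on generalizing x with
  | empty =>
    rw [dg_empty]
    simp only [Xd, rowM_up]
    exact plucker_symm _ (rowM_symm E x) _ _ _ _ (by simpa using hab) (by simpa using hac)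
      (by simpa using had)
  | insert z Z hz ih =>
    simp only [Finset.mem_insert, not_or] at ha hb hc hd
    rw [dg_insert, up_comm _ (Ne.symm ha.1), up_comm _ (Ne.symm ha.1), up_comm _ (Ne.symm hb.1),
      up_comm _ (Ne.symm hc.1), up_comm _ (Ne.symm hd.1), Xd_diff, Xd_diff, Xd_diff]
    · have h1 := ih ha.2 hb.2 hc.2 hd.2 (Function.update x z 1)
      have h0 := ih ha.2 hb.2 hc.2 hd.2 (Function.update x z 0)
      linear_combination h1 - h0
    all_goals
      simp [up, dg, hz, Ne.symm ha.1, Ne.symm hb.1, Ne.symm hc.1, Ne.symm hd.1]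

lemma Xd_map {R' : Type*} [CommRing R'] (φ : R →+* R') (E : Matrix ι W R) (P : ι → Option ι)
    (x : ι → R) : φ (Xd E P x) = Xd (E.map φ) P (fun i => φ (x i)) := by
  unfold Xd
  rw [RingHom.map_det]
  congr 1
  ext r c
  rcases r with r | r
  · rcases h' : P r with _ | j
    · rcases c with c | c
      · by_cases hc : r = c
        · subst hc; simp [rowM, h']
        · simp [rowM, h', hc]
      · simp [rowM, h']
    · by_cases hc : c = Sum.inl j
      · subst hc; simp [rowM, h']
      · simp [rowM, h', hc]
  · rcases c with c | c <;> simp [rowM]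

/-- number of replaced rows -/
noncomputable def nup (P : ι → Option ι) : ℕ := (Finset.univ.filter fun i => P i ≠ none).card

lemma nup_p0 : nup (p0 : ι → Option ι) = 0 := by simp [nup, p0]

lemma nup_up (P : ι → Option ι) (i j : ι) (h : P i = none) : nup (up P i j) = nup P + 1 := by
  unfold nup
  rw [← Finset.card_insert_of_notMem (a := i) (by simp [h])]
  congr 1
  ext k
  by_cases hk : k = i
  · subst hk; simp [up, h, Function.update_apply]
  · simp [up, hk, Function.update_apply]

lemma nup_dg (Z : Finset ι) : nup (dg Z) = Z.card := by
  unfold nup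
  congr 1
  ext i; by_cases h : i ∈ Z <;> simp [dg, h]

lemma Xd_term (E : Matrix ι W R) (P : ι → Option ι) (s : Equiv.Perm (ι ⊕ W)) :
    (∏ c, rowM (E.map MvPolynomial.C) P (MvPolynomial.X : ι → MvPolynomial ι R) (s c) c) = 0 ∨
    ∃ d, Fintype.card ι = Fintype.card W + nup P + d ∧
      (∏ c, rowM (E.map MvPolynomial.C) P (MvPolynomial.X : ι → MvPolynomial ι R) (s c) c).IsHomogeneous d := by
  let NU : ι ⊕ W → Prop := fun r => Sum.elim (fun i => P i = none) (fun _ => False) r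
  by_cases hz : ∀ w, NU (s (Sum.inr w))
  · right
    let dgr : ι ⊕ W → ℕ := Sum.elim (fun j => if NU (s (Sum.inl j)) then 1 else 0) (fun _ => 0)
    refine ⟨∑ c, dgr c, ?_, ?_⟩
    · have h1 : (Finset.univ.filter NU).card = (Finset.univ.filter (fun c => NU (s c))).card := by
        refine (Finset.card_bij (fun c _ => s c) ?_ ?_ ?_).symm
        · intro c hc; simpa using hc
        · intro a _ b _ h; exact s.injective h
        · intro r hr; exact ⟨s.symm r, by simpa using hr, by simp⟩
      have h2 : (Finset.univ.filter (fun c => NU (s c))).card = Fintype.card W + ∑ c, dgr c := by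
        rw [Finset.card_filter, Fintype.sum_sum_type, Fintype.sum_sum_type]
        simp [hz, dgr, add_comm]
      have h3 : (Finset.univ.filter NU).card + nup P = Fintype.card ι := by
        have e1 : (Finset.univ.filter NU).card = (Finset.univ.filter fun i => P i = none).card := by
          symm
          refine Finset.card_bij (fun i _ => Sum.inl i) ?_ ?_ ?_
          · intro i hi; simpa [NU] using hi
          · intro a _ b _ h; simpa using h
          · rintro (i | w) hr
            · exact ⟨i, by simpa [NU] using hr, rfl⟩
            · simp [NU] at hr
        rw [e1, nup]
        exact Finset.card_filter_add_card_filter_not _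
      omega
    · refine MvPolynomial.IsHomogeneous.prod _ _ _ fun c _ => ?_
      rcases hr : s c with i | v
      · rcases hP : P i with _ | j
        · rcases c with c | w
          · have : dgr (Sum.inl c) = 1 := by simp [dgr, hr, NU, hP]
            rw [this]
            by_cases h : i = c
            · subst h
              simpa [rowM, hP] using MvPolynomial.isHomogeneous_X R i
            · simpa [rowM, hP, h] using MvPolynomial.isHomogeneous_zero ι R 1
          · simpa [rowM, hP, dgr] using MvPolynomial.isHomogeneous_C ι _
        · have : dgr c = 0 := by
            rcases c with c | w
            · simp [dgr, hr, NU, hP]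
            · simp [dgr]
          rw [this]
          by_cases h : c = Sum.inl j
          · simpa [rowM, hP, h] using MvPolynomial.isHomogeneous_one ι R
          · simpa [rowM, hP, h] using MvPolynomial.isHomogeneous_zero ι R 0
      · rcases c with c | w
        · have : dgr (Sum.inl c) = 0 := by simp [dgr, hr, NU]
          rw [this]
          simpa [rowM] using MvPolynomial.isHomogeneous_C ι _
        · simpa [rowM, dgr] using MvPolynomial.isHomogeneous_zero ι R 0
  · left
    push Not at hz
    obtain ⟨w, hw⟩ := hz
    refine Finset.prod_eq_zero (Finset.mem_univ (Sum.inr w)) ?_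
    rcases hr : s (Sum.inr w) with i | v
    · rw [hr] at hw
      obtain ⟨j, hj⟩ := Option.ne_none_iff_exists'.1 hw
      simp [rowM, hj]
    · simp [rowM]

lemma Xd_homog (E : Matrix ι W R) (P : ι → Option ι) (d : ℕ)
    (hd : Fintype.card ι = Fintype.card W + nup P + d) :
    (Xd (E.map MvPolynomial.C) P (MvPolynomial.X : ι → MvPolynomial ι R)).IsHomogeneous d := by
  unfold Xd
  rw [Matrix.det_apply]
  refine MvPolynomial.IsHomogeneous.sum _ _ _ fun s _ => ?_
  rcases Xd_term E P s with h | ⟨e, he, h⟩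
  · rw [h, smul_zero]; exact MvPolynomial.isHomogeneous_zero _ _ _
  · have : e = d := by omega
    subst this
    rcases Int.units_eq_one_or (Equiv.Perm.sign s) with h' | h' <;> rw [h']
    · simpa using h
    · simpa using h.neg

lemma Xd_totalDegree (E : Matrix ι W R) (P : ι → Option ι) (d : ℕ)
    (hd : Fintype.card ι ≤ Fintype.card W + nup P + d) :
    (Xd (E.map MvPolynomial.C) P (MvPolynomial.X : ι → MvPolynomial ι R)).totalDegree ≤ d := by
  unfold Xd
  rw [Matrix.det_apply]
  refine MvPolynomial.totalDegree_finsetSum_le fun s _ => ?_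
  rcases Xd_term E P s with h | ⟨e, he, h⟩
  · rw [h, smul_zero]; simp
  · have : e ≤ d := by omega
    rcases Int.units_eq_one_or (Equiv.Perm.sign s) with h' | h' <;> rw [h']
    · simpa using h.totalDegree_le.trans this
    · simpa using h.totalDegree_le.trans this

lemma Xd_hasDeg {K : Type*} [Field K] (E : Matrix ι W K) (P : ι → Option ι) (d : ℕ)
    (hd : Fintype.card ι ≤ Fintype.card W + nup P + d) : HasDeg (Xd E P) d := by
  refine ⟨_, Xd_totalDegree E P d hd, fun x => ?_⟩
  rw [Xd_map]
  congr 1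
  · ext i w; simp
  · ext i; simp

end Xd

set_option linter.unusedSectionVars false

/-! Part C4: the basic congruences. -/

section TT

lemma modEq_of_eq {n a b : ℤ} (h : a = b) : a ≡ b [ZMOD n] := by rw [h]

variable {ι W K : Type*} [Fintype ι] [Fintype W] [DecidableEq ι] [DecidableEq W] [Field K]
  [Fintype K]

noncomputable def TT (E : Matrix ι W K) (a b c : ι) : ℤ :=
  cnt (insert c (insert b {a})) (fun x => Xd E (up (up p0 a b) c c) x = 0 ∧ Xd E (up p0 a b) x = 0)

noncomputable def QQ (E : Matrix ι W K) (a b c d e : ι) (x : ι → K) : K :=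
  Xd E (up (up (up p0 a b) c d) e e) x * Xd E (up (up p0 a b) d c) x -
  Xd E (up (up p0 a b) c d) x * Xd E (up (up (up p0 a b) d c) e e) x

lemma hasDeg_one (E : Matrix ι W K) (h : ℕ) (hι : Fintype.card ι = 2 * h)
    (hW : Fintype.card W = h) (a b : ι) : HasDeg (Xd E (up p0 a b)) (h - 1) := by
  apply Xd_hasDeg
  rw [nup_up _ _ _ (by simp [p0]), nup_p0]
  omega

lemma hasDeg_two (E : Matrix ι W K) (h : ℕ) (hι : Fintype.card ι = 2 * h)
    (hW : Fintype.card W = h) (a b c d : ι) (hac : a ≠ c) :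
    HasDeg (Xd E (up (up p0 a b) c d)) (h - 2) := by
  apply Xd_hasDeg
  rw [nup_up _ _ _ (by simp [up, hac.symm, p0]), nup_up _ _ _ (by simp [p0]), nup_p0]
  omega

lemma hasDeg_three (E : Matrix ι W K) (h : ℕ) (hι : Fintype.card ι = 2 * h)
    (hW : Fintype.card W = h) (a b c d e f : ι) (hac : a ≠ c) (hae : a ≠ e) (hce : c ≠ e) :
    HasDeg (Xd E (up (up (up p0 a b) c d) e f)) (h - 3) := by
  apply Xd_hasDeg
  rw [nup_up _ _ _ (by simp [up, hae.symm, hce.symm, p0]), nup_up _ _ _ (by simp [up, hac.symm, p0]),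
    nup_up _ _ _ (by simp [p0]), nup_p0]
  omega

lemma TT_QQ (E : Matrix ι W K) (h : ℕ) (h4 : 4 ≤ h) (hι : Fintype.card ι = 2 * h)
    (hW : Fintype.card W = h) (a b c d e : ι) (hab : a ≠ b) (hac : a ≠ c) (had : a ≠ d)
    (hae : a ≠ e) (hbc : b ≠ c) (hbd : b ≠ d) (hbe : b ≠ e) (hcd : c ≠ d) (hce : c ≠ e)
    (hde : d ≠ e) :
    TT E a b c ≡ - cnt {e, d, c, b, a} (fun x => QQ E a b c d e x = 0) [ZMOD Fintype.card K] := by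
  have hc3 : (insert c (insert b {a}) : Finset ι).card = 3 :=
    Finset.card_eq_three.2 ⟨c, b, a, hbc.symm, hac.symm, hab.symm, rfl⟩
  have hd3 : d ∉ (insert c (insert b {a}) : Finset ι) := by
    simp [hcd.symm, hbd.symm, had.symm]
  have hc4 : (insert d (insert c (insert b {a})) : Finset ι).card = 4 := by
    rw [Finset.card_insert_of_notMem hd3, hc3]
  have he4 : e ∉ (insert d (insert c (insert b {a})) : Finset ι) := by
    simp [hae.symm, hbe.symm, hce.symm, hde.symm]
  have hc5 : (insert e (insert d (insert c (insert b {a}))) : Finset ι).card = 5 := by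
    rw [Finset.card_insert_of_notMem he4, hc4]
  have s1 := cnt_elim_two (insert c (insert b {a})) d hd3
    (Xd E (up (up p0 a b) c c)) (Xd E (up (up (up p0 a b) c c) d d))
    (Xd E (up p0 a b)) (Xd E (up (up p0 a b) d d))
    (fun x hx t => Xd_update E _ d (by simp [up, p0, hcd.symm, had.symm]) x hx t)
    (fun x hx t => Xd_update E _ d (by simp [up, p0, had.symm]) x hx t)
  have s2 := cnt_ax_two (insert d (insert c (insert b {a}))) _ _ _ _
    (hasDeg_three E h hι hW a b c c d d hac had hcd) (hasDeg_two E h hι hW a b d d had)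
    (by rw [hc4, hι]; omega)
  have s3 : cnt (insert d (insert c (insert b {a}))) (fun x =>
      Xd E (up (up (up p0 a b) c c) d d) x * Xd E (up p0 a b) x -
      Xd E (up (up p0 a b) c c) x * Xd E (up (up p0 a b) d d) x = 0) =
      cnt (insert d (insert c (insert b {a}))) (fun x =>
        Xd E (up (up p0 a b) c d) x * Xd E (up (up p0 a b) d c) x = 0) := by
    apply cnt_congr
    intro x _
    rw [Xd_DJ E _ x hcd]
    have : ∀ u v w : K, (u - v * w - u = 0 ↔ w * v = 0) := by
      intro u v w
      rw [mul_comm w v, sub_sub_cancel_left, neg_eq_zero]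
    exact this _ _ _
  have s4 := cnt_elim_mul (insert d (insert c (insert b {a}))) e he4
    (Xd E (up (up p0 a b) c d)) (Xd E (up (up (up p0 a b) c d) e e))
    (Xd E (up (up p0 a b) d c)) (Xd E (up (up (up p0 a b) d c) e e))
    (by rw [hc4, hι]; omega)
    (fun x hx t => Xd_update E _ e (by simp [up, p0, hce.symm, hae.symm]) x hx t)
    (fun x hx t => Xd_update E _ e (by simp [up, p0, hde.symm, hae.symm]) x hx t)
  have s5 := cnt_ax (insert e (insert d (insert c (insert b {a})))) _ _
    ((hasDeg_three E h hι hW a b c d e e hac hae hce).mul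
      (hasDeg_three E h hι hW a b d c e e had hae hde)) (by rw [hc5, hι]; omega)
  rw [s3] at s1
  have s6 := s1.trans (s4.sub s2)
  refine s6.trans ?_
  have s7 := (s5.neg.sub (Int.ModEq.refl (cnt (insert e (insert d (insert c (insert b {a}))))
    (fun x => QQ E a b c d e x = 0)))).sub (Int.ModEq.refl 0)
  simpa [QQ] using s7

lemma QQ_anti (E : Matrix ι W K) (a b c d e : ι) (x : ι → K) :
    QQ E a b d c e x = - QQ E a b c d e x := by
  unfold QQ; ring

lemma up_rot (a b c d e : ι) (hae : a ≠ e) (hce : c ≠ e) :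
    up (up (up (p0 : ι → Option ι) a b) c d) e e = up (up (dg {e}) a b) c d := by
  have : dg ({e} : Finset ι) = up p0 e e := by
    rw [← dg_empty, ← dg_insert]; rfl
  rw [this, up_comm _ hce, up_comm _ hae]

lemma QQ_plucker (E : Matrix ι W K) (a b c d e : ι) (hab : a ≠ b) (hac : a ≠ c) (had : a ≠ d)
    (hae : a ≠ e) (hbe : b ≠ e) (hce : c ≠ e) (hde : d ≠ e) (x : ι → K) :
    QQ E a c b d e x = - QQ E a b c d e x := by
  unfold QQ
  rw [up_rot a c b d e hae hbe, up_rot a c d b e hae hde, up_rot a b c d e hae hce,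
    up_rot a b d c e hae hde]
  have h1 := Xd_plucker E ∅ a b c d (by simp) (by simp) (by simp) (by simp) hab hac had x
  have h2 := Xd_plucker E ∅ a c b d (by simp) (by simp) (by simp) (by simp) hac hab had x
  have h3 := Xd_plucker E {e} a b c d (by simpa) (by simpa) (by simpa) (by simpa) hab hac had x
  have h4 := Xd_plucker E {e} a c b d (by simpa) (by simpa) (by simpa) (by simpa) hac hab had x
  rw [dg_empty] at h1 h2
  have e1 : Xd E (up (up p0 a c) d b) x = - Xd E (up (up p0 a b) d c) x := by
    linear_combination h2 + h1
  have e2 : Xd E (up (up (dg {e}) a c) d b) x = - Xd E (up (up (dg {e}) a b) d c) x := by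
    linear_combination h4 + h3
  have e3 : Xd E (up (up p0 a c) b d) x = Xd E (up (up p0 a b) c d) x -
    Xd E (up (up p0 a b) d c) x := by linear_combination h1
  have e4 : Xd E (up (up (dg {e}) a c) b d) x = Xd E (up (up (dg {e}) a b) c d) x -
    Xd E (up (up (dg {e}) a b) d c) x := by linear_combination h3
  rw [e1, e2, e3, e4]
  ring

lemma exists_avoid (S : Finset ι) (h : S.card < Fintype.card ι) : ∃ e, e ∉ S := by
  by_contra hc
  push Not at hc
  have : S = Finset.univ := Finset.eq_univ_iff_forall.2 hc
  rw [this, Finset.card_univ] at h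
  exact lt_irrefl _ h

lemma exists_avoid4 (a b c d : ι) (h : 4 < Fintype.card ι) : ∃ e, a ≠ e ∧ b ≠ e ∧ c ≠ e ∧ d ≠ e := by
  obtain ⟨e, he⟩ := exists_avoid ({a, b, c, d} : Finset ι) (lt_of_le_of_lt Finset.card_le_four h)
  simp only [Finset.mem_insert, Finset.mem_singleton, not_or] at he
  exact ⟨e, Ne.symm he.1, Ne.symm he.2.1, Ne.symm he.2.2.1, Ne.symm he.2.2.2⟩

lemma TT_third (E : Matrix ι W K) (h : ℕ) (h4 : 4 ≤ h) (hι : Fintype.card ι = 2 * h)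
    (hW : Fintype.card W = h) (a b c d : ι) (hab : a ≠ b) (hac : a ≠ c) (had : a ≠ d)
    (hbc : b ≠ c) (hbd : b ≠ d) : TT E a b c ≡ TT E a b d [ZMOD Fintype.card K] := by
  by_cases hcd : c = d
  · rw [hcd]
  obtain ⟨e, hae, hbe, hce, hde⟩ := exists_avoid4 a b c d (by omega)
  refine (TT_QQ E h h4 hι hW a b c d e hab hac had hae hbc hbd hbe hcd hce hde).trans
    (Int.ModEq.trans ?_ (TT_QQ E h h4 hι hW a b d c e hab had hac hae hbd hbc hbe
      (Ne.symm hcd) hde hce).symm)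
  have : ({e, d, c, b, a} : Finset ι) = {e, c, d, b, a} := by
    ext i; simp only [Finset.mem_insert, Finset.mem_singleton]; tauto
  rw [this]
  refine Int.ModEq.neg (modEq_of_eq (cnt_congr fun x _ => ?_))
  rw [QQ_anti, neg_eq_zero]

lemma TT_swap23 (E : Matrix ι W K) (h : ℕ) (h4 : 4 ≤ h) (hι : Fintype.card ι = 2 * h)
    (hW : Fintype.card W = h) (a b c : ι) (hab : a ≠ b) (hac : a ≠ c)
    (hbc : b ≠ c) : TT E a b c ≡ TT E a c b [ZMOD Fintype.card K] := by
  obtain ⟨d, had, hbd, hcd, -⟩ := exists_avoid4 a b c c (by omega)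
  obtain ⟨e, hae, hbe, hce, hde⟩ := exists_avoid4 a b c d (by omega)
  refine (TT_QQ E h h4 hι hW a b c d e hab hac had hae hbc hbd hbe hcd hce hde).trans
    (Int.ModEq.trans ?_ (TT_QQ E h h4 hι hW a c b d e hac hab had hae hbc.symm hcd hce
      hbd hbe hde).symm)
  have : ({e, d, c, b, a} : Finset ι) = {e, d, b, c, a} := by
    ext i; simp only [Finset.mem_insert, Finset.mem_singleton]; tauto
  rw [this]
  refine Int.ModEq.neg (modEq_of_eq (cnt_congr fun x _ => ?_))
  rw [QQ_plucker E a b c d e hab hac had hae hbe hce hde, neg_eq_zero]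

lemma TT_swap12 (E : Matrix ι W K) (a b c : ι) (hac : a ≠ c)
    (hbc : b ≠ c) : TT E a b c = TT E b a c := by
  unfold TT
  have : (insert c (insert b {a}) : Finset ι) = insert c (insert a {b}) := by
    ext i; simp only [Finset.mem_insert, Finset.mem_singleton]; tauto
  rw [this]
  refine cnt_congr fun x _ => ?_
  have h1 := Xd_symm E ∅ a b (by simp) (by simp) x
  have h2 := Xd_symm E {c} a b (by simpa) (by simpa) x
  rw [dg_empty] at h1
  have hd : dg ({c} : Finset ι) = up p0 c c := by
    rw [← dg_empty, ← dg_insert]; rfl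
  rw [hd, up_comm _ hac.symm, up_comm _ hbc.symm] at h2
  rw [h1, h2]

lemma TT_second (E : Matrix ι W K) (h : ℕ) (h4 : 4 ≤ h) (hι : Fintype.card ι = 2 * h)
    (hW : Fintype.card W = h) (a b c d : ι) (hab : a ≠ b) (hac : a ≠ c) (had : a ≠ d)
    (hbc : b ≠ c) (hcd : c ≠ d) : TT E a b c ≡ TT E a d c [ZMOD Fintype.card K] :=
  (TT_swap23 E h h4 hι hW a b c hab hac hbc).trans
    ((TT_third E h h4 hι hW a c b d hac hab had hbc.symm hcd).trans
      (TT_swap23 E h h4 hι hW a c d hac had hcd))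

lemma TT_first (E : Matrix ι W K) (h : ℕ) (h4 : 4 ≤ h) (hι : Fintype.card ι = 2 * h)
    (hW : Fintype.card W = h) (a b c d : ι) (hab : a ≠ b) (hac : a ≠ c) (hbd : b ≠ d)
    (hbc : b ≠ c) (hcd : c ≠ d) : TT E a b c ≡ TT E d b c [ZMOD Fintype.card K] := by
  rw [TT_swap12 E a b c hac hbc, TT_swap12 E d b c hcd.symm hbc]
  exact TT_second E h h4 hι hW b a c d hab.symm hbc hbd hac hcd

lemma TT_all (E : Matrix ι W K) (h : ℕ) (h4 : 4 ≤ h) (hι : Fintype.card ι = 2 * h)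
    (hW : Fintype.card W = h) (a b c a' b' c' : ι) (hab : a ≠ b) (hac : a ≠ c) (hbc : b ≠ c)
    (hab' : a' ≠ b') (hac' : a' ≠ c') (hbc' : b' ≠ c') :
    TT E a b c ≡ TT E a' b' c' [ZMOD Fintype.card K] := by
  have s1 : ∃ b1 c1, a' ≠ b1 ∧ a' ≠ c1 ∧ b1 ≠ c1 ∧
      TT E a b c ≡ TT E a' b1 c1 [ZMOD Fintype.card K] := by
    by_cases e1 : a' = b
    · subst e1
      exact ⟨a, c, hab.symm, hbc, hac, modEq_of_eq (TT_swap12 E a a' c hac hbc)⟩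
    by_cases e2 : a' = c
    · subst e2
      exact ⟨a, b, hac.symm, hbc.symm, hab, (TT_swap23 E h h4 hι hW a b a' hab hac hbc).trans
        (modEq_of_eq (TT_swap12 E a a' b hab hbc.symm))⟩
    exact ⟨b, c, e1, e2, hbc, TT_first E h h4 hι hW a b c a' hab hac (Ne.symm e1) hbc (Ne.symm e2)⟩
  obtain ⟨b1, c1, h1, h2, h3, hs1⟩ := s1
  have s2 : ∃ c2, a' ≠ c2 ∧ b' ≠ c2 ∧
      TT E a' b1 c1 ≡ TT E a' b' c2 [ZMOD Fintype.card K] := by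
    by_cases e1 : b' = c1
    · subst e1
      exact ⟨b1, h1, h3.symm, TT_swap23 E h h4 hι hW a' b1 b' h1 h2 h3⟩
    exact ⟨c1, h2, e1, TT_second E h h4 hι hW a' b1 c1 b' h1 h2 hab' h3 (Ne.symm e1)⟩
  obtain ⟨c2, h5, h6, hs2⟩ := s2
  exact hs1.trans (hs2.trans (TT_third E h h4 hι hW a' b' c2 c' hab' h5 hac' h6 hbc'))

/-- Lemma P -/
lemma pair_zero (E : Matrix ι W K) (h : ℕ) (hι : Fintype.card ι = 2 * h)
    (hW : Fintype.card W = h) (Z S : Finset ι) (k : ι) (hZS : Z ⊆ S) (hkS : k ∈ S) (hkZ : k ∉ Z)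
    (hdeg : (h - Z.card - 1) + (h - Z.card - 2) + S.card + 1 < 2 * h) :
    cnt S (fun x => Xd E (up (dg Z) k k) x = 0 ∧ Xd E (dg Z) x = 0) ≡ 0 [ZMOD Fintype.card K] := by
  obtain ⟨l, hl⟩ := exists_avoid S (by omega)
  have hlZ : l ∉ Z := fun hh => hl (hZS hh)
  have hkl : k ≠ l := fun hh => hl (hh ▸ hkS)
  have s1 := cnt_elim_two S l hl
    (Xd E (up (dg Z) k k)) (Xd E (up (up (dg Z) k k) l l))
    (Xd E (dg Z)) (Xd E (up (dg Z) l l))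
    (fun x hx t => Xd_update E _ l (by simp [up, dg, hlZ, hkl.symm]) x hx t)
    (fun x hx t => Xd_update E _ l (by simp [dg, hlZ]) x hx t)
  have hc : (insert l S).card = S.card + 1 := Finset.card_insert_of_notMem hl
  have s2 : cnt (insert l S) (fun x =>
      Xd E (up (up (dg Z) k k) l l) x * Xd E (dg Z) x -
      Xd E (up (dg Z) k k) x * Xd E (up (dg Z) l l) x = 0) =
      cnt (insert l S) (fun x => Xd E (up (dg Z) k l) x = 0) := by
    apply cnt_congr
    intro x _
    rw [Xd_DJ E _ x hkl, Xd_symm E Z l k hlZ hkZ, sub_sub_cancel_left, neg_eq_zero, mul_self_eq_zero]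
  rw [s2] at s1
  have s3 := cnt_ax (insert l S) _ (h - Z.card - 1) (Xd_hasDeg E (up (dg Z) k l) _ (by
    rw [nup_up _ _ _ (by simp [dg, hkZ]), nup_dg]; omega)) (by omega)
  have s4 := cnt_ax_two (insert l S) _ _ (h - Z.card - 2) (h - Z.card - 1)
    (Xd_hasDeg E (up (up (dg Z) k k) l l) _ (by
      rw [nup_up _ _ _ (by simp [up, dg, hlZ, hkl.symm]), nup_up _ _ _ (by simp [dg, hkZ]), nup_dg]
      omega))
    (Xd_hasDeg E (up (dg Z) l l) _ (by
      rw [nup_up _ _ _ (by simp [dg, hlZ]), nup_dg]; omega)) (by omega)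
  simpa using s1.trans (s3.sub s4)

/-- Lemma M2 -/
lemma sq_dvd (E : Matrix ι W K) (h : ℕ) (h4 : 4 ≤ h) (hι : Fintype.card ι = 2 * h)
    (hW : Fintype.card W = h) (m : ℕ) : ∀ (Z S : Finset ι), Z ⊆ S → S.card ≤ Z.card + 1 →
      1 ≤ Z.card → Z.card + m = h →
    (Fintype.card K : ℤ) ^ 2 ∣ cnt S (fun x => Xd E (dg Z) x = 0) := by
  induction m with
  | zero =>
    intro Z S hZS hS hZ hm
    obtain ⟨f, hf, hf2⟩ := Xd_hasDeg E (dg Z) 0 (by rw [nup_dg]; omega)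
    rw [Nat.le_zero, MvPolynomial.totalDegree_eq_zero_iff_eq_C] at hf
    have hcon : ∀ x, Xd E (dg Z) x = MvPolynomial.coeff 0 f := by
      intro x; rw [← hf2, hf]; simp
    by_cases h0 : MvPolynomial.coeff 0 f = 0
    · have := cnt_true (K := K) S
      have e : cnt S (fun x => Xd E (dg Z) x = 0) = cnt (K := K) S (fun _ => True) :=
        cnt_congr fun x _ => by rw [hcon]; simp [h0]
      rw [e, this]
      exact pow_dvd_pow _ (by omega)
    · have e : cnt S (fun x => Xd E (dg Z) x = 0) = 0 := by
        simp [cnt, hcon, h0]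
      rw [e]; exact dvd_zero _
  | succ m ih =>
    intro Z S hZS hS hZ hm
    obtain ⟨k, hk⟩ := exists_avoid S (by omega)
    have hkZ : k ∉ Z := fun hh => hk (hZS hh)
    have hc : (insert k S).card = S.card + 1 := Finset.card_insert_of_notMem hk
    have hcZ : (insert k Z).card = Z.card + 1 := Finset.card_insert_of_notMem hkZ
    have s1 := cnt_elim_one S k hk (Xd E (dg Z)) (Xd E (up (dg Z) k k))
      (fun x hx t => Xd_update E _ k (by simp [dg, hkZ]) x hx t)
    have s2 := cnt_add_not (insert k S) (fun x => Xd E (up (dg Z) k k) x = 0)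
    have s3 := pair_zero E h hι hW Z (insert k S) k (hZS.trans (Finset.subset_insert _ _))
      (Finset.mem_insert_self _ _) hkZ (by omega)
    have s4 := ih (insert k Z) (insert k S) (Finset.insert_subset_insert _ hZS) (by omega)
      (by omega) (by omega)
    rw [dg_insert] at s4
    rw [s1]
    refine dvd_add ?_ ?_
    · rw [eq_sub_of_add_eq' s2]
      exact dvd_sub (pow_dvd_pow _ (by omega)) s4
    · rw [pow_two]
      exact mul_dvd_mul_left _ (Int.modEq_zero_iff_dvd.1 s3)

end TT

set_option linter.unusedSectionVars false

/-! Part C5: vertices of small degree. -/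

section Vertex
variable {ι W K : Type*} [Fintype ι] [Fintype W] [DecidableEq ι] [DecidableEq W] [Field K]

/-- `e` lies in the span of the columns of `E`. -/
def VRel (E : Matrix ι W K) (e : ι → K) : Prop := ∃ c : W → K, ∀ j, ∑ w, c w * E j w = e j

lemma vrel_sum (E : Matrix ι W K) (e : ι → K) (he : VRel E e) (P : ι → Option ι) (i : ι)
    (x : ι → K) : ∑ a, e a * Xd E (up P i a) x = 0 := by
  obtain ⟨c, hc⟩ := he
  simp only [Xd, rowM_up, ← Matrix.cramer_transpose_apply]
  set A := rowM E P x with hA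
  have h1 : ∑ a, e a * (Aᵀ.cramer (Pi.single (Sum.inl a) 1)) (Sum.inl i) =
      (Aᵀ.cramer (∑ a, e a • Pi.single (Sum.inl a) 1)) (Sum.inl i) := by
    simp [map_sum, Finset.sum_apply]
  have h2 : (∑ a, e a • (Pi.single (Sum.inl a) 1 : ι ⊕ W → K)) = ∑ w, c w • A (Sum.inr w) := by
    ext r
    simp only [Finset.sum_apply, Pi.smul_apply, smul_eq_mul]
    rcases r with j | w
    · simp only [hA, rowM, Matrix.of_apply, Sum.elim_inl, hc]
      rw [Finset.sum_eq_single j]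
      · simp
      · intro b _ hb; simp [Ne.symm hb]
      · simp
    · simp [hA, rowM]
  rw [h1, h2, map_sum, Finset.sum_apply]
  refine Finset.sum_eq_zero fun w _ => ?_
  rw [map_smul, Pi.smul_apply, Matrix.cramer_transpose_apply]
  have : (A.updateRow (Sum.inl i) (A (Sum.inr w))).det = 0 := by
    refine Matrix.det_zero_of_row_eq (i := Sum.inl i) (j := Sum.inr w) (by simp) ?_
    ext c
    simp [Matrix.updateRow_apply]
  rw [this, smul_zero]

lemma Xd_dup (E : Matrix ι W K) (P : ι → Option ι) {i k : ι} (hik : i ≠ k) (j : ι)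
    (x : ι → K) : Xd E (up (up P i j) k j) x = 0 := by
  simp only [Xd, rowM_up]
  refine Matrix.det_zero_of_row_eq (i := Sum.inl i) (j := Sum.inl k) (by simpa using hik) ?_
  ext c
  simp [Matrix.updateRow_apply, hik]

lemma dg_single (a : ι) : dg ({a} : Finset ι) = up p0 a a := by
  rw [← dg_empty, ← dg_insert]; rfl

lemma Xd_symm0 (E : Matrix ι W K) (k l : ι) (x : ι → K) :
    Xd E (up p0 k l) x = Xd E (up p0 l k) x := by
  have := Xd_symm E ∅ k l (by simp) (by simp) x
  rwa [dg_empty] at this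

lemma Xd_symm1 (E : Matrix ι W K) (a k l : ι) (hk : k ≠ a) (hl : l ≠ a) (x : ι → K) :
    Xd E (up (up p0 a a) k l) x = Xd E (up (up p0 a a) l k) x := by
  have := Xd_symm E {a} k l (by simpa) (by simpa) x
  rwa [dg_single] at this

variable [Fintype K]

lemma lin_count (f g : K) : (∑ t : K, if t * f + g = 0 then (1 : ℤ) else 0) =
    if f = 0 then (if g = 0 then (Fintype.card K : ℤ) else 0) else 1 := by
  rw [root_one]
  by_cases hf : f = 0 <;> by_cases hg : g = 0 <;> simp [hf, hg]

/-- counting zeros of the linear form in two variables -/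
lemma lin_count2 (f g r : K) : (∑ s : K, ∑ t : K, if t * f + (s * g + r) = 0 then (1 : ℤ) else 0) =
    if f = 0 ∧ g = 0 then (if r = 0 then (Fintype.card K : ℤ) ^ 2 else 0)
    else (Fintype.card K : ℤ) := by
  simp only [lin_count]
  by_cases hf : f = 0
  · by_cases hg : g = 0
    · by_cases hr : r = 0
      · simp [hf, hg, hr, pow_two]
      · simp [hf, hg, hr]
    · have : ∀ s : K, s * g + r = 0 ↔ s = - r / g := by
        intro s
        rw [eq_div_iff hg, eq_neg_iff_add_eq_zero]
      simp [hf, hg, this]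
  · simp [hf]

lemma lin_count3 (f g k r : K) :
    (∑ u : K, ∑ s : K, ∑ t : K, if t * f + (s * g + (u * k + r)) = 0 then (1 : ℤ) else 0) =
    if f = 0 ∧ g = 0 ∧ k = 0 then (if r = 0 then (Fintype.card K : ℤ) ^ 3 else 0)
    else (Fintype.card K : ℤ) ^ 2 := by
  simp only [lin_count2]
  by_cases hfg : f = 0 ∧ g = 0
  · obtain ⟨hf, hg⟩ := hfg
    by_cases hk : k = 0
    · by_cases hr : r = 0
      · simp [hf, hg, hr, hk]; ring
      · simp [hf, hg, hr, hk]
    · have : ∀ s : K, s * k + r = 0 ↔ s = - r / k := by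
        intro s
        rw [eq_div_iff hk, eq_neg_iff_add_eq_zero]
      simp [hf, hg, hk, this]
  · have : ¬ (f = 0 ∧ g = 0 ∧ k = 0) := fun h => hfg ⟨h.1, h.2.1⟩
    simp [hfg, this, pow_two]

lemma quad_count3 (f A B C r : K) (hf : f ≠ 0) (hr : f * r = A * B + A * C + B * C) :
    (∑ u : K, ∑ s : K, ∑ t : K,
      if t * (f * (s + u) + (B + C)) + (f * s * u + (A + C) * s + (A + B) * u + r) = 0
      then (1 : ℤ) else 0) = (Fintype.card K : ℤ) ^ 2 := by
  simp only [lin_count]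
  have h1 : ∀ u s : K, f * (s + u) + (B + C) = 0 ↔ s = - (B + C) / f - u := by
    intro u s
    constructor
    · intro h; field_simp; linear_combination h
    · rintro rfl; field_simp; ring
  have h2 : ∀ u : K, (∑ s : K, if f * (s + u) + (B + C) = 0 then
      (if f * s * u + (A + C) * s + (A + B) * u + r = 0 then (Fintype.card K : ℤ) else 0) else 1) =
      (Fintype.card K : ℤ) - 1 + (if u = - C / f then (Fintype.card K : ℤ) else 0) := by
    intro u
    rw [← Finset.add_sum_erase _ _ (Finset.mem_univ (- (B + C) / f - u))]
    have e1 : ∑ s ∈ Finset.univ.erase (- (B + C) / f - u), (if f * (s + u) + (B + C) = 0 then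
      (if f * s * u + (A + C) * s + (A + B) * u + r = 0 then (Fintype.card K : ℤ) else 0) else 1) =
        (Fintype.card K : ℤ) - 1 := by
      rw [Finset.sum_congr rfl (g := fun _ => (1 : ℤ))]
      · rw [Finset.sum_const, Finset.card_erase_of_mem (Finset.mem_univ _), Finset.card_univ]
        simp [Nat.cast_sub Fintype.card_pos]
      · intro s hs
        rw [if_neg]
        rw [h1]
        exact Finset.ne_of_mem_erase hs
    rw [e1, if_pos ((h1 _ _).2 rfl)]
    have e2 : (f * (- (B + C) / f - u) * u + (A + C) * (- (B + C) / f - u) + (A + B) * u + r = 0) ↔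
        u = - C / f := by
      have : f * (f * (- (B + C) / f - u) * u + (A + C) * (- (B + C) / f - u) + (A + B) * u + r) =
          - (f * u + C) ^ 2 := by
        have hh : f * (- (B + C) / f) = - (B + C) := by field_simp
        linear_combination (f * u + A + C) * hh + hr
      rw [← mul_right_inj' hf, this, mul_zero, neg_eq_zero, sq_eq_zero_iff, eq_div_iff hf,
        eq_neg_iff_add_eq_zero, mul_comm]
    simp only [e2]
    ring
  simp only [h2]
  rw [Finset.sum_add_distrib]
  simp
  ring

end Vertex

set_option linter.unusedSectionVars false

/-! Part C6: total counts. -/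

section Total
variable {ι W K : Type*} [Fintype ι] [Fintype W] [DecidableEq ι] [DecidableEq W] [Field K]
  [Fintype K]

noncomputable def TOT (E : Matrix ι W K) : ℤ := cnt ∅ (fun x => Xd E p0 x = 0)

lemma rel_three (E : Matrix ι W K) (e : ι → K) (he : VRel E e) (a b c : ι) (hab : a ≠ b)
    (hac : a ≠ c) (hbc : b ≠ c) (h0 : ∀ j, j ≠ a → j ≠ b → j ≠ c → e j = 0)
    (P : ι → Option ι) (i : ι) (x : ι → K) :
    e a * Xd E (up P i a) x + e b * Xd E (up P i b) x + e c * Xd E (up P i c) x = 0 := by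
  have h := vrel_sum E e he P i x
  rw [← Finset.sum_subset (Finset.subset_univ {a, b, c})] at h
  · rw [Finset.sum_insert (by simp [hab, hac]), Finset.sum_insert (by simp [hbc]),
      Finset.sum_singleton] at h
    rw [← h]; ring
  · intro j _ hj
    simp only [Finset.mem_insert, Finset.mem_singleton, not_or] at hj
    rw [h0 j hj.1 hj.2.1 hj.2.2, zero_mul]

lemma rel_two (E : Matrix ι W K) (e : ι → K) (he : VRel E e) (a b : ι) (hab : a ≠ b)
    (h0 : ∀ j, j ≠ a → j ≠ b → e j = 0)
    (P : ι → Option ι) (i : ι) (x : ι → K) :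
    e a * Xd E (up P i a) x + e b * Xd E (up P i b) x = 0 := by
  have h := vrel_sum E e he P i x
  rw [← Finset.sum_subset (Finset.subset_univ {a, b})] at h
  · rw [Finset.sum_insert (by simp [hab]), Finset.sum_singleton] at h
    rw [← h]
  · intro j _ hj
    simp only [Finset.mem_insert, Finset.mem_singleton, not_or] at hj
    rw [h0 j hj.1 hj.2, zero_mul]

lemma rel_one (E : Matrix ι W K) (e : ι → K) (he : VRel E e) (a : ι) (ha : e a ^ 2 = 1)
    (h0 : ∀ j, j ≠ a → e j = 0)
    (P : ι → Option ι) (i : ι) (x : ι → K) : Xd E (up P i a) x = 0 := by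
  have h := vrel_sum E e he P i x
  rw [Finset.sum_eq_single a (fun j _ hj => by rw [h0 j hj, zero_mul]) (by simp)] at h
  refine (mul_eq_zero.1 h).resolve_left ?_
  rintro h'
  rw [h'] at ha
  simp at ha

lemma zero_three (E : Matrix ι W K) (e : ι → K) (he : VRel E e) (a b c : ι) (hab : a ≠ b)
    (hac : a ≠ c) (hbc : b ≠ c) (h0 : ∀ j, j ≠ a → j ≠ b → j ≠ c → e j = 0)
    (ha : e a ^ 2 = 1) (hb : e b ^ 2 = 1) (hc : e c ^ 2 = 1) (x : ι → K) :
    Xd E (up (up p0 a a) c c) x = Xd E (up (up p0 a a) b b) x ∧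
    Xd E (up (up (up p0 a a) b b) c c) x = 0 ∧
    Xd E (up (up p0 a b) c c) x = - (e a * e b) * Xd E (up (up p0 a a) b b) x ∧
    Xd E (up p0 a a) x = - (e a * e b) * Xd E (up p0 a b) x - (e a * e c) * Xd E (up p0 a c) x := by
  have R := rel_three E e he a b c hab hac hbc h0
  have r1 := R (up p0 a a) b x
  rw [Xd_dup E p0 hab] at r1
  have r2 := R (up p0 a a) c x
  rw [Xd_dup E p0 hac] at r2
  have s := Xd_symm1 E a b c hab.symm hac.symm x
  have k1 : Xd E (up (up p0 a a) c c) x = Xd E (up (up p0 a a) b b) x := by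
    linear_combination e c * r2 - e b * r1 - Xd E (up (up p0 a a) c c) x * hc
      + Xd E (up (up p0 a a) b b) x * hb + e b * e c * s
  refine ⟨k1, ?_, ?_, ?_⟩
  · have r3 := R (up (up p0 a a) b b) c x
    rw [Xd_dup _ _ hbc, up_comm _ hab, Xd_dup _ _ hac, up_comm _ hab.symm] at r3
    linear_combination e c * r3 - Xd E (up (up (up p0 a a) b b) c c) x * hc
  · have r4 := R (up p0 c c) a x
    rw [Xd_dup _ _ hac.symm, up_comm _ hac.symm, up_comm _ hac.symm, k1] at r4
    linear_combination e b * r4 - Xd E (up (up p0 a b) c c) x * hb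
  · have r5 := R p0 a x
    linear_combination e a * r5 - Xd E (up p0 a a) x * ha

lemma expand3 (E : Matrix ι W K) (a b c : ι) (hab : a ≠ b) (hac : a ≠ c) (hbc : b ≠ c)
    (x : ι → K) (hxa : x a = 0) (hxb : x b = 0) (hxc : x c = 0) (t s u : K) :
    Xd E p0 (Function.update (Function.update (Function.update x c u) b s) a t) =
      Xd E p0 x + t * Xd E (up p0 a a) x + s * Xd E (up p0 b b) x + u * Xd E (up p0 c c) x +
      t * s * Xd E (up (up p0 a a) b b) x + t * u * Xd E (up (up p0 a a) c c) x +
      s * u * Xd E (up (up p0 b b) c c) x + t * s * u * Xd E (up (up (up p0 a a) b b) c c) x := by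
  have e1 : ∀ P : ι → Option ι, P b = none →
      Xd E P (Function.update (Function.update x c u) b s) =
      s * Xd E (up P b b) (Function.update x c u) + Xd E P (Function.update x c u) := by
    intro P hP
    exact Xd_update E P b hP _ (by simp [hbc, hxb]) s
  have e2 : ∀ P : ι → Option ι, P c = none →
      Xd E P (Function.update x c u) = u * Xd E (up P c c) x + Xd E P x :=
    fun P hP => Xd_update E P c hP x hxc u
  rw [Xd_update E p0 a (by simp [p0]) _ (by simp [hab, hac, hxa]), e1 _ (by simp [up, p0, hab.symm]),
    e1 _ (by simp [p0]), e2 _ (by simp [up, p0, hbc.symm, hac.symm]), e2 _ (by simp [up, p0, hac.symm]),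
    e2 _ (by simp [up, p0, hbc.symm]), e2 _ (by simp [p0])]
  ring

lemma pt3 (f A B C r : K) (hd : f * r = A * B + A * C + B * C) :
    (∑ u : K, ∑ s : K, ∑ t : K,
      if r + t * (B + C) + s * (A + C) + u * (A + B) + t * s * f + t * u * f + s * u * f +
        t * s * u * 0 = 0 then (1 : ℤ) else 0) ≡
      (Fintype.card K : ℤ) ^ 2 * (1 - ((if f = 0 ∧ A + C = 0 then 1 else 0) +
        (if f = 0 ∧ B + C = 0 then 1 else 0) - (if f = 0 ∧ C = 0 then 1 else 0)))
      [ZMOD (Fintype.card K : ℤ) ^ 3] := by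
  by_cases hf : f = 0
  · subst hf
    have e1 : ∀ t s u : K, r + t * (B + C) + s * (A + C) + u * (A + B) + t * s * 0 + t * u * 0 +
        s * u * 0 + t * s * u * 0 = t * (B + C) + (s * (A + C) + (u * (A + B) + r)) := by
      intros; ring
    simp only [e1, lin_count3]
    rw [zero_mul] at hd
    have k1 : A + C = 0 → A = 0 ∧ C = 0 := by
      intro h
      have : A ^ 2 = 0 := by linear_combination hd + (A + B) * h
      have hA : A = 0 := by simpa using this
      exact ⟨hA, by rw [hA, zero_add] at h; exact h⟩
    have k2 : B + C = 0 → B = 0 ∧ C = 0 := by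
      intro h
      have : B ^ 2 = 0 := by linear_combination hd + (A + B) * h
      have hA : B = 0 := by simpa using this
      exact ⟨hA, by rw [hA, zero_add] at h; exact h⟩
    by_cases hC : C = 0
    · subst hC
      simp only [mul_zero, add_zero] at hd
      rcases mul_eq_zero.1 hd.symm with hA | hB
      · subst hA
        by_cases hB : B = 0
        · subst hB
          by_cases hr : r = 0 <;> simp [hr, Int.ModEq]
        · simp [hB, Int.ModEq]
      · subst hB
        by_cases hA : A = 0
        · subst hA
          by_cases hr : r = 0 <;> simp [hr, Int.ModEq]
        · simp [hA, Int.ModEq]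
    · have hA : A + C ≠ 0 := fun h => hC (k1 h).2
      have hB : B + C ≠ 0 := fun h => hC (k2 h).2
      simp [hA, hB, hC, Int.ModEq]
  · have e1 : ∀ t s u : K, r + t * (B + C) + s * (A + C) + u * (A + B) + t * s * f + t * u * f +
        s * u * f + t * s * u * 0 =
        t * (f * (s + u) + (B + C)) + (f * s * u + (A + C) * s + (A + B) * u + r) := by
      intros; ring
    simp only [e1, quad_count3 f A B C r hf hd]
    simp [hf, Int.ModEq]

lemma TOT_three (E : Matrix ι W K) (h : ℕ) (h4 : 4 ≤ h) (hι : Fintype.card ι = 2 * h)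
    (hW : Fintype.card W = h) (e : ι → K) (he : VRel E e) (a b c : ι) (hab : a ≠ b)
    (hac : a ≠ c) (hbc : b ≠ c) (h0 : ∀ j, j ≠ a → j ≠ b → j ≠ c → e j = 0)
    (ha : e a ^ 2 = 1) (hb : e b ^ 2 = 1) (hc : e c ^ 2 = 1) :
    TOT E ≡ (Fintype.card K : ℤ) ^ 2 * TT E a b c [ZMOD (Fintype.card K : ℤ) ^ 3] := by
  set q : ℤ := (Fintype.card K : ℤ) with hq
  have hbS : b ∉ (insert a ∅ : Finset ι) := by simp [hab.symm]
  have hcS : c ∉ (insert b (insert a ∅) : Finset ι) := by simp [hbc.symm, hac.symm]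
  have hSS : (insert c (insert b (insert a ∅)) : Finset ι) = insert c (insert b {a}) := by simp
  let S : Finset ι := insert c (insert b {a})
  have hS3 : S.card = 3 := Finset.card_eq_three.2 ⟨c, b, a, hbc.symm, hac.symm, hab.symm, rfl⟩
  let f : (ι → K) → K := Xd E (up (up p0 a a) b b)
  let Fc : (ι → K) → K := fun x => - (e a * e b) * Xd E (up p0 a b) x
  let Fb : (ι → K) → K := fun x => - (e a * e c) * Xd E (up p0 a c) x
  let Fa : (ι → K) → K := fun x => - (e b * e c) * Xd E (up p0 b c) x
  let r : (ι → K) → K := Xd E p0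
  have eb2 : Fc = fun x => - (e b * e a) * Xd E (up p0 b a) x := by
    funext x; simp only [Fc]; rw [Xd_symm0 E a b]; ring
  -- identities
  have Za := fun x => zero_three E e he a b c hab hac hbc h0 ha hb hc x
  have Zb := fun x => zero_three E e he b a c hab.symm hbc hac (fun j h1 h2 h3 => h0 j h2 h1 h3) hb ha hc x
  have Zc := fun x => zero_three E e he c a b hac.symm hbc.symm hab
    (fun j h1 h2 h3 => h0 j h2 h3 h1) hc ha hb x
  have caa : ∀ x, Xd E (up p0 a a) x = Fb x + Fc x := by
    intro x; rw [(Za x).2.2.2]; simp only [Fb, Fc]; ring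
  have cbb : ∀ x, Xd E (up p0 b b) x = Fa x + Fc x := by
    intro x; rw [(Zb x).2.2.2]; simp only [Fa, eb2]; ring
  have ccc : ∀ x, Xd E (up p0 c c) x = Fa x + Fb x := by
    intro x; rw [(Zc x).2.2.2]; simp only [Fa, Fb]; rw [Xd_symm0 E c a, Xd_symm0 E c b]; ring
  have fab : ∀ x, Xd E (up (up p0 b b) a a) x = f x := by
    intro x; simp only [f]; rw [up_comm _ hab.symm]
  have fac : ∀ x, Xd E (up (up p0 a a) c c) x = f x := fun x => (Za x).1
  have fbc : ∀ x, Xd E (up (up p0 b b) c c) x = f x := fun x => ((Zb x).1).trans (fab x)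
  have hdj : ∀ x, f x * r x = Fa x * Fb x + Fa x * Fc x + Fb x * Fc x := by
    intro x
    have := Xd_DJ E p0 x hab a b
    rw [caa, cbb, Xd_symm0 E b a] at this
    simp only [f, r]
    rw [this]
    simp only [Fc]
    have hab2 : (e a * e b) ^ 2 = 1 := by rw [mul_pow, ha, hb, one_mul]
    linear_combination Xd E (up p0 a b) x ^ 2 * hab2
  -- sum
  have hsum : TOT E = ∑ x ∈ cbase K S, ∑ u : K, ∑ s : K, ∑ t : K,
      if Xd E p0 (Function.update (Function.update (Function.update x c u) b s) a t) = 0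
      then (1 : ℤ) else 0 := by
    unfold TOT cnt
    rw [sum_cbase (K := K) ∅ a (by simp), sum_cbase (K := K) _ b hbS, sum_cbase (K := K) _ c hcS, hSS]
  have hpt : ∀ x ∈ cbase K S, (∑ u : K, ∑ s : K, ∑ t : K,
      if Xd E p0 (Function.update (Function.update (Function.update x c u) b s) a t) = 0
      then (1 : ℤ) else 0) ≡ q ^ 2 * (1 - ((if f x = 0 ∧ Xd E (up p0 b b) x = 0 then 1 else 0) +
        (if f x = 0 ∧ Xd E (up p0 a a) x = 0 then 1 else 0) -
        (if f x = 0 ∧ Fc x = 0 then 1 else 0))) [ZMOD q ^ 3] := by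
    intro x hx
    rw [mem_cbase] at hx
    have hx3 := expand3 E a b c hab hac hbc x (hx a (by simp [S])) (hx b (by simp [S]))
      (hx c (by simp [S]))
    simp only [hx3, fac, fbc, (Za x).2.1, caa, cbb, ccc]
    exact pt3 (f x) (Fa x) (Fb x) (Fc x) (r x) (hdj x)
  have hea : e a ≠ 0 := by rintro h'; rw [h'] at ha; simp at ha
  have heb : e b ≠ 0 := by rintro h'; rw [h'] at hb; simp at hb
  have h1 : TOT E ≡ q ^ 2 * (cnt S (fun _ : ι → K => True) -
      (cnt S (fun x => f x = 0 ∧ Xd E (up p0 b b) x = 0) +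
       cnt S (fun x => f x = 0 ∧ Xd E (up p0 a a) x = 0) -
       cnt S (fun x => f x = 0 ∧ Fc x = 0))) [ZMOD q ^ 3] := by
    rw [hsum]
    refine (Int.ModEq.sum hpt).trans (modEq_of_eq ?_)
    rw [← Finset.mul_sum]
    unfold cnt
    rw [← Finset.sum_add_distrib, ← Finset.sum_sub_distrib, ← Finset.sum_sub_distrib]
    refine congrArg (q ^ 2 * ·) (Finset.sum_congr rfl fun x _ => ?_)
    by_cases c1 : f x = 0 <;> by_cases c2 : Xd E (up p0 b b) x = 0 <;>
      by_cases c3 : Xd E (up p0 a a) x = 0 <;> by_cases c4 : Fc x = 0 <;> simp [c1, c2, c3, c4]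
  refine h1.trans ?_
  have hT : cnt S (fun x => f x = 0 ∧ Fc x = 0) = TT E a b c := by
    unfold TT
    refine cnt_congr (fun x _ => ?_)
    rw [(Za x).2.2.1]
    simp [f, Fc, hea, heb]
  have p1 : cnt S (fun x => f x = 0 ∧ Xd E (up p0 b b) x = 0) ≡ 0 [ZMOD q] := by
    have := pair_zero E h hι hW {b} S a (by simp [S]) (by simp [S]) (by simpa using hab)
      (by simp [hS3]; omega)
    rw [dg_single] at this
    simpa only [fab] using this
  have p2 : cnt S (fun x => f x = 0 ∧ Xd E (up p0 a a) x = 0) ≡ 0 [ZMOD q] := by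
    have := pair_zero E h hι hW {a} S b (by simp [S]) (by simp [S]) (by simpa using hab.symm)
      (by simp [hS3]; omega)
    rw [dg_single] at this
    exact this
  have p3 : cnt S (fun _ : ι → K => True) ≡ 0 [ZMOD q] := by
    rw [cnt_true, hS3, hι, Int.modEq_zero_iff_dvd]
    exact dvd_pow_self _ (by omega)
  rw [hT]
  have := (p3.sub ((p1.add p2).sub (Int.ModEq.refl (TT E a b c))))
  rw [show (0:ℤ) - (0 + 0 - TT E a b c) = TT E a b c by ring] at this
  have h3 := this.mul_left' (c := q ^ 2)
  rwa [show q ^ 2 * q = q ^ 3 by ring] at h3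

lemma TOT_two (E : Matrix ι W K) (h : ℕ) (h4 : 4 ≤ h) (hι : Fintype.card ι = 2 * h)
    (hW : Fintype.card W = h) (e : ι → K) (he : VRel E e) (a b c : ι) (hab : a ≠ b)
    (hac : a ≠ c) (hbc : b ≠ c) (h0 : ∀ j, j ≠ a → j ≠ b → e j = 0)
    (ha : e a ^ 2 = 1) (hb : e b ^ 2 = 1) :
    TOT E ≡ (Fintype.card K : ℤ) ^ 2 * TT E a c b [ZMOD (Fintype.card K : ℤ) ^ 3] := by
  set q : ℤ := (Fintype.card K : ℤ) with hq
  have hbS : b ∉ (insert a ∅ : Finset ι) := by simp [hab.symm]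
  let S : Finset ι := insert b (insert a ∅)
  have hS2 : S.card = 2 := Finset.card_pair hab.symm
  have hcS : c ∉ S := by simp [S, hbc.symm, hac.symm]
  have hea : e a ≠ 0 := by rintro h'; rw [h'] at ha; simp at ha
  have heb : e b ≠ 0 := by rintro h'; rw [h'] at hb; simp at hb
  have R := rel_two E e he a b hab h0
  have z1 : ∀ x, Xd E (up (up p0 a a) b b) x = 0 := by
    intro x
    have := R (up p0 a a) b x
    rw [Xd_dup E p0 hab, mul_zero, zero_add] at this
    exact (mul_eq_zero.1 this).resolve_left heb
  have z2 : ∀ x, Xd E (up p0 b b) x = Xd E (up p0 a a) x := by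
    intro x
    have r1 := R p0 a x
    have r2 := R p0 b x
    rw [Xd_symm0 E b a] at r2
    linear_combination e b * r2 - e a * r1 - Xd E (up p0 b b) x * hb + Xd E (up p0 a a) x * ha
  have z3 : ∀ x, Xd E (up (up p0 a c) b b) x = 0 := by
    intro x
    rw [up_comm _ hab, Xd_symm1 E b a c hab hbc.symm]
    have := R (up p0 b b) c x
    rw [Xd_dup E p0 hbc, mul_zero, add_zero] at this
    exact (mul_eq_zero.1 this).resolve_left hea
  have exp2 : ∀ x, x a = 0 → x b = 0 → ∀ t s,
      Xd E p0 (Function.update (Function.update x b s) a t) =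
        t * Xd E (up p0 a a) x + (s * Xd E (up p0 a a) x + Xd E p0 x) := by
    intro x hxa hxb t s
    rw [Xd_update E p0 a (by simp [p0]) _ (by simp [hab, hxa]),
      Xd_update E _ b (by simp [up, p0, hab.symm]) _ hxb,
      Xd_update E _ b (by simp [p0]) _ hxb, z1, z2]
    ring
  have hsum : TOT E = q * cnt S (fun _ : ι → K => True) - q * cnt S (fun x => Xd E (up p0 a a) x = 0)
      + q ^ 2 * cnt S (fun x => Xd E (up p0 a a) x = 0 ∧ Xd E p0 x = 0) := by
    unfold TOT cnt
    rw [sum_cbase (K := K) ∅ a (by simp), sum_cbase (K := K) _ b hbS, Finset.mul_sum,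
      Finset.mul_sum, Finset.mul_sum, ← Finset.sum_sub_distrib, ← Finset.sum_add_distrib]
    refine Finset.sum_congr rfl fun x hx => ?_
    rw [mem_cbase] at hx
    have hxa : x a = 0 := hx a (by simp [S])
    have hxb : x b = 0 := hx b (by simp [S])
    simp only [exp2 x hxa hxb, lin_count2]
    by_cases c1 : Xd E (up p0 a a) x = 0 <;> by_cases c2 : Xd E p0 x = 0 <;> simp [c1, c2, hq]
  have p1 : q ^ 2 ∣ cnt S (fun x => Xd E (up p0 a a) x = 0) := by
    have := sq_dvd E h h4 hι hW (h - 1) {a} S (by simp [S]) (by simp [hS2]) (by simp)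
      (by simp; omega)
    rwa [dg_single] at this
  have p2 : q ^ 2 ∣ cnt S (fun _ : ι → K => True) := by
    rw [cnt_true, hS2, hι]
    exact pow_dvd_pow _ (by omega)
  have ax : ∀ T : Finset ι, T.card = 3 →
      cnt T (fun x => Xd E (up p0 a c) x = 0) ≡ 0 [ZMOD q] := by
    intro T hT
    refine cnt_ax T _ (h - 1) (Xd_hasDeg E _ _ ?_) (by omega)
    rw [nup_up _ _ _ (by simp [p0]), nup_p0]
    omega
  have hins : (insert c S).card = 3 := by rw [Finset.card_insert_of_notMem hcS, hS2]
  have p3 : cnt S (fun x => Xd E (up p0 a a) x = 0 ∧ Xd E p0 x = 0) ≡ 0 [ZMOD q] := by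
    refine (cnt_elim_two S c hcS _ (Xd E (up (up p0 a a) c c)) _ (Xd E (up p0 c c))
      (fun x hx t => Xd_update E _ c (by simp [up, p0, hac.symm]) x hx t)
      (fun x hx t => Xd_update E _ c (by simp [p0]) x hx t)).trans ?_
    have e1 : cnt (insert c S) (fun x => Xd E (up (up p0 a a) c c) x * Xd E p0 x -
        Xd E (up p0 a a) x * Xd E (up p0 c c) x = 0) =
        cnt (insert c S) (fun x => Xd E (up p0 a c) x = 0) := by
      refine cnt_congr fun x _ => ?_
      rw [Xd_DJ E p0 x hac, Xd_symm0 E c a, sub_sub_cancel_left, neg_eq_zero, mul_self_eq_zero]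
    have e2 := pair_zero E h hι hW {c} (insert c S) a (by simp) (by simp [S]) (by simpa using hac)
      (by rw [hins]; simp; omega)
    rw [dg_single, up_comm _ hac.symm] at e2
    rw [e1]
    exact ((ax _ hins).sub e2).trans (modEq_of_eq (by ring))
  have hT : TT E a c b ≡ 0 [ZMOD q] := by
    unfold TT
    refine Int.ModEq.trans (modEq_of_eq ?_) (ax (insert b (insert c {a})) ?_)
    · exact cnt_congr fun x _ => by simp [z3]
    · exact Finset.card_eq_three.2 ⟨b, c, a, hbc, hab.symm, hac.symm, rfl⟩
  rw [hsum]
  rw [Int.modEq_zero_iff_dvd] at p3 hT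
  obtain ⟨u1, k1⟩ := p1
  obtain ⟨u2, k2⟩ := p2
  obtain ⟨u3, k3⟩ := p3
  obtain ⟨u4, k4⟩ := hT
  rw [k1, k2, k3, k4, Int.modEq_iff_dvd]
  exact ⟨u4 - u2 + u1 - u3, by ring⟩

lemma TOT_one (E : Matrix ι W K) (h : ℕ) (h4 : 4 ≤ h) (hι : Fintype.card ι = 2 * h)
    (hW : Fintype.card W = h) (e : ι → K) (he : VRel E e) (e' : ι → K) (he' : VRel E e')
    (a b c : ι) (hab : a ≠ b) (hac : a ≠ c) (hbc : b ≠ c)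
    (h0 : ∀ j, j ≠ a → e j = 0) (h0' : ∀ j, j ≠ b → e' j = 0)
    (ha : e a ^ 2 = 1) (hb : e' b ^ 2 = 1) :
    TOT E ≡ (Fintype.card K : ℤ) ^ 2 * TT E a b c [ZMOD (Fintype.card K : ℤ) ^ 3] := by
  set q : ℤ := (Fintype.card K : ℤ) with hq
  have hbS : b ∉ (insert a ∅ : Finset ι) := by simp [hab.symm]
  let S : Finset ι := insert b (insert a ∅)
  have hS2 : S.card = 2 := Finset.card_pair hab.symm
  have R := rel_one E e he a ha h0
  have R' := rel_one E e' he' b hb h0'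
  have exp2 : ∀ x, x a = 0 → x b = 0 → ∀ t s,
      Xd E p0 (Function.update (Function.update x b s) a t) = Xd E p0 x := by
    intro x hxa hxb t s
    rw [Xd_update E p0 a (by simp [p0]) _ (by simp [hab, hxa]), R,
      Xd_update E p0 b (by simp [p0]) _ hxb, R']
    ring
  have hsum : TOT E = q ^ 2 * cnt S (fun x => Xd E p0 x = 0) := by
    unfold TOT cnt
    rw [sum_cbase (K := K) ∅ a (by simp), sum_cbase (K := K) _ b hbS, Finset.mul_sum]
    refine Finset.sum_congr rfl fun x hx => ?_
    rw [mem_cbase] at hx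
    have hxa : x a = 0 := hx a (by simp [S])
    have hxb : x b = 0 := hx b (by simp [S])
    simp only [exp2 x hxa hxb]
    by_cases c2 : Xd E p0 x = 0 <;> simp [c2, hq, sq]
  have p1 : cnt S (fun x => Xd E p0 x = 0) ≡ 0 [ZMOD q] := by
    refine cnt_ax S _ h (Xd_hasDeg E _ _ ?_) (by omega)
    rw [nup_p0]; omega
  have hT : TT E a b c ≡ 0 [ZMOD q] := by
    unfold TT
    have e1 : cnt (insert c (insert b {a})) (fun x => Xd E (up (up p0 a b) c c) x = 0 ∧
        Xd E (up p0 a b) x = 0) = cnt (K := K) (insert c (insert b {a})) (fun _ => True) :=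
      cnt_congr fun x _ => by
        rw [R', up_comm _ hac, R']; simp
    rw [e1, cnt_true, Finset.card_eq_three.2 ⟨c, b, a, hbc.symm, hac.symm, hab.symm, rfl⟩, hι,
      Int.modEq_zero_iff_dvd]
    exact dvd_pow_self _ (by omega)
  rw [hsum]
  have := (p1.trans hT.symm).mul_left' (c := q ^ 2)
  rwa [show q ^ 2 * q = q ^ 3 by ring] at this

end Total

set_option linter.unusedSectionVars false

/-! Part F1: graphs. -/

section GraphPart
variable {ι V : Type*} [Fintype ι] [Fintype V] [DecidableEq ι] [DecidableEq V]

/-- incidence numbers -/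
def incN {ι V : Type*} [DecidableEq V] (R : Type*) [Ring R] (src tgt : ι → V) (i : ι) (v : V) : R :=
  if src i = v then 1 else if tgt i = v then -1 else 0

/-- reduced incidence matrix -/
def incE {ι V : Type*} [DecidableEq V] (R : Type*) [Ring R] (src tgt : ι → V) (v₀ : V) :
    Matrix ι {u : V // u ≠ v₀} R :=
  Matrix.of fun i w => incN R src tgt i w

def ConnSys {ι V : Type*} (src tgt : ι → V) : Prop :=
  ∀ S : Set V, (∀ i, src i ∈ S ↔ tgt i ∈ S) → S.Nonempty → ∀ v, v ∈ S

lemma incN_sum (R : Type*) [Ring R] (src tgt : ι → V) (hne : ∀ i, src i ≠ tgt i) (i : ι) :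
    ∑ v, incN R src tgt i v = 0 := by
  have : ∀ v, incN R src tgt i v = (if src i = v then 1 else 0) - (if tgt i = v then 1 else 0) := by
    intro v
    unfold incN
    by_cases h1 : src i = v
    · have : ¬ tgt i = v := fun h => hne i (h1.trans h.symm)
      simp [h1, this]
    · by_cases h2 : tgt i = v <;> simp [h1, h2]
  simp [this]

lemma incN_sq (R : Type*) [Ring R] (src tgt : ι → V) (i : ι) (v : V) (h : src i = v ∨ tgt i = v) :
    incN R src tgt i v ^ 2 = 1 := by
  unfold incN
  by_cases h1 : src i = v
  · simp [h1]
  · simp [h1, h.resolve_left h1]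

lemma incN_zero (R : Type*) [Ring R] (src tgt : ι → V) (i : ι) (v : V)
    (h : ¬ (src i = v ∨ tgt i = v)) : incN R src tgt i v = 0 := by
  unfold incN
  push Not at h
  simp [h.1, h.2]

lemma incN_vrel {K : Type*} [Field K] (src tgt : ι → V) (hne : ∀ i, src i ≠ tgt i) (v₀ v : V) :
    VRel (incE K src tgt v₀) (fun i => incN K src tgt i v) := by
  by_cases hv : v = v₀
  · subst hv
    refine ⟨fun _ => -1, fun j => ?_⟩
    have h1 := incN_sum K src tgt hne j
    rw [← Finset.add_sum_erase _ _ (Finset.mem_univ v)] at h1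
    have h2 : ∑ w : {u : V // u ≠ v}, incN K src tgt j w = ∑ u ∈ Finset.univ.erase v, incN K src tgt j u := by
      rw [Finset.sum_subtype (Finset.univ.erase v) (p := fun u => u ≠ v) (by simp)]
    simp only [incE, Matrix.of_apply, neg_one_mul, Finset.sum_neg_distrib, h2]
    linear_combination -h1
  · refine ⟨Pi.single ⟨v, hv⟩ 1, fun j => ?_⟩
    rw [Finset.sum_eq_single ⟨v, hv⟩]
    · simp [incE]
    · intro b _ hb; simp [hb]
    · simp

def dgr (src tgt : ι → V) (v : V) : ℕ := (Finset.univ.filter fun i => src i = v ∨ tgt i = v).card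

lemma dgr_sum (src tgt : ι → V) (hne : ∀ i, src i ≠ tgt i) :
    ∑ v, dgr src tgt v = 2 * Fintype.card ι := by
  have : ∀ v, dgr src tgt v = ∑ i, ((if src i = v then 1 else 0) + (if tgt i = v then 1 else 0)) := by
    intro v
    unfold dgr
    rw [Finset.card_filter]
    refine Finset.sum_congr rfl fun i _ => ?_
    by_cases h1 : src i = v
    · have : ¬ tgt i = v := fun h => hne i (h1.trans h.symm)
      simp [h1, this]
    · by_cases h2 : tgt i = v <;> simp [h1, h2]
  simp only [this]
  rw [Finset.sum_comm]
  simp [Finset.sum_add_distrib]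
  ring

lemma dgr_pos (src tgt : ι → V) (hc : ConnSys src tgt) (hV : 3 ≤ Fintype.card V) (v : V) :
    1 ≤ dgr src tgt v := by
  by_contra h
  have h0 : dgr src tgt v = 0 := by omega
  unfold dgr at h0
  rw [Finset.card_eq_zero, Finset.filter_eq_empty_iff] at h0
  have := hc {v} (fun i => by
    have := h0 (Finset.mem_univ i)
    push Not at this
    simp [this.1, this.2]) ⟨v, rfl⟩
  have h2 : Fintype.card V ≤ 1 := Fintype.card_le_one_iff.2 fun a b => by
    rw [Set.mem_singleton_iff.1 (this a), Set.mem_singleton_iff.1 (this b)]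
  omega

lemma dgr_cases (src tgt : ι → V) (hne : ∀ i, src i ≠ tgt i) (hc : ConnSys src tgt)
    (hV : 3 ≤ Fintype.card V) (h : ℕ) (hι : Fintype.card ι = 2 * h)
    (hVh : Fintype.card V = h + 1) :
    (∃ v, dgr src tgt v = 3) ∨ (∃ v, dgr src tgt v = 2) ∨
    ∃ v v', v ≠ v' ∧ dgr src tgt v = 1 ∧ dgr src tgt v' = 1 := by
  by_contra hcon
  push Not at hcon
  obtain ⟨h3, h2, h1⟩ := hcon
  have hs := dgr_sum src tgt hne
  have key : ∀ v, 4 ≤ dgr src tgt v + (if dgr src tgt v = 1 then 3 else 0) := by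
    intro v
    have a1 := dgr_pos src tgt hc hV v
    have a2 := h2 v
    have a3 := h3 v
    split_ifs <;> omega
  have hsum := Finset.sum_le_sum (fun v (_ : v ∈ Finset.univ) => key v)
  rw [Finset.sum_add_distrib, hs] at hsum
  have hle : ∑ v, (if dgr src tgt v = 1 then 3 else 0) ≤ 3 := by
    rw [← Finset.sum_filter, Finset.sum_const, smul_eq_mul]
    have : (Finset.univ.filter fun v => dgr src tgt v = 1).card ≤ 1 := by
      rw [Finset.card_le_one]
      intro a ha b hb
      by_contra hab
      simp only [Finset.mem_filter, Finset.mem_univ, true_and] at ha hb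
      exact h1 a b hab ha hb
    omega
  simp only [Finset.sum_const, Finset.card_univ, smul_eq_mul] at hsum
  omega

lemma pendant_ne (src tgt : ι → V) (hc : ConnSys src tgt)
    (hV : 3 ≤ Fintype.card V) (v v' : V) (hvv : v ≠ v') (a : ι)
    (h1 : ∀ i, (src i = v ∨ tgt i = v) ↔ i = a) (h2 : ∀ i, (src i = v' ∨ tgt i = v') ↔ i = a) :
    False := by
  have := hc {v, v'} (fun i => by
    by_cases hi : i = a
    · subst hi
      have k1 := (h1 i).2 rfl
      have k2 := (h2 i).2 rfl
      simp only [Set.mem_insert_iff, Set.mem_singleton_iff]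
      rcases k1 with k1 | k1 <;> rcases k2 with k2 | k2
      · exact absurd (k1.symm.trans k2) hvv
      · tauto
      · tauto
      · exact absurd (k1.symm.trans k2) hvv
    · have k1 := mt (h1 i).1 hi
      have k2 := mt (h2 i).1 hi
      simp only [Set.mem_insert_iff, Set.mem_singleton_iff]
      tauto) ⟨v, by simp⟩
  have h3 : (Finset.univ : Finset V) ⊆ {v, v'} := fun w _ => by simpa using this w
  have := Finset.card_le_card h3
  rw [Finset.card_pair hvv, Finset.card_univ] at this
  omega

theorem TOT_TT {K : Type*} [Field K] [Fintype K] (src tgt : ι → V) (hne : ∀ i, src i ≠ tgt i)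
    (hc : ConnSys src tgt) (hV : 3 ≤ Fintype.card V) (h : ℕ) (h4 : 4 ≤ h)
    (hι : Fintype.card ι = 2 * h) (hVh : Fintype.card V = h + 1) (v₀ : V) (a b c : ι)
    (hab : a ≠ b) (hac : a ≠ c) (hbc : b ≠ c) :
    TOT (incE K src tgt v₀) ≡ (Fintype.card K : ℤ) ^ 2 * TT (incE K src tgt v₀) a b c
      [ZMOD (Fintype.card K : ℤ) ^ 3] := by
  have hW : Fintype.card {u : V // u ≠ v₀} = h := by
    rw [Fintype.card_subtype_compl, hVh]; simp
  suffices hs : ∃ a' b' c' : ι, a' ≠ b' ∧ a' ≠ c' ∧ b' ≠ c' ∧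
      TOT (incE K src tgt v₀) ≡ (Fintype.card K : ℤ) ^ 2 * TT (incE K src tgt v₀) a' b' c'
      [ZMOD (Fintype.card K : ℤ) ^ 3] by
    obtain ⟨a', b', c', n1, n2, n3, hh⟩ := hs
    have := TT_all (incE K src tgt v₀) h h4 hι hW a' b' c' a b c n1 n2 n3 hab hac hbc
    have h3 := this.mul_left' (c := (Fintype.card K : ℤ) ^ 2)
    rw [← pow_succ] at h3
    exact hh.trans h3
  have vr := fun v => incN_vrel (K := K) src tgt hne v₀ v
  rcases dgr_cases src tgt hne hc hV h hι hVh with ⟨v, hv⟩ | ⟨v, hv⟩ | ⟨v, v', hvv, hv, hv'⟩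
  · obtain ⟨a', b', c', n1, n2, n3, hS⟩ := Finset.card_eq_three.1 hv
    have hm : ∀ i, (src i = v ∨ tgt i = v) ↔ (i = a' ∨ i = b' ∨ i = c') := by
      intro i
      have := Finset.ext_iff.1 hS i
      simpa using this
    refine ⟨a', b', c', n1, n2, n3, TOT_three _ h h4 hι hW _ (vr v) a' b' c' n1 n2 n3 ?_
      (incN_sq _ _ _ _ _ ((hm _).2 (by simp))) (incN_sq _ _ _ _ _ ((hm _).2 (by simp)))
      (incN_sq _ _ _ _ _ ((hm _).2 (by simp)))⟩
    intro j h1 h2 h3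
    exact incN_zero _ _ _ _ _ (by rw [hm]; tauto)
  · obtain ⟨a', b', n1, hS⟩ := Finset.card_eq_two.1 hv
    have hm : ∀ i, (src i = v ∨ tgt i = v) ↔ (i = a' ∨ i = b') := by
      intro i
      have := Finset.ext_iff.1 hS i
      simpa using this
    obtain ⟨c', hc'⟩ := exists_avoid ({a', b'} : Finset ι) (by rw [Finset.card_pair n1]; omega)
    simp only [Finset.mem_insert, Finset.mem_singleton, not_or] at hc'
    refine ⟨a', c', b', Ne.symm hc'.1, n1, hc'.2,
      TOT_two _ h h4 hι hW _ (vr v) a' b' c' n1 (Ne.symm hc'.1) (Ne.symm hc'.2) ?_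
      (incN_sq _ _ _ _ _ ((hm _).2 (by simp))) (incN_sq _ _ _ _ _ ((hm _).2 (by simp)))⟩
    intro j h1 h2
    exact incN_zero _ _ _ _ _ (by rw [hm]; tauto)
  · obtain ⟨a', hS⟩ := Finset.card_eq_one.1 hv
    obtain ⟨b', hS'⟩ := Finset.card_eq_one.1 hv'
    have hm : ∀ i, (src i = v ∨ tgt i = v) ↔ i = a' := by
      intro i
      have := Finset.ext_iff.1 hS i
      simpa using this
    have hm' : ∀ i, (src i = v' ∨ tgt i = v') ↔ i = b' := by
      intro i
      have := Finset.ext_iff.1 hS' i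
      simpa using this
    have n1 : a' ≠ b' := by
      rintro rfl
      exact pendant_ne src tgt hc hV v v' hvv a' hm hm'
    obtain ⟨c', hc'⟩ := exists_avoid ({a', b'} : Finset ι) (by rw [Finset.card_pair n1]; omega)
    simp only [Finset.mem_insert, Finset.mem_singleton, not_or] at hc'
    refine ⟨a', b', c', n1, Ne.symm hc'.1, Ne.symm hc'.2,
      TOT_one _ h h4 hι hW _ (vr v) _ (vr v') a' b' c' n1 (Ne.symm hc'.1) (Ne.symm hc'.2) ?_ ?_
      (incN_sq _ _ _ _ _ ((hm _).2 (by simp))) (incN_sq _ _ _ _ _ ((hm' _).2 (by simp)))⟩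
    · intro j h1
      exact incN_zero _ _ _ _ _ (by rw [hm]; tauto)
    · intro j h1
      exact incN_zero _ _ _ _ _ (by rw [hm']; tauto)

end GraphPart

set_option linter.unusedSectionVars false

/-! Part B1: the matrix-tree expansion. -/

section MatrixTree
variable {ι V W : Type*} [Fintype ι] [Fintype V] [Fintype W] [DecidableEq ι] [DecidableEq V]
  [DecidableEq W]

lemma Xd_expand_aux {R : Type*} [CommRing R] (E : Matrix ι W R) (x : ι → R) (A : Finset ι) :
    ∀ Z : Finset ι, Disjoint A Z → Xd E (dg Z) (fun i => if i ∈ A then x i else 0) =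
      ∑ S ∈ A.powerset, (∏ i ∈ S, x i) * Xd E (dg (S ∪ Z)) 0 := by
  induction A using Finset.induction_on with
  | empty => intro Z _; simp; rfl
  | insert k A hk ih =>
    intro Z hZ
    rw [Finset.disjoint_insert_left] at hZ
    have h1 : (fun i => if i ∈ insert k A then x i else 0) =
        Function.update (fun i => if i ∈ A then x i else 0) k (x k) := by
      funext i
      by_cases hi : i = k
      · subst hi; simp
      · simp [hi]
    rw [h1, Xd_update E (dg Z) k (by simp [dg, hZ.1]) _ (by simp [hk]), Finset.sum_powerset_insert hk,
      ← dg_insert, ih Z hZ.2, ih (insert k Z) (by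
        rw [Finset.disjoint_insert_right]; exact ⟨hk, hZ.2⟩), add_comm, Finset.mul_sum]
    congr 1
    refine Finset.sum_congr rfl fun S hS => ?_
    have hkS : k ∉ S := fun h => hk (Finset.mem_powerset.1 hS h)
    rw [Finset.prod_insert hkS, Finset.union_insert, Finset.insert_union]
    ring

lemma Xd_expand {R : Type*} [CommRing R] (E : Matrix ι W R) (x : ι → R) :
    Xd E p0 x = ∑ S : Finset ι, (∏ i ∈ S, x i) * Xd E (dg S) 0 := by
  have := Xd_expand_aux E x Finset.univ ∅ (by simp)
  simpa [dg_empty] using this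

lemma Xd_dg_block {R : Type*} [CommRing R] (E : Matrix ι W R) (S : Finset ι) :
    Xd E (dg S) 0 = (Matrix.fromBlocks 0 (Matrix.of fun (i : {i // ¬ i ∈ S}) w => E i w)
      (Matrix.of fun w (i : {i // ¬ i ∈ S}) => E i w) 0).det := by
  unfold Xd
  let e : {i // i ∈ S} ⊕ ({i // ¬ i ∈ S} ⊕ W) ≃ ι ⊕ W :=
    (Equiv.sumAssoc _ _ _).symm.trans ((Equiv.sumCompl (fun i => i ∈ S)).sumCongr (Equiv.refl W))
  rw [← Matrix.det_submatrix_equiv_self e]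
  have h : (rowM E (dg S) 0).submatrix e e = Matrix.fromBlocks 1 0
      (Matrix.of fun r c => rowM E (dg S) 0 (e (Sum.inr r)) (e (Sum.inl c)))
      (Matrix.fromBlocks 0 (Matrix.of fun (i : {i // ¬ i ∈ S}) w => E i w)
      (Matrix.of fun w (i : {i // ¬ i ∈ S}) => E i w) 0) := by
    ext r c
    rcases r with r | r | r <;> rcases c with c | c | c
    · by_cases hrc : r = c
      · subst hrc; simp [e, rowM, dg, r.2]
      · have : (c : ι) ≠ r := fun h => hrc (Subtype.ext h.symm)
        simp [e, rowM, dg, r.2, Pi.single_apply, Matrix.one_apply, hrc, this]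
    · have : (c : ι) ≠ r := fun h => c.2 (h ▸ r.2)
      simp [e, rowM, dg, r.2, Pi.single_apply, this]
    · simp [e, rowM, dg, r.2, Pi.single_apply]
    · simp [e]
    · simp [e, rowM, dg, r.2]
    · simp [e, rowM, dg, r.2]
    · simp [e]
    · simp [e, rowM, dg]
    · simp [e, rowM, dg]
  rw [h, Matrix.det_fromBlocks_zero₁₂, Matrix.det_one, one_mul]

/-- the sign -/
noncomputable def sgW (W R : Type*) [Fintype W] [DecidableEq W] [CommRing R] : R :=
  (Matrix.fromBlocks (0 : Matrix W W R) (1 : Matrix W W R) (1 : Matrix W W R)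
    (0 : Matrix W W R)).det

lemma sgW_sq (R : Type*) [CommRing R] : sgW W R * sgW W R = 1 := by
  unfold sgW
  rw [← Matrix.det_mul, Matrix.fromBlocks_multiply]
  simp

lemma Xd_dg_square {R : Type*} [CommRing R] (E : Matrix ι W R) (S : Finset ι)
    (e : W ≃ {i // ¬ i ∈ S}) :
    Xd E (dg S) 0 = sgW W R * (Matrix.of fun v w : W => E (e v) w).det ^ 2 := by
  rw [Xd_dg_block]
  rw [← Matrix.det_submatrix_equiv_self (e.sumCongr (Equiv.refl W))]
  set A : Matrix W W R := Matrix.of fun v w : W => E (e v) w with hA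
  have h : (Matrix.fromBlocks 0 (Matrix.of fun (i : {i // ¬ i ∈ S}) w => E i w)
      (Matrix.of fun w (i : {i // ¬ i ∈ S}) => E i w) 0).submatrix (e.sumCongr (Equiv.refl W))
      (e.sumCongr (Equiv.refl W)) = Matrix.fromBlocks 0 A Aᵀ 0 := by
    ext r c
    rcases r with r | r <;> rcases c with c | c <;> simp [hA]
  rw [h]
  have h2 : (Matrix.fromBlocks 0 A Aᵀ 0).det * sgW W R = A.det ^ 2 := by
    unfold sgW
    rw [← Matrix.det_mul, Matrix.fromBlocks_multiply]
    simp [sq]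
  calc _ = (Matrix.fromBlocks (0 : Matrix W W R) A Aᵀ (0 : Matrix W W R)).det * (sgW W R * sgW W R) := by rw [sgW_sq, mul_one]
    _ = _ := by rw [← mul_assoc, h2, mul_comm]

lemma Xd_dg_card {K : Type*} [Field K] (E : Matrix ι W K) (S : Finset ι)
    (hc : Fintype.card {i // ¬ i ∈ S} ≠ Fintype.card W) : Xd E (dg S) 0 = 0 := by
  rw [Xd_dg_block]
  rcases lt_or_gt_of_ne hc with h | h
  · set A : Matrix {i // ¬ i ∈ S} W K := Matrix.of fun (i : {i // ¬ i ∈ S}) w => E i w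
    have := LinearMap.ker_ne_bot_of_finrank_lt (f := A.mulVecLin) (by simpa using h)
    obtain ⟨w, hw, hw0⟩ := (Submodule.ne_bot_iff _).1 this
    rw [← Matrix.exists_mulVec_eq_zero_iff]
    refine ⟨Sum.elim 0 w, ?_, ?_⟩
    · intro h0
      apply hw0
      funext j
      exact congrFun h0 (Sum.inr j)
    · rw [Matrix.fromBlocks_mulVec]
      have : A *ᵥ w = 0 := by simpa using hw
      ext r
      rcases r with r | r
      · simpa using congrFun this r
      · simp
  · set B : Matrix W {i // ¬ i ∈ S} K := Matrix.of fun w (i : {i // ¬ i ∈ S}) => E i w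
    have := LinearMap.ker_ne_bot_of_finrank_lt (f := B.mulVecLin) (by simpa using h)
    obtain ⟨w, hw, hw0⟩ := (Submodule.ne_bot_iff _).1 this
    rw [← Matrix.exists_mulVec_eq_zero_iff]
    refine ⟨Sum.elim w 0, ?_, ?_⟩
    · intro h0
      apply hw0
      funext j
      exact congrFun h0 (Sum.inl j)
    · rw [Matrix.fromBlocks_mulVec]
      have : B *ᵥ w = 0 := by simpa using hw
      ext r
      rcases r with r | r
      · simp
      · simpa using congrFun this r

def ConnOn {ι V : Type*} (src tgt : ι → V) (T : Finset ι) : Prop :=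
  ∀ S : Set V, (∀ i ∈ T, src i ∈ S ↔ tgt i ∈ S) → S.Nonempty → ∀ v, v ∈ S

lemma incE_mulVec {R : Type*} [Ring R] (src tgt : ι → V) (hne : ∀ i, src i ≠ tgt i) (v₀ : V)
    (f : V → R) (hf : f v₀ = 0) (i : ι) :
    ∑ w : {u : V // u ≠ v₀}, incE R src tgt v₀ i w * f w = f (src i) - f (tgt i) := by
  have h2 : ∑ w : {u : V // u ≠ v₀}, incE R src tgt v₀ i w * f w =
      ∑ u ∈ Finset.univ.erase v₀, incN R src tgt i u * f u := by
    rw [Finset.sum_subtype (Finset.univ.erase v₀) (p := fun u => u ≠ v₀) (by simp)]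
    rfl
  rw [h2, Finset.sum_erase _ (by rw [hf, mul_zero])]
  have : ∀ v, incN R src tgt i v * f v =
      (if src i = v then f v else 0) - (if tgt i = v then f v else 0) := by
    intro v
    unfold incN
    by_cases h1 : src i = v
    · have : ¬ tgt i = v := fun h => hne i (h1.trans h.symm)
      simp [h1, this]
    · by_cases h2 : tgt i = v <;> simp [h1, h2]
  simp [this]

lemma det_conn_ne {K : Type*} [Field K] (src tgt : ι → V) (hne : ∀ i, src i ≠ tgt i) (v₀ : V)
    (S : Finset ι) (e : {u : V // u ≠ v₀} ≃ {i // ¬ i ∈ S}) (hc : ConnOn src tgt Sᶜ) :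
    (Matrix.of fun v w => incE K src tgt v₀ (e v) w).det ≠ 0 := by
  rw [Ne, ← Matrix.exists_mulVec_eq_zero_iff]
  rintro ⟨f, hf0, hf⟩
  apply hf0
  let g : V → K := fun v => if h : v ≠ v₀ then f ⟨v, h⟩ else 0
  have hg : g v₀ = 0 := by simp [g]
  have hgw : ∀ w : {u : V // u ≠ v₀}, g w = f w := fun w => by simp [g, w.2]
  have := hc {v | g v = 0} (fun i hi => by
    have h1 := incE_mulVec (R := K) src tgt hne v₀ g hg i
    have h2 := congrFun hf (e.symm ⟨i, by simpa using hi⟩)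
    simp only [Matrix.mulVec, dotProduct, Matrix.of_apply, Equiv.apply_symm_apply,
      Pi.zero_apply] at h2
    simp only [hgw] at h1
    rw [h2] at h1
    rw [Set.mem_ofPred_eq, Set.mem_ofPred_eq, sub_eq_zero.1 h1.symm]) ⟨v₀, hg⟩
  funext w
  rw [← hgw]
  exact this w

lemma det_conn_sq {K : Type*} [Field K] (src tgt : ι → V) (hne : ∀ i, src i ≠ tgt i) (v₀ : V)
    (S : Finset ι) (e : {u : V // u ≠ v₀} ≃ {i // ¬ i ∈ S}) (hc : ConnOn src tgt Sᶜ) :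
    (Matrix.of fun v w => incE K src tgt v₀ (e v) w).det ^ 2 = 1 := by
  have hmap : ∀ (F : Type _) [Field F], (Int.castRingHom F)
      (Matrix.of fun v w => incE ℤ src tgt v₀ (e v) w).det =
      (Matrix.of fun v w => incE F src tgt v₀ (e v) w).det := by
    intro F _
    rw [RingHom.map_det]
    congr 1
    ext v w
    simp only [RingHom.mapMatrix_apply, Matrix.map_apply, Matrix.of_apply, incE, incN]
    split_ifs <;> simp
  set d : ℤ := (Matrix.of fun v w => incE ℤ src tgt v₀ (e v) w).det with hd
  have h1 : d.natAbs = 1 := by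
    by_contra hcon
    obtain ⟨p, hp, hpd⟩ := Nat.exists_prime_and_dvd hcon
    haveI : Fact p.Prime := ⟨hp⟩
    refine det_conn_ne (K := ULift (ZMod p)) src tgt hne v₀ S e hc ?_
    rw [← hmap]
    have : ((d : ℤ) : ZMod p) = 0 := by
      rw [ZMod.intCast_zmod_eq_zero_iff_dvd]
      exact Int.natCast_dvd.2 hpd
    apply ULift.ext
    simpa using this
  rw [← hmap, ← map_pow]
  have : d ^ 2 = 1 := by rw [← Int.natAbs_sq, h1]; simp
  rw [this, map_one]

lemma det_nconn {K : Type*} [Field K] (src tgt : ι → V) (hne : ∀ i, src i ≠ tgt i) (v₀ : V)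
    (S : Finset ι) (e : {u : V // u ≠ v₀} ≃ {i // ¬ i ∈ S}) (hc : ¬ ConnOn src tgt Sᶜ) :
    (Matrix.of fun v w => incE K src tgt v₀ (e v) w).det = 0 := by
  unfold ConnOn at hc
  push Not at hc
  have : ∃ Z : Set V, (∀ i ∈ Sᶜ, src i ∈ Z ↔ tgt i ∈ Z) ∧ v₀ ∉ Z ∧ Z.Nonempty := by
    obtain ⟨Z, h1, h2, v, hv⟩ := hc
    by_cases h0 : v₀ ∈ Z
    · exact ⟨Zᶜ, fun i hi => not_congr (h1 i hi), fun h => h h0, ⟨v, hv⟩⟩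
    · exact ⟨Z, h1, h0, h2⟩
  obtain ⟨Z, h1, h0, z, hz⟩ := this
  rw [← Matrix.exists_mulVec_eq_zero_iff]
  let g : V → K := fun v => if v ∈ Z then 1 else 0
  have hz0 : z ≠ v₀ := fun h => h0 (h ▸ hz)
  refine ⟨fun w => g w, ?_, ?_⟩
  · intro h
    have := congrFun h ⟨z, hz0⟩
    simp [g, hz] at this
  · funext v
    have := incE_mulVec (R := K) src tgt hne v₀ g (by simp [g, h0]) (e v)
    simp only [Matrix.mulVec, dotProduct, Matrix.of_apply, Pi.zero_apply]
    rw [this]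
    have hh := h1 (e v) (by simpa using (e v).2)
    simp only [g, hh, sub_self]

theorem matrix_tree {K : Type*} [Field K] (src tgt : ι → V) (hne : ∀ i, src i ≠ tgt i) (v₀ : V)
    (x : ι → K) :
    Xd (incE K src tgt v₀) p0 x = sgW {u : V // u ≠ v₀} K *
      ∑ T : Finset ι, if ConnOn src tgt T ∧ T.card + 1 = Fintype.card V then ∏ i ∈ Tᶜ, x i else 0 := by
  have hV : Fintype.card {u : V // u ≠ v₀} + 1 = Fintype.card V := by
    rw [Fintype.card_subtype_compl]
    have : 0 < Fintype.card V := Fintype.card_pos_iff.2 ⟨v₀⟩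
    simp; omega
  rw [Xd_expand, Finset.mul_sum]
  refine Fintype.sum_equiv (Function.Involutive.toPerm Compl.compl (compl_involutive (α := Finset ι))) _ _ ?_
  intro S
  have hSc : Fintype.card {i // ¬ i ∈ S} = (Sᶜ).card := by
    rw [Fintype.card_subtype]; congr 1; ext i; simp
  change _ = sgW {u : V // u ≠ v₀} K * (if ConnOn src tgt Sᶜ ∧ (Sᶜ).card + 1 = Fintype.card V
    then ∏ i ∈ Sᶜᶜ, x i else 0)
  rw [compl_compl]
  by_cases hcard : (Sᶜ).card + 1 = Fintype.card V
  · have e : {u : V // u ≠ v₀} ≃ {i // ¬ i ∈ S} := Fintype.equivOfCardEq (by rw [hSc]; omega)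
    rw [Xd_dg_square _ S e]
    by_cases hc : ConnOn src tgt Sᶜ
    · rw [det_conn_sq src tgt hne v₀ S e hc, if_pos ⟨hc, hcard⟩]; ring
    · rw [det_nconn src tgt hne v₀ S e hc, if_neg (fun h => hc h.1)]; ring
  · rw [Xd_dg_card _ S (by rw [hSc]; omega), if_neg (fun h => hcard h.2)]; ring

end MatrixTree

set_option linter.unusedSectionVars false

/-! Part B2: point counts and determinants. -/

section CountLink
variable {V : Type*} [Fintype V] [DecidableEq V]

lemma orient_ne {G : SimpleGraph V} {src tgt : G.edgeSet → V} (h : IsOrientation G src tgt)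
    (e : G.edgeSet) : src e ≠ tgt e := by
  intro he
  have h1 := e.2
  rw [h e, he, SimpleGraph.mem_edgeSet] at h1
  exact G.loopless.irrefl _ h1

lemma adj_iff_orient {G : SimpleGraph V} {src tgt : G.edgeSet → V} (h : IsOrientation G src tgt)
    (T : Set G.edgeSet) (u v : V) :
    (SimpleGraph.fromEdgeSet (Subtype.val '' T)).Adj u v ↔
      ∃ e ∈ T, (src e = u ∧ tgt e = v) ∨ (src e = v ∧ tgt e = u) := by
  rw [SimpleGraph.fromEdgeSet_adj]
  constructor
  · rintro ⟨⟨e, he, heq⟩, huv⟩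
    rw [h e] at heq
    refine ⟨e, he, ?_⟩
    simpa using heq
  · rintro ⟨e, he, heq⟩
    refine ⟨⟨e, he, by rw [h e]; simpa using heq⟩, ?_⟩
    have := orient_ne h e
    rcases heq with ⟨rfl, rfl⟩ | ⟨rfl, rfl⟩
    · exact this
    · exact this.symm

lemma connected_iff_closed (G : SimpleGraph V) [Nonempty V] :
    G.Connected ↔ ∀ S : Set V, (∀ u v, G.Adj u v → (u ∈ S ↔ v ∈ S)) → S.Nonempty → ∀ v, v ∈ S := by
  constructor
  · rintro hG S hS ⟨u, hu⟩ v
    obtain ⟨p⟩ := hG.preconnected u v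
    induction p with
    | nil => exact hu
    | cons hadj p ih => exact ih ((hS _ _ hadj).1 hu)
  · intro h
    refine SimpleGraph.Connected.mk fun u v => ?_
    refine h {w | G.Reachable u w} ?_ ⟨u, SimpleGraph.Reachable.refl u⟩ v
    intro a b hab
    exact ⟨fun h => h.trans hab.reachable, fun h => h.trans hab.symm.reachable⟩

lemma isTree_iff_sys {N : ℕ} {G : SimpleGraph V} [Nonempty V] {src tgt : G.edgeSet → V}
    (h : IsOrientation G src tgt) (ε : Fin N ≃ G.edgeSet) (T : Finset (Fin N)) :
    (SimpleGraph.fromEdgeSet (Subtype.val '' ((T.map ε.toEmbedding : Finset G.edgeSet) :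
      Set G.edgeSet))).IsTree ↔
      ConnOn (fun i => src (ε i)) (fun i => tgt (ε i)) T ∧ T.card + 1 = Fintype.card V := by
  rw [SimpleGraph.isTree_iff_connected_and_card, connected_iff_closed]
  refine and_congr ?_ ?_
  · unfold ConnOn
    refine forall_congr' fun S => ?_
    refine imp_congr ?_ Iff.rfl
    simp only [adj_iff_orient h]
    constructor
    · intro hh i hi
      exact hh _ _ ⟨ε i, by simpa using hi, Or.inl ⟨rfl, rfl⟩⟩
    · rintro hh u v ⟨e, he, heq⟩
      have := hh (ε.symm e) (by simpa [Equiv.eq_symm_apply] using he)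
      simp only [Equiv.apply_symm_apply] at this
      rcases heq with ⟨rfl, rfl⟩ | ⟨rfl, rfl⟩
      · exact this
      · exact this.symm
  · rw [SimpleGraph.edgeSet_fromEdgeSet, Nat.card_eq_fintype_card (α := V)]
    have h1 : (Subtype.val '' ((T.map ε.toEmbedding : Finset G.edgeSet) : Set G.edgeSet)) \
        Sym2.diagSet = (Subtype.val '' ((T.map ε.toEmbedding : Finset G.edgeSet) : Set G.edgeSet)) := by
      rw [sdiff_eq_left, Set.disjoint_left]
      rintro _ ⟨e, _, rfl⟩ he
      have := G.not_isDiag_of_mem_edgeSet e.2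
      exact this (by simpa using he)
    rw [h1, Nat.card_coe_set_eq, Set.ncard_image_of_injective _ Subtype.val_injective,
      Set.ncard_coe_finset, Finset.card_map]

lemma connSys_of_connected {N : ℕ} {G : SimpleGraph V} [Nonempty V] {src tgt : G.edgeSet → V}
    (h : IsOrientation G src tgt) (ε : Fin N ≃ G.edgeSet) (hG : G.Connected) :
    ConnSys (fun i => src (ε i)) (fun i => tgt (ε i)) := by
  rw [connected_iff_closed] at hG
  intro S hS
  refine hG S fun u v huv => ?_
  obtain ⟨e, he⟩ : ∃ e : G.edgeSet, (e : Sym2 V) = s(u, v) := ⟨⟨s(u, v), huv⟩, rfl⟩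
  have h1 := h e
  rw [he] at h1
  have h2 := hS (ε.symm e)
  simp only [Equiv.apply_symm_apply] at h2
  rcases Sym2.eq_iff.1 h1 with ⟨k1, k2⟩ | ⟨k1, k2⟩
  · rw [k1, k2]; exact h2
  · rw [k1, k2]; exact h2.symm

lemma aeval_graphPoly {N : ℕ} {G : SimpleGraph V} [Nonempty V] {src tgt : G.edgeSet → V}
    (h : IsOrientation G src tgt) (ε : Fin N ≃ G.edgeSet) (v₀ : V) {K : Type*} [Field K]
    (x : G.edgeSet → K) :
    Xd (incE K (fun i => src (ε i)) (fun i => tgt (ε i)) v₀) p0 (fun i => x (ε i)) =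
      sgW {u : V // u ≠ v₀} K * MvPolynomial.aeval x (graphPoly G) := by
  rw [matrix_tree _ _ (fun i => orient_ne h (ε i))]
  congr 1
  unfold graphPoly
  rw [map_sum]
  let _ : Fintype G.edgeSet := Fintype.ofFinite _
  refine Fintype.sum_equiv (Equiv.finsetCongr ε) _ _ fun T => ?_
  have key := isTree_iff_sys h ε T
  rw [Equiv.finsetCongr_apply]
  by_cases hT : ConnOn (fun i => src (ε i)) (fun i => tgt (ε i)) T ∧ T.card + 1 = Fintype.card V
  · rw [if_pos hT, if_pos (key.2 hT), map_prod]
    simp only [MvPolynomial.aeval_X]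
    refine Finset.prod_equiv ε ?_ (fun i _ => rfl)
    intro i
    simp
  · rw [if_neg hT, if_neg (fun hh => hT (key.1 hh)), map_zero]

lemma Xcount_TOT {N : ℕ} {G : SimpleGraph V} [Nonempty V] {src tgt : G.edgeSet → V}
    (h : IsOrientation G src tgt) (ε : Fin N ≃ G.edgeSet) (v₀ : V) {K : Type*} [Field K]
    [Fintype K] :
    (Xcount G K : ℤ) = TOT (incE K (fun i => src (ε i)) (fun i => tgt (ε i)) v₀) := by
  unfold Xcount TOT cnt
  rw [← Finset.sum_filter, Finset.sum_const, nsmul_eq_mul, mul_one]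
  congr 1
  have hs : sgW {u : V // u ≠ v₀} K ≠ 0 := fun h0 => by
    have := sgW_sq (W := {u : V // u ≠ v₀}) K
    rw [h0, zero_mul] at this
    exact zero_ne_one this
  rw [← Nat.card_eq_finsetCard]
  refine Nat.card_congr ((ε.arrowCongr (Equiv.refl K)).symm.subtypeEquiv fun x => ?_)
  have := aeval_graphPoly h ε v₀ x
  simp only [Finset.mem_filter, mem_cbase, Finset.notMem_empty, false_imp_iff, implies_true,
    true_and]
  have e1 : (ε.arrowCongr (Equiv.refl K)).symm x = fun i => x (ε i) := by
    funext i; simp [Equiv.arrowCongr]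
  rw [e1, this]
  simp [hs]

end CountLink

set_option linter.unusedSectionVars false

/-! Part D1: the frozen minors as determinants with replaced rows. -/

section MinorLink

lemma minorDet_perm {R : Type*} [CommRing R] {N : ℕ} {W' : Type*} [Fintype W'] [DecidableEq W']
    (M : Matrix (Fin N ⊕ W') (Fin N ⊕ W') R) (I J : Finset (Fin N)) (σ : Equiv.Perm (Fin N))
    (hs : Equiv.Perm.sign σ = 1) (hIJ : ∀ i, σ i ∈ J ↔ i ∈ I)
    (hmono : ∀ i j, i ∉ I → j ∉ I → i < j → σ i < σ j) :
    minorDet M I J = Matrix.det (Matrix.of fun r c => Sum.elim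
      (fun i => if i ∈ I then (Pi.single (Sum.inl (σ i)) 1 : Fin N ⊕ W' → R) c else M (Sum.inl i) c)
      (fun w => M (Sum.inr w) c) r) := by
  have hJ : J = I.map σ.toEmbedding := by
    ext j
    rw [Finset.mem_map_equiv, ← hIJ, Equiv.apply_symm_apply]
  have hcard : (Jᶜ : Finset (Fin N)).card = (Iᶜ : Finset (Fin N)).card := by
    rw [Finset.card_compl, Finset.card_compl, hJ, Finset.card_map]
  unfold minorDet
  rw [dif_pos hcard]
  set Q : Matrix (Fin N ⊕ W') (Fin N ⊕ W') R := Matrix.of fun r c => Sum.elim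
      (fun i => if i ∈ I then (Pi.single (Sum.inl (σ i)) 1 : Fin N ⊕ W' → R) c else M (Sum.inl i) c)
      (fun w => M (Sum.inr w) c) r with hQ
  have hcol : ∀ j, ((Jᶜ.orderIsoOfFin hcard j : {x // x ∈ (Jᶜ : Finset (Fin N))}) : Fin N) =
      σ ((Iᶜ.orderIsoOfFin rfl j : {x // x ∈ (Iᶜ : Finset (Fin N))}) : Fin N) := by
    have hI : ∀ j, ((Iᶜ.orderIsoOfFin rfl j : {x // x ∈ (Iᶜ : Finset (Fin N))}) : Fin N) ∉ I :=
      fun j => Finset.mem_compl.1 (Iᶜ.orderIsoOfFin rfl j).2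
    have := Finset.orderEmbOfFin_unique hcard
      (f := fun j => σ ((Iᶜ.orderIsoOfFin rfl j : {x // x ∈ (Iᶜ : Finset (Fin N))}) : Fin N))
      (fun j => by
        rw [Finset.mem_compl, hIJ]
        exact hI j)
      (fun a b hab => hmono _ _ (hI a) (hI b) (by
        have := (Iᶜ.orderIsoOfFin rfl).strictMono hab
        exact this))
    intro j
    exact (congrFun this j).symm
  have h1 : Q.det = (Q.submatrix id (σ.sumCongr (Equiv.refl W'))).det := by
    have := Matrix.det_permute' (σ.sumCongr (Equiv.refl W')) Q
    rw [this]
    have h2 : Equiv.Perm.sign (σ.sumCongr (Equiv.refl W')) = 1 := by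
      have := Equiv.Perm.sign_sumCongr σ (1 : Equiv.Perm W')
      rw [hs, Equiv.Perm.sign_one, mul_one] at this
      exact this
    rw [h2]; simp
  rw [h1]
  let oI := Iᶜ.orderIsoOfFin rfl
  let e0 : Fin (Iᶜ : Finset (Fin N)).card ≃ {i // ¬ i ∈ I} :=
    oI.toEquiv.trans (Equiv.subtypeEquivRight (by simp))
  let e : {i // i ∈ I} ⊕ (Fin (Iᶜ : Finset (Fin N)).card ⊕ W') ≃ Fin N ⊕ W' :=
    ((Equiv.refl _).sumCongr (e0.sumCongr (Equiv.refl W'))).trans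
    ((Equiv.sumAssoc _ _ _).symm.trans ((Equiv.sumCompl (fun i => i ∈ I)).sumCongr (Equiv.refl W')))
  rw [← Matrix.det_submatrix_equiv_self e]
  have he1 : ∀ i, e (Sum.inl i) = Sum.inl (i : Fin N) := fun i => rfl
  have he2 : ∀ i, e (Sum.inr (Sum.inl i)) = Sum.inl ((oI i : {x // x ∈ (Iᶜ : Finset (Fin N))}) : Fin N) :=
    fun i => rfl
  have he3 : ∀ i, e (Sum.inr (Sum.inr i)) = Sum.inr i := fun i => rfl
  have hoI : ∀ j, ((oI j : {x // x ∈ (Iᶜ : Finset (Fin N))}) : Fin N) ∉ I :=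
      fun j => Finset.mem_compl.1 (oI j).2
  have h : (Q.submatrix id (σ.sumCongr (Equiv.refl W'))).submatrix e e = Matrix.fromBlocks 1 0
      (Matrix.of fun r c => (Q.submatrix id (σ.sumCongr (Equiv.refl W'))) (e (Sum.inr r)) (e (Sum.inl c)))
      (Matrix.of
      fun (r c : Fin (Iᶜ : Finset (Fin N)).card ⊕ W') =>
        M (Sum.map (fun i => ((Iᶜ.orderIsoOfFin rfl i : {x // x ∈ (Iᶜ : Finset (Fin N))}) : Fin N)) id r)
          (Sum.map (fun j => ((Jᶜ.orderIsoOfFin hcard j : {x // x ∈ (Jᶜ : Finset (Fin N))}) : Fin N)) id c)) := by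
    ext r c
    rcases r with r | r | r <;> rcases c with c | c | c
    · by_cases hrc : r = c
      · subst hrc; simp [he1, hQ, r.2]
      · have : (c : Fin N) ≠ r := fun h => hrc (Subtype.ext h.symm)
        simp [he1, hQ, r.2, Pi.single_apply, Matrix.one_apply, hrc, this]
    · have : ((oI c : {x // x ∈ (Iᶜ : Finset (Fin N))}) : Fin N) ≠ r := fun h => hoI c (h ▸ r.2)
      simp [he1, he2, hQ, r.2, Pi.single_apply, this]
    · simp [he1, he3, hQ, r.2]
    · simp
    · simp only [Matrix.submatrix_apply, he2, hQ, Matrix.of_apply, id, Sum.elim_inl, if_neg (hoI r),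
        Matrix.fromBlocks_apply₂₂, Sum.map_inl, hcol]
      rfl
    · simp only [Matrix.submatrix_apply, he2, he3, hQ, Matrix.of_apply, id, Sum.elim_inl, if_neg (hoI r),
        Matrix.fromBlocks_apply₂₂, Sum.map_inl, Sum.map_inr, hcol]
      rfl
    · simp
    · simp only [Matrix.submatrix_apply, he2, he3, hQ, Matrix.of_apply, id, Sum.elim_inr,
        Matrix.fromBlocks_apply₂₂, Sum.map_inl, Sum.map_inr, hcol]
      rfl
    · simp only [Matrix.submatrix_apply, he3, hQ, Matrix.of_apply, id, Sum.elim_inr,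
        Matrix.fromBlocks_apply₂₂, Sum.map_inr]
      rfl
  rw [h, Matrix.det_fromBlocks_zero₁₂, Matrix.det_one, one_mul]

/-- the variables with those in `K` set to zero -/
noncomputable def xz {N : ℕ} (K : Finset (Fin N)) : Fin N → MvPolynomial (Fin N) ℤ :=
  fun i => if i ∈ K then 0 else MvPolynomial.X i

lemma dodgson_Xd {V : Type*} [Fintype V] [DecidableEq V] {N : ℕ}
    (G : SimpleGraph V) (ε : Fin N ≃ G.edgeSet) (src tgt : G.edgeSet → V) (v₀ : V)
    (I J K : Finset (Fin N)) (σ : Equiv.Perm (Fin N))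
    (hs : Equiv.Perm.sign σ = 1) (hIJ : ∀ i, σ i ∈ J ↔ i ∈ I)
    (hmono : ∀ i j, i ∉ I → j ∉ I → i < j → σ i < σ j) :
    dodgson G ε src tgt v₀ I J K = (-1) ^ (Fintype.card {u : V // u ≠ v₀}) *
      Xd (incE (MvPolynomial (Fin N) ℤ) (fun i => src (ε i)) (fun i => tgt (ε i)) v₀)
        (fun i => if i ∈ I then some (σ i) else none) (xz K) := by
  unfold dodgson
  have := minorDet_perm (MGmatrix G ε src tgt v₀ K) I J σ hs hIJ hmono
  have h2 : ∏ r : Fin N ⊕ {u : V // u ≠ v₀}, (Sum.elim (fun _ => (1 : MvPolynomial (Fin N) ℤ))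
      (fun _ => -1)) r = (-1) ^ (Fintype.card {u : V // u ≠ v₀}) := by
    rw [Fintype.prod_sum_type]; simp
  rw [← h2]
  unfold Xd
  rw [← Matrix.det_mul_column]
  convert this using 2
  ext1 r c
  rcases r with r | r
  · by_cases hr : r ∈ I
    · simp [rowM, hr]
    · rcases c with c | c
      · by_cases hrc : r = c
        · subst hrc; simp [rowM, hr, MGmatrix, xz]
        · simp [rowM, hr, MGmatrix, xz, hrc]
      · simp [rowM, hr, MGmatrix, incE, incN]
        split_ifs <;> rfl
  · rcases c with c | c
    · simp [rowM, MGmatrix, incE, incN]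
      split_ifs <;> simp
    · simp [rowM, MGmatrix]

lemma sign_two {N : ℕ} (a b c d : Fin N) (hab : a ≠ b) (hcd : c ≠ d) :
    Equiv.Perm.sign (Equiv.swap a b * Equiv.swap c d) = 1 := by
  rw [Equiv.Perm.sign_mul, Equiv.Perm.sign_swap hab, Equiv.Perm.sign_swap hcd]; simp

/-- the polynomial version of `Xd` -/
noncomputable def Xp {V : Type*} [Fintype V] [DecidableEq V] {N : ℕ} (s t : Fin N → V) (v₀ : V)
    (P : Fin N → Option (Fin N)) (K : Finset (Fin N)) : MvPolynomial (Fin N) ℤ :=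
  Xd (incE (MvPolynomial (Fin N) ℤ) s t v₀) P (xz K)

lemma fiveInv_Xp {V : Type*} [Fintype V] [DecidableEq V] {N : ℕ}
    (G : SimpleGraph V) (ε : Fin N ≃ G.edgeSet) (src tgt : G.edgeSet → V) (v₀ : V)
    (i j k l m : Fin N) (hi : (i : ℕ) = 0) (hj : (j : ℕ) = 1) (hk : (k : ℕ) = 2) (hl : (l : ℕ) = 3)
    (hm : (m : ℕ) = 4) :
    fiveInv G ε src tgt v₀ i j k l m =
      Xp (fun i => src (ε i)) (fun i => tgt (ε i)) v₀ (up (up p0 i k) j l) {m} *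
      Xp (fun i => src (ε i)) (fun i => tgt (ε i)) v₀ (up (up (up p0 i j) k l) m m) ∅ -
      Xp (fun i => src (ε i)) (fun i => tgt (ε i)) v₀ (up (up p0 i j) k l) {m} *
      Xp (fun i => src (ε i)) (fun i => tgt (ε i)) v₀ (up (up (up p0 i k) j l) m m) ∅ := by
  have nij : i ≠ j := fun h => by rw [Fin.ext_iff] at h; omega
  have nik : i ≠ k := fun h => by rw [Fin.ext_iff] at h; omega
  have nil : i ≠ l := fun h => by rw [Fin.ext_iff] at h; omega
  have nim : i ≠ m := fun h => by rw [Fin.ext_iff] at h; omega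
  have njk : j ≠ k := fun h => by rw [Fin.ext_iff] at h; omega
  have njl : j ≠ l := fun h => by rw [Fin.ext_iff] at h; omega
  have njm : j ≠ m := fun h => by rw [Fin.ext_iff] at h; omega
  have nkl : k ≠ l := fun h => by rw [Fin.ext_iff] at h; omega
  have nkm : k ≠ m := fun h => by rw [Fin.ext_iff] at h; omega
  have nlm : l ≠ m := fun h => by rw [Fin.ext_iff] at h; omega
  let σ : Equiv.Perm (Fin N) := Equiv.swap i k * Equiv.swap j l
  let τ : Equiv.Perm (Fin N) := Equiv.swap i j * Equiv.swap k l
  have sσ : Equiv.Perm.sign σ = 1 := sign_two _ _ _ _ nik njl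
  have sτ : Equiv.Perm.sign τ = 1 := sign_two _ _ _ _ nij nkl
  have vσ : ∀ a, σ a = if a = i then k else if a = k then i else if a = j then l else
      if a = l then j else a := by
    intro a
    simp only [σ, Equiv.Perm.mul_apply, Equiv.swap_apply_def]
    split_ifs <;> simp_all
  have vτ : ∀ a, τ a = if a = i then j else if a = j then i else if a = k then l else
      if a = l then k else a := by
    intro a
    simp only [τ, Equiv.Perm.mul_apply, Equiv.swap_apply_def]
    split_ifs <;> simp_all
  have hP1 : (fun a => if a ∈ ({i, j} : Finset (Fin N)) then some (σ a) else none) =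
      up (up p0 i k) j l := by
    funext a
    rw [vσ]
    by_cases h1 : a = j
    · subst h1; simp [up, nij.symm, njk]
    · by_cases h2 : a = i
      · subst h2; simp [up, h1]
      · simp [up, h1, h2, p0]
  have hP2 : (fun a => if a ∈ ({i, k} : Finset (Fin N)) then some (τ a) else none) =
      up (up p0 i j) k l := by
    funext a
    rw [vτ]
    by_cases h1 : a = k
    · subst h1; simp [up, nik.symm, njk.symm]
    · by_cases h2 : a = i
      · subst h2; simp [up, h1]
      · simp [up, h1, h2, p0]
  have hP3 : (fun a => if a ∈ ({i, j, m} : Finset (Fin N)) then some (σ a) else none) =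
      up (up (up p0 i k) j l) m m := by
    rw [← hP1]
    funext a
    by_cases h1 : a = m
    · subst h1; simp [up, vσ, nim.symm, njm.symm, nkm.symm, nlm.symm]
    · simp [up, h1]
  have hP4 : (fun a => if a ∈ ({i, k, m} : Finset (Fin N)) then some (τ a) else none) =
      up (up (up p0 i j) k l) m m := by
    rw [← hP2]
    funext a
    by_cases h1 : a = m
    · subst h1; simp [up, vτ, nim.symm, njm.symm, nkm.symm, nlm.symm]
    · simp [up, h1]
  have m1 : ∀ a b, a ∉ ({i, j} : Finset (Fin N)) → b ∉ ({i, j} : Finset (Fin N)) → a < b →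
      σ a < σ b := by
    intro a b ha hb hab
    rw [vσ, vσ]
    simp only [Finset.mem_insert, Finset.mem_singleton, not_or, Fin.ext_iff] at ha hb
    simp only [Fin.lt_def, Fin.ext_iff] at hab ⊢
    split_ifs <;> omega
  have m2 : ∀ a b, a ∉ ({i, k} : Finset (Fin N)) → b ∉ ({i, k} : Finset (Fin N)) → a < b →
      τ a < τ b := by
    intro a b ha hb hab
    rw [vτ, vτ]
    simp only [Finset.mem_insert, Finset.mem_singleton, not_or, Fin.ext_iff] at ha hb
    simp only [Fin.lt_def, Fin.ext_iff] at hab ⊢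
    split_ifs <;> omega
  have c1 : ∀ a, σ a ∈ ({k, l} : Finset (Fin N)) ↔ a ∈ ({i, j} : Finset (Fin N)) := by
    intro a
    rw [vσ]
    simp only [Finset.mem_insert, Finset.mem_singleton, Fin.ext_iff]
    split_ifs <;> omega
  have c2 : ∀ a, τ a ∈ ({j, l} : Finset (Fin N)) ↔ a ∈ ({i, k} : Finset (Fin N)) := by
    intro a
    rw [vτ]
    simp only [Finset.mem_insert, Finset.mem_singleton, Fin.ext_iff]
    split_ifs <;> omega
  have c3 : ∀ a, σ a ∈ ({k, l, m} : Finset (Fin N)) ↔ a ∈ ({i, j, m} : Finset (Fin N)) := by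
    intro a
    rw [vσ]
    simp only [Finset.mem_insert, Finset.mem_singleton, Fin.ext_iff]
    split_ifs <;> omega
  have c4 : ∀ a, τ a ∈ ({j, l, m} : Finset (Fin N)) ↔ a ∈ ({i, k, m} : Finset (Fin N)) := by
    intro a
    rw [vτ]
    simp only [Finset.mem_insert, Finset.mem_singleton, Fin.ext_iff]
    split_ifs <;> omega
  unfold fiveInv
  rw [Matrix.det_fin_two_of,
    dodgson_Xd G ε src tgt v₀ {i, j} {k, l} {m} σ sσ c1 m1,
    dodgson_Xd G ε src tgt v₀ {i, k} {j, l} {m} τ sτ c2 m2,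
    dodgson_Xd G ε src tgt v₀ {i, j, m} {k, l, m} ∅ σ sσ c3
      (fun a b ha hb => m1 a b (fun h => ha (by simp at h ⊢; tauto)) (fun h => hb (by simp at h ⊢; tauto))),
    dodgson_Xd G ε src tgt v₀ {i, k, m} {j, l, m} ∅ τ sτ c4
      (fun a b ha hb => m2 a b (fun h => ha (by simp at h ⊢; tauto)) (fun h => hb (by simp at h ⊢; tauto))),
    hP1, hP2, hP3, hP4]
  have hsq : ((-1) ^ (Fintype.card {u : V // u ≠ v₀}) : MvPolynomial (Fin N) ℤ) ^ 2 = 1 := by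
    rw [← pow_mul, mul_comm, pow_mul]; simp
  unfold Xp
  generalize Xd (incE (MvPolynomial (Fin N) ℤ) (fun i => src (ε i)) (fun i => tgt (ε i)) v₀)
    (up (up p0 i k) j l) (xz {m}) = q1
  generalize Xd (incE (MvPolynomial (Fin N) ℤ) (fun i => src (ε i)) (fun i => tgt (ε i)) v₀)
    (up (up p0 i j) k l) (xz {m}) = q2
  generalize Xd (incE (MvPolynomial (Fin N) ℤ) (fun i => src (ε i)) (fun i => tgt (ε i)) v₀)
    (up (up (up p0 i k) j l) m m) (xz ∅) = q3
  generalize Xd (incE (MvPolynomial (Fin N) ℤ) (fun i => src (ε i)) (fun i => tgt (ε i)) v₀)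
    (up (up (up p0 i j) k l) m m) (xz ∅) = q4
  linear_combination (q1 * q4 - q2 * q3) * hsq

lemma Xp_homog {V : Type*} [Fintype V] [DecidableEq V] {N : ℕ} (s t : Fin N → V) (v₀ : V)
    (P : Fin N → Option (Fin N)) (K : Finset (Fin N)) (d : ℕ)
    (hd : N = Fintype.card {u : V // u ≠ v₀} + nup P + d) : (Xp s t v₀ P K).IsHomogeneous d := by
  have h1 := Xd_homog (incE ℤ s t v₀) P d (by simpa using hd)
  have h2 := h1.aeval (xz K) (n := 1) (fun i => by
    unfold xz
    split_ifs
    · exact MvPolynomial.isHomogeneous_zero _ _ _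
    · exact MvPolynomial.isHomogeneous_X _ _)
  rw [one_mul] at h2
  have e1 : Xp s t v₀ P K = MvPolynomial.aeval (xz K) (Xd ((incE ℤ s t v₀).map MvPolynomial.C) P
      (MvPolynomial.X : Fin N → MvPolynomial (Fin N) ℤ)) := by
    have := Xd_map (MvPolynomial.aeval (R := ℤ) (xz K)).toRingHom
      ((incE ℤ s t v₀).map MvPolynomial.C) P (MvPolynomial.X : Fin N → MvPolynomial (Fin N) ℤ)
    refine Eq.trans ?_ this.symm
    unfold Xp
    congr 1
    · ext1 i w
      simp only [incE, incN, Matrix.map_apply, Matrix.of_apply]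
      split_ifs <;> simp
    · funext i; simp
  rw [e1]; exact h2

lemma Xp_eval {V : Type*} [Fintype V] [DecidableEq V] {N : ℕ} (s t : Fin N → V) (v₀ : V)
    (P : Fin N → Option (Fin N)) (Z : Finset (Fin N)) {K : Type*} [Field K] (x : Fin N → K)
    (hx : ∀ i ∈ Z, x i = 0) :
    MvPolynomial.aeval x (Xp s t v₀ P Z) = Xd (incE K s t v₀) P x := by
  have := Xd_map (MvPolynomial.aeval (R := ℤ) x).toRingHom
    (incE (MvPolynomial (Fin N) ℤ) s t v₀) P (xz Z)
  refine Eq.trans this ?_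
  congr 1
  · ext1 i w
    simp only [incE, incN, Matrix.map_apply, Matrix.of_apply]
    split_ifs <;> simp
  · funext i
    by_cases hi : i ∈ Z <;> simp [xz, hi, hx]

lemma fiveInv_homog {V : Type*} [Fintype V] [DecidableEq V] {N : ℕ}
    (G : SimpleGraph V) (ε : Fin N ≃ G.edgeSet) (src tgt : G.edgeSet → V) (v₀ : V)
    (i j k l m : Fin N) (hi : (i : ℕ) = 0) (hj : (j : ℕ) = 1) (hk : (k : ℕ) = 2) (hl : (l : ℕ) = 3)
    (hm : (m : ℕ) = 4) (h : ℕ) (h4 : 4 ≤ h) (hN : N = 2 * h)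
    (hW : Fintype.card {u : V // u ≠ v₀} = h) :
    (fiveInv G ε src tgt v₀ i j k l m).IsHomogeneous (N - 5) := by
  rw [fiveInv_Xp G ε src tgt v₀ i j k l m hi hj hk hl hm]
  have nij : i ≠ j := fun h => by rw [Fin.ext_iff] at h; omega
  have nik : i ≠ k := fun h => by rw [Fin.ext_iff] at h; omega
  have nim : i ≠ m := fun h => by rw [Fin.ext_iff] at h; omega
  have njm : j ≠ m := fun h => by rw [Fin.ext_iff] at h; omega
  have nkm : k ≠ m := fun h => by rw [Fin.ext_iff] at h; omega
  have u1 : nup (up (up (p0 : Fin N → Option (Fin N)) i k) j l) = 2 := by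
    rw [nup_up _ _ _ (by simp [up, p0, nij.symm]), nup_up _ _ _ (by simp [p0]), nup_p0]
  have u2 : nup (up (up (p0 : Fin N → Option (Fin N)) i j) k l) = 2 := by
    rw [nup_up _ _ _ (by simp [up, p0, nik.symm]), nup_up _ _ _ (by simp [p0]), nup_p0]
  have u3 : nup (up (up (up (p0 : Fin N → Option (Fin N)) i k) j l) m m) = 3 := by
    rw [nup_up _ _ _ (by simp [up, p0, nim.symm, njm.symm]), u1]
  have u4 : nup (up (up (up (p0 : Fin N → Option (Fin N)) i j) k l) m m) = 3 := by
    rw [nup_up _ _ _ (by simp [up, p0, nim.symm, nkm.symm]), u2]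
  have e : N - 5 = (h - 2) + (h - 3) := by omega
  rw [e]
  refine MvPolynomial.IsHomogeneous.sub ?_ ?_
  · exact (Xp_homog _ _ v₀ _ _ _ (by rw [u1]; omega)).mul (Xp_homog _ _ v₀ _ _ _ (by rw [u4]; omega))
  · exact (Xp_homog _ _ v₀ _ _ _ (by rw [u2]; omega)).mul (Xp_homog _ _ v₀ _ _ _ (by rw [u3]; omega))

lemma fiveInv_eval {V : Type*} [Fintype V] [DecidableEq V] {N : ℕ}
    (G : SimpleGraph V) (ε : Fin N ≃ G.edgeSet) (src tgt : G.edgeSet → V) (v₀ : V)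
    (i j k l m : Fin N) (hi : (i : ℕ) = 0) (hj : (j : ℕ) = 1) (hk : (k : ℕ) = 2) (hl : (l : ℕ) = 3)
    (hm : (m : ℕ) = 4) {K : Type*} [Field K] (x : Fin N → K) (hx : x m = 0) :
    MvPolynomial.aeval x (fiveInv G ε src tgt v₀ i j k l m) =
      - QQ (incE K (fun i => src (ε i)) (fun i => tgt (ε i)) v₀) i j k l m x := by
  rw [fiveInv_Xp G ε src tgt v₀ i j k l m hi hj hk hl hm, map_sub, map_mul, map_mul,
    Xp_eval _ _ _ _ _ x (by simpa using hx), Xp_eval _ _ _ _ _ x (by simp),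
    Xp_eval _ _ _ _ _ x (by simpa using hx), Xp_eval _ _ _ _ _ x (by simp)]
  have nij : i ≠ j := fun h => by rw [Fin.ext_iff] at h; omega
  have nik : i ≠ k := fun h => by rw [Fin.ext_iff] at h; omega
  have nil : i ≠ l := fun h => by rw [Fin.ext_iff] at h; omega
  have nim : i ≠ m := fun h => by rw [Fin.ext_iff] at h; omega
  have njm : j ≠ m := fun h => by rw [Fin.ext_iff] at h; omega
  have nkm : k ≠ m := fun h => by rw [Fin.ext_iff] at h; omega
  have nlm : l ≠ m := fun h => by rw [Fin.ext_iff] at h; omega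
  unfold QQ
  set E := incE K (fun i => src (ε i)) (fun i => tgt (ε i)) v₀
  have h1 := Xd_plucker E ∅ i j k l (by simp) (by simp) (by simp) (by simp) nij nik nil x
  have h2 := Xd_plucker E {m} i j k l (by simpa) (by simpa) (by simpa) (by simpa) nij nik nil x
  rw [← up_rot i k j l m nim njm, ← up_rot i j k l m nim nkm, ← up_rot i j l k m nim nlm] at h2
  rw [dg_empty] at h1
  linear_combination (Xd E (up (up (up p0 i j) k l) m m) x) * h1 -
    Xd E (up (up p0 i j) k l) x * h2

end MinorLink

section Homog
open MvPolynomial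

variable {σ : Type*}

noncomputable def tw (σ : Type*) : MvPolynomial σ ℤ →+* Polynomial (MvPolynomial σ ℤ) :=
  eval₂Hom (Polynomial.C.comp MvPolynomial.C) (fun i => Polynomial.C (X i) * Polynomial.X)

lemma tw_monomial (d : σ →₀ ℕ) (r : ℤ) :
    tw σ (monomial d r) = Polynomial.C (monomial d r) * Polynomial.X ^ d.degree := by
  have e1 : tw σ (monomial d r) = Polynomial.C (MvPolynomial.C r) *
      d.prod fun n e => (Polynomial.C (X n) * Polynomial.X) ^ e := by
    rw [tw, coe_eval₂Hom, eval₂_monomial]; rfl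
  have e2 : (d.prod fun n e => (Polynomial.C (X n : MvPolynomial σ ℤ) * Polynomial.X) ^ e) =
      Polynomial.C (d.prod fun n e => (X n : MvPolynomial σ ℤ) ^ e) *
        Polynomial.X ^ d.degree := by
    simp only [Finsupp.prod, mul_pow, Finset.prod_mul_distrib]
    rw [map_prod, Finset.prod_pow_eq_pow_sum]
    simp only [map_pow]
    rfl
  rw [e1, e2, ← mul_assoc, ← map_mul, ← MvPolynomial.monomial_eq]

lemma tw_coeff (g : MvPolynomial σ ℤ) (k : ℕ) (d : σ →₀ ℕ) :
    coeff d ((tw σ g).coeff k) = if d.degree = k then coeff d g else 0 := by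
  induction g using MvPolynomial.induction_on' with
  | monomial u a =>
    rw [tw_monomial, Polynomial.coeff_C_mul, Polynomial.coeff_X_pow]
    by_cases h : u = d
    · subst h
      by_cases h2 : k = u.degree
      · simp [h2]
      · simp [h2, Ne.symm h2]
    · have : coeff d (monomial u a) = 0 := by rw [coeff_monomial, if_neg h]
      split_ifs <;> simp [this]
  | add p q hp hq =>
    rw [map_add, Polynomial.coeff_add, coeff_add, hp, hq, coeff_add]
    split_ifs <;> simp

lemma tw_inj (g : MvPolynomial σ ℤ) (h : tw σ g = 0) : g = 0 := by
  ext d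
  have := tw_coeff g d.degree d
  rw [h] at this
  simpa using this.symm

lemma tw_homog (g : MvPolynomial σ ℤ) (m : ℕ) (h : ∀ k, k ≠ m → (tw σ g).coeff k = 0) :
    g.IsHomogeneous m := by
  intro d hd
  by_contra hne
  have hw : Finsupp.weight 1 d = d.degree :=
    (DFunLike.congr_fun (Finsupp.degree_eq_weight_one (R := ℕ) (σ := σ)) d).symm
  rw [hw] at hne
  apply hd
  have := tw_coeff g d.degree d
  rw [h _ hne] at this
  simpa using this.symm

lemma homog_tw (g : MvPolynomial σ ℤ) (m : ℕ) (h : g.IsHomogeneous m) :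
    tw σ g = Polynomial.C g * Polynomial.X ^ m := by
  ext k d
  rw [tw_coeff, Polynomial.coeff_C_mul, Polynomial.coeff_X_pow]
  by_cases hd : coeff d g = 0
  · split_ifs <;> simp [hd]
  · have := h hd
    have hw : Finsupp.weight 1 d = d.degree :=
      (DFunLike.congr_fun (Finsupp.degree_eq_weight_one (R := ℕ) (σ := σ)) d).symm
    rw [hw] at this
    change d.degree = m at this
    rw [this]
    by_cases hk : k = m
    · simp [hk]
    · simp [hk, Ne.symm hk]

lemma homog_factor (g h : MvPolynomial σ ℤ) (n : ℕ) (hgh : (g * h).IsHomogeneous n)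
    (h0 : g * h ≠ 0) : ∃ m m', m + m' = n ∧ g.IsHomogeneous m ∧ h.IsHomogeneous m' := by
  have hg0 : g ≠ 0 := left_ne_zero_of_mul h0
  have hh0 : h ≠ 0 := right_ne_zero_of_mul h0
  have tg : tw σ g ≠ 0 := fun e => hg0 (tw_inj g e)
  have th : tw σ h ≠ 0 := fun e => hh0 (tw_inj h e)
  have e := homog_tw _ _ hgh
  rw [map_mul] at e
  have e1 : (tw σ g).natDegree + (tw σ h).natDegree = n := by
    rw [← Polynomial.natDegree_mul tg th, e, Polynomial.natDegree_C_mul_X_pow _ _ h0]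
  have e2 : (tw σ g).natTrailingDegree + (tw σ h).natTrailingDegree = n := by
    rw [← Polynomial.natTrailingDegree_mul tg th, e, Polynomial.C_mul_X_pow_eq_monomial,
      Polynomial.natTrailingDegree_monomial h0]
  have e3 := Polynomial.natTrailingDegree_le_natDegree (tw σ g)
  have e4 := Polynomial.natTrailingDegree_le_natDegree (tw σ h)
  refine ⟨_, _, e1, tw_homog _ _ fun k hk => ?_, tw_homog _ _ fun k hk => ?_⟩
  · rcases lt_or_gt_of_ne hk with h' | h'
    · exact Polynomial.coeff_eq_zero_of_lt_natTrailingDegree (by omega)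
    · exact Polynomial.coeff_eq_zero_of_natDegree_lt h'
  · rcases lt_or_gt_of_ne hk with h' | h'
    · exact Polynomial.coeff_eq_zero_of_lt_natTrailingDegree (by omega)
    · exact Polynomial.coeff_eq_zero_of_natDegree_lt h'

lemma pderiv_lin (a b : MvPolynomial σ ℤ) (k : σ) (ha : k ∉ a.vars) (hb : k ∉ b.vars) :
    pderiv k (a * X k + b) = a := by
  simp [Derivation.leibniz, pderiv_eq_zero_of_notMem_vars ha, pderiv_eq_zero_of_notMem_vars hb]

lemma lin_homog (a b : MvPolynomial σ ℤ) (k : σ) (ha : k ∉ a.vars) (hb : k ∉ b.vars) (m : ℕ)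
    (h : (a * X k + b).IsHomogeneous m) :
    a.IsHomogeneous (m - 1) ∧ b.IsHomogeneous m ∧ (m = 0 → a = 0) := by
  have h1 : a.IsHomogeneous (m - 1) := by
    have := h.pderiv (i := k)
    rwa [pderiv_lin a b k ha hb] at this
  have h0 : m = 0 → a = 0 := by
    rintro rfl
    rw [← pderiv_lin a b k ha hb]
    have := totalDegree_eq_zero_iff_eq_C.1 (Nat.le_zero.1 h.totalDegree_le)
    rw [this, pderiv_C]
  refine ⟨h1, ?_, h0⟩
  have h2 : (a * X k).IsHomogeneous m := by
    rcases Nat.eq_zero_or_pos m with hm | hm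
    · rw [h0 hm, zero_mul]; exact isHomogeneous_zero _ _ _
    · have := h1.mul (isHomogeneous_X ℤ k)
      rwa [Nat.sub_add_cancel hm] at this
  have := h.sub h2
  rwa [add_sub_cancel_left] at this

lemma lin_zero (a b : MvPolynomial σ ℤ) (k : σ) (ha : k ∉ a.vars) (hb : k ∉ b.vars)
    (h : a * X k + b = 0) : a = 0 ∧ b = 0 := by
  have h1 : a = 0 := by rw [← pderiv_lin a b k ha hb, h, map_zero]
  refine ⟨h1, ?_⟩
  rwa [h1, zero_mul, zero_add] at h

lemma step_homog (a b c d : MvPolynomial σ ℤ) (k : σ) (ha : k ∉ a.vars) (hb : k ∉ b.vars)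
    (hc : k ∉ c.vars) (hd : k ∉ d.vars) (n : ℕ)
    (h : ((a * X k + b) * (c * X k + d)).IsHomogeneous n) :
    (a * d - b * c).IsHomogeneous (n - 1) ∧ (a * c = 0 ∨ (a * c).totalDegree + 2 ≤ n) := by
  by_cases h0 : (a * X k + b) * (c * X k + d) = 0
  · rcases mul_eq_zero.1 h0 with h1 | h1
    · obtain ⟨rfl, rfl⟩ := lin_zero a b k ha hb h1
      simp [isHomogeneous_zero]
    · obtain ⟨rfl, rfl⟩ := lin_zero c d k hc hd h1
      simp [isHomogeneous_zero]
  · obtain ⟨m, m', hm, hg, hh⟩ := homog_factor _ _ _ h h0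
    obtain ⟨a1, b1, z1⟩ := lin_homog a b k ha hb m hg
    obtain ⟨c1, d1, z2⟩ := lin_homog c d k hc hd m' hh
    have p1 : (a * d).IsHomogeneous (n - 1) := by
      rcases Nat.eq_zero_or_pos m with h2 | h2
      · rw [z1 h2, zero_mul]; exact isHomogeneous_zero _ _ _
      · have := a1.mul d1
        rwa [show m - 1 + m' = n - 1 by omega] at this
    have p2 : (b * c).IsHomogeneous (n - 1) := by
      rcases Nat.eq_zero_or_pos m' with h2 | h2
      · rw [z2 h2, mul_zero]; exact isHomogeneous_zero _ _ _
      · have := b1.mul c1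
        rwa [show m + (m' - 1) = n - 1 by omega] at this
    refine ⟨p1.sub p2, ?_⟩
    rcases Nat.eq_zero_or_pos m with h2 | h2
    · left; rw [z1 h2, zero_mul]
    rcases Nat.eq_zero_or_pos m' with h3 | h3
    · left; rw [z2 h3, mul_zero]
    right
    have := (a1.mul c1).totalDegree_le
    omega

lemma aeval_upd [DecidableEq σ] {K : Type*} [Field K] (p : MvPolynomial σ ℤ) (k : σ) (hk : k ∉ p.vars)
    (x : σ → K) (t : K) : aeval (Function.update x k t) p = aeval x p := by
  refine eval₂Hom_congr' rfl ?_ rfl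
  intro i hi _
  rw [Function.update_of_ne]
  rintro rfl
  exact hk hi

end Homog

section Step
open MvPolynomial

lemma hasDeg_aeval {ι K : Type*} [Field K] [Fintype ι] [Fintype K] (p : MvPolynomial ι ℤ) (d : ℕ)
    (h : p.totalDegree ≤ d) : HasDeg (fun x : ι → K => aeval x p) d := by
  refine ⟨map (Int.castRingHom K) p, ?_, fun x => ?_⟩
  · refine le_trans ?_ h
    exact Finset.sup_mono (support_map_subset _ _)
  · rw [eval_map]; rfl

lemma step_cnt {ι K : Type*} [Field K] [Fintype ι] [DecidableEq ι] [Fintype K] (S : Finset ι) (k : ι) (hk : k ∉ S)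
    (a b c d : MvPolynomial ι ℤ) (ha : k ∉ a.vars) (hb : k ∉ b.vars)
    (hc : k ∉ c.vars) (hd : k ∉ d.vars) (n : ℕ) (hn : n + S.card = Fintype.card ι) (hn2 : 2 ≤ n)
    (h : ((a * X k + b) * (c * X k + d)).IsHomogeneous n) :
    cnt S (fun x : ι → K => aeval x ((a * X k + b) * (c * X k + d)) = 0) ≡
      - cnt (insert k S) (fun x : ι → K => aeval x (a * d - b * c) = 0)
      [ZMOD Fintype.card K] := by
  have key := cnt_elim_mul S k hk (fun x : ι → K => aeval x (a * X k + b)) (fun x => aeval x a)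
    (fun x => aeval x (c * X k + d)) (fun x => aeval x c) (by omega)
    (by
      intro x hx t
      simp only [map_add, map_mul, aeval_X, aeval_upd _ _ ha, aeval_upd _ _ hb, hx,
        Function.update_self]
      ring)
    (by
      intro x hx t
      simp only [map_add, map_mul, aeval_X, aeval_upd _ _ hc, aeval_upd _ _ hd, hx,
        Function.update_self]
      ring)
  have hcard : (insert k S).card = S.card + 1 := Finset.card_insert_of_notMem hk
  have h1 : cnt (insert k S) (fun x : ι → K => aeval x a * aeval x c = 0) ≡ 0
      [ZMOD Fintype.card K] := by
    have e : (fun x : ι → K => aeval x a * aeval x c = 0) = fun x => aeval x (a * c) = 0 := by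
      funext x; rw [map_mul]
    rw [e]
    apply cnt_ax _ _ (a * c).totalDegree (hasDeg_aeval _ _ le_rfl)
    rcases (step_homog a b c d k ha hb hc hd n h).2 with h2 | h2
    · rw [h2, totalDegree_zero]; omega
    · omega
  have h2 : cnt (insert k S) (fun x : ι → K =>
      aeval x a * aeval x (c * X k + d) - aeval x (a * X k + b) * aeval x c = 0) =
      cnt (insert k S) (fun x : ι → K => aeval x (a * d - b * c) = 0) := by
    refine cnt_congr fun x hx => ?_
    have := hx k (Finset.mem_insert_self _ _)
    simp [this]
  rw [h2] at key
  simp only [map_mul]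
  refine key.trans ?_
  have := (h1.neg).sub_right (cnt (insert k S) (fun x : ι → K => aeval x (a * d - b * c) = 0))
  simpa using this

end Step

section QuadCount
variable {K : Type*} [Field K] [Fintype K]

lemma quad_red (α β γ : K) :
    (∑ s : K, ∑ t : K, if α * s ^ 2 + β * s * t + γ * t ^ 2 = 0 then (1 : ℤ) else 0) ≡
    (if α = 0 then 0 else 1) - (∑ s : K, if α * s ^ 2 + β * s + γ = 0 then (1 : ℤ) else 0)
    [ZMOD Fintype.card K] := by
  have hq : (1 : ℕ) ≤ Fintype.card K := Fintype.card_pos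
  rw [Finset.sum_comm]
  rw [← Finset.add_sum_erase _ _ (Finset.mem_univ (0 : K))]
  have h0 : (∑ s : K, if α * s ^ 2 + β * s * 0 + γ * 0 ^ 2 = 0 then (1 : ℤ) else 0) ≡
      (if α = 0 then 0 else 1) [ZMOD Fintype.card K] := by
    by_cases hα : α = 0
    · simp only [hα]
      simp [Int.modEq_zero_iff_dvd]
    · simp [hα]
  have h1 : ∀ t ∈ Finset.univ.erase (0 : K),
      (∑ s : K, if α * s ^ 2 + β * s * t + γ * t ^ 2 = 0 then (1 : ℤ) else 0) =
      ∑ s : K, if α * s ^ 2 + β * s + γ = 0 then (1 : ℤ) else 0 := by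
    intro t ht
    have ht0 : t ≠ 0 := (Finset.mem_erase.1 ht).1
    rw [← Equiv.sum_comp (Equiv.mulRight₀ t ht0)]
    refine Finset.sum_congr rfl fun s _ => ?_
    have : α * (Equiv.mulRight₀ t ht0 s) ^ 2 + β * (Equiv.mulRight₀ t ht0 s) * t + γ * t ^ 2 =
        t ^ 2 * (α * s ^ 2 + β * s + γ) := by
      have e : Equiv.mulRight₀ t ht0 s = s * t := rfl
      rw [e]; ring
    rw [this]
    simp [ht0]
  rw [Finset.sum_congr rfl h1, Finset.sum_const, Finset.card_erase_of_mem (Finset.mem_univ _),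
    Finset.card_univ]
  set B := ∑ s : K, if α * s ^ 2 + β * s + γ = 0 then (1 : ℤ) else 0
  have h2 : (Fintype.card K - 1) • B ≡ - B [ZMOD Fintype.card K] := by
    rw [Int.modEq_iff_dvd]
    refine ⟨-B, ?_⟩
    rw [nsmul_eq_mul, Nat.cast_sub hq]
    push_cast
    ring
  rw [sub_eq_add_neg]
  exact h0.add h2

lemma quad_zero (α β γ : K) (h : β ^ 2 - 4 * α * γ = 0) :
    (∑ s : K, ∑ t : K, if α * s ^ 2 + β * s * t + γ * t ^ 2 = 0 then (1 : ℤ) else 0) ≡ 0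
    [ZMOD Fintype.card K] := by
  refine (quad_red α β γ).trans ?_
  by_cases hα : α = 0
  · subst hα
    have hβ : β = 0 := by simpa using h
    subst hβ
    by_cases hγ : γ = 0
    · simp [hγ, Int.modEq_zero_iff_dvd]
    · simp [hγ]
  · have key : ∃ r : K, ∀ s, α * s ^ 2 + β * s + γ = 0 ↔ s = r := by
      by_cases h2 : (2 : K) = 0
      · have hβ : β = 0 := by
          have h4 : (4 : K) = 0 := by linear_combination 2 * h2
          have : β ^ 2 = 0 := by linear_combination h + α * γ * h4
          simpa using this
        subst hβ
        obtain ⟨r, hr⟩ := FiniteField.isSquare_of_char_two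
          (CharP.ringChar_of_prime_eq_zero Nat.prime_two (by exact_mod_cast h2)) (-γ / α)
        have hr' : r * r * α = - γ := by rw [← hr]; field_simp
        refine ⟨r, fun s => ⟨fun hs => ?_, ?_⟩⟩
        · have : α * (s - r) ^ 2 = 0 := by
            linear_combination hs + hr' + (- γ - α * s * r) * h2
          simpa [hα, sub_eq_zero] using this
        · rintro rfl
          linear_combination hr'
      · refine ⟨- β / (2 * α), fun s => ?_⟩
        have e : 4 * α * (α * s ^ 2 + β * s + γ) = (2 * α * s + β) ^ 2 := by
          linear_combination - h
        have h4 : (4 : K) * α ≠ 0 := by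
          rw [show (4 : K) = 2 * 2 by norm_num]
          exact mul_ne_zero (mul_ne_zero h2 h2) hα
        rw [eq_div_iff (mul_ne_zero h2 hα)]
        constructor
        · intro hs
          rw [hs, mul_zero] at e
          have := pow_eq_zero_iff (two_ne_zero) |>.1 e.symm
          linear_combination this
        · intro hs
          have : 2 * α * s + β = 0 := by linear_combination hs
          rw [this] at e
          have e' : 4 * α * (α * s ^ 2 + β * s + γ) = 0 := by rw [e]; ring
          exact (mul_eq_zero.1 e').resolve_left h4
    obtain ⟨r, hr⟩ := key
    simp [hr, hα]

lemma quad_sq (α β γ δ : K) (h2 : (2 : K) ≠ 0) (h : β ^ 2 - 4 * α * γ = δ ^ 2) (hδ : δ ≠ 0) :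
    (∑ s : K, ∑ t : K, if α * s ^ 2 + β * s * t + γ * t ^ 2 = 0 then (1 : ℤ) else 0) ≡ -1
    [ZMOD Fintype.card K] := by
  refine (quad_red α β γ).trans ?_
  by_cases hα : α = 0
  · subst hα
    have hβ : β ≠ 0 := by
      rintro rfl
      apply hδ
      simpa using h.symm
    have : ∀ s, 0 * s ^ 2 + β * s + γ = 0 ↔ s = - γ / β := by
      intro s
      rw [eq_div_iff hβ]
      constructor <;> intro hs <;> linear_combination hs
    simp only [this]
    simp
  · have h2α : 2 * α ≠ 0 := mul_ne_zero h2 hα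
    have key : ∀ s, α * s ^ 2 + β * s + γ = 0 ↔
        s = (- β + δ) / (2 * α) ∨ s = (- β - δ) / (2 * α) := by
      intro s
      have e : 4 * α * (α * s ^ 2 + β * s + γ) =
          (s * (2 * α) - (- β + δ)) * (s * (2 * α) - (- β - δ)) := by
        linear_combination - h
      have h4 : (4 : K) * α ≠ 0 := by
        rw [show (4 : K) = 2 * 2 by norm_num]
        exact mul_ne_zero (mul_ne_zero h2 h2) hα
      rw [eq_div_iff h2α, eq_div_iff h2α, ← sub_eq_zero (b := - β + δ), ← sub_eq_zero (b := - β - δ),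
        ← mul_eq_zero, ← e]
      simp [h4]
    have hne : (- β + δ) / (2 * α) ≠ (- β - δ) / (2 * α) := by
      rw [Ne, div_left_inj' h2α]
      intro hh
      have : 2 * δ = 0 := by linear_combination hh
      exact (mul_ne_zero h2 hδ) this
    have : (∑ s : K, if α * s ^ 2 + β * s + γ = 0 then (1 : ℤ) else 0) = 2 := by
      simp only [key]
      rw [Finset.sum_ite, Finset.sum_const_zero, add_zero, Finset.sum_const]
      have : (Finset.univ.filter fun s : K =>
          s = (- β + δ) / (2 * α) ∨ s = (- β - δ) / (2 * α)) =
          {(- β + δ) / (2 * α), (- β - δ) / (2 * α)} := by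
        ext s; simp
      rw [this, Finset.card_pair hne]
      rfl
    rw [this]
    simp [hα]

lemma int_square (p n : ℕ) (hp : p.Prime) (hp2 : p ≠ 2) 
    (hK : Fintype.card K = p ^ (2 * n)) (Δ : ℤ) (hΔ : ¬ (p : ℤ) ∣ Δ) :
    (2 : K) ≠ 0 ∧ ∃ δ : K, δ ≠ 0 ∧ (Δ : K) = δ ^ 2 := by
  haveI : Fact p.Prime := ⟨hp⟩
  haveI : CharP K p := charP_of_card_eq_prime_pow hK
  have h2 : (2 : K) ≠ 0 := by
    intro h
    have : ((2 : ℕ) : K) = 0 := by exact_mod_cast h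
    rw [CharP.cast_eq_zero_iff K p] at this
    exact hp2 ((Nat.prime_dvd_prime_iff_eq hp Nat.prime_two).1 this)
  refine ⟨h2, ?_⟩
  have hd : (Δ : K) ≠ 0 := by
    rw [Ne, CharP.intCast_eq_zero_iff K p]; exact hΔ
  have hrc : ringChar K ≠ 2 := by
    rw [ringChar.eq K p] at *
    exact hp2
  have hf : (Δ : K) ^ p = Δ := by
    rw [← frobenius_def, map_intCast]
  have hf1 : (Δ : K) ^ (p - 1) = 1 := by
    have : (Δ : K) ^ (p - 1) * Δ = 1 * Δ := by
      rw [← pow_succ, Nat.sub_add_cancel hp.one_le, hf, one_mul]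
    exact mul_right_cancel₀ hd this
  have hodd : p % 2 = 1 := hp.eq_two_or_odd.resolve_left hp2
  have hdvd : (p - 1) ∣ Fintype.card K / 2 := by
    obtain ⟨m, hm⟩ : ∃ m, p = 2 * m + 1 := ⟨p / 2, by omega⟩
    have h3 : (p ^ 2 - 1) ∣ (p ^ 2) ^ n - 1 := by
      simpa using Nat.sub_dvd_pow_sub_pow (p ^ 2) 1 n
    obtain ⟨c, hc⟩ := h3
    have h4 : p ^ 2 - 1 = (p - 1) * (2 * (m + 1)) := by
      subst hm
      simp only [Nat.add_sub_cancel]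
      rw [Nat.sub_eq_iff_eq_add (Nat.one_le_pow _ _ (by omega))]
      ring
    have h5 : 1 ≤ (p ^ 2) ^ n := Nat.one_le_pow _ _ (pow_pos hp.pos 2)
    refine ⟨(m + 1) * c, ?_⟩
    rw [hK, pow_mul]
    have h6 : (p ^ 2) ^ n = 2 * ((p - 1) * ((m + 1) * c)) + 1 := by
      rw [h4] at hc
      have : (p ^ 2) ^ n = (p - 1) * (2 * (m + 1)) * c + 1 := by omega
      rw [this]; ring
    omega
  obtain ⟨r, hr⟩ := (FiniteField.isSquare_iff hrc hd).2 (by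
    obtain ⟨c, hc⟩ := hdvd
    rw [hc, pow_mul, hf1, one_pow])
  refine ⟨r, ?_, by rw [hr, sq]⟩
  rintro rfl
  exact hd (by simpa using hr)

end QuadCount

section Iter
open MvPolynomial

def lo (N k : ℕ) : Finset (Fin N) := Finset.univ.filter fun i => (i : ℕ) < k

lemma mem_lo {N k : ℕ} {i : Fin N} : i ∈ lo N k ↔ (i : ℕ) < k := by simp [lo]

lemma insert_lo {N k : ℕ} {_ : DecidableEq (Fin N)} (hk : k < N) : insert (⟨k, hk⟩ : Fin N) (lo N k) = lo N (k + 1) := by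
  ext i
  rw [Finset.mem_insert, mem_lo, mem_lo, Fin.ext_iff]
  simp only
  omega

lemma notMem_lo {N k : ℕ} (hk : k < N) : (⟨k, hk⟩ : Fin N) ∉ lo N k := by
  simp [mem_lo]

lemma card_lo {N k : ℕ} (hk : k ≤ N) : (lo N k).card = k := by
  induction k with
  | zero =>
    rw [Finset.card_eq_zero]
    ext i; simp [mem_lo]
  | succ k ih =>
    rw [← insert_lo (k := k) (by omega), Finset.card_insert_of_notMem (notMem_lo _),
      ih (by omega)]

lemma cnt_neg_poly {ι K : Type*} [Field K] [Fintype ι] [DecidableEq ι] [Fintype K] (S : Finset ι)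
    (p r : MvPolynomial ι ℤ) (h : p = r ∨ p = - r) :
    cnt S (fun x : ι → K => aeval x p = 0) = cnt S (fun x : ι → K => aeval x r = 0) := by
  rcases h with rfl | rfl
  · rfl
  · simp

lemma homog_neg_poly {ι : Type*} (p r : MvPolynomial ι ℤ) (h : p = r ∨ p = - r) (n : ℕ)
    (hr : r.IsHomogeneous n) : p.IsHomogeneous n := by
  rcases h with rfl | rfl
  · exact hr
  · exact hr.neg

lemma denom_iter {N n : ℕ} (D : ℕ → MvPolynomial (Fin N) ℤ) (hn : n + 2 ≤ N)
    (h5 : (D 5).IsHomogeneous (N - 5))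
    (hs : ∀ k, 5 ≤ k → k < n →
      ∃ (hk : k < N) (a b c d : MvPolynomial (Fin N) ℤ),
      (⟨k, hk⟩ : Fin N) ∉ a.vars ∧ (⟨k, hk⟩ : Fin N) ∉ b.vars ∧
      (⟨k, hk⟩ : Fin N) ∉ c.vars ∧ (⟨k, hk⟩ : Fin N) ∉ d.vars ∧
      D k = (a * MvPolynomial.X ⟨k, hk⟩ + b) * (c * MvPolynomial.X ⟨k, hk⟩ + d) ∧
      (D (k + 1) = a * d - b * c ∨ D (k + 1) = -(a * d - b * c)))
    (j : ℕ) (hj : 5 + j ≤ n) :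
    (D (5 + j)).IsHomogeneous (N - (5 + j)) ∧
    ∀ (K : Type) [Field K] [Fintype K],
      cnt (lo N 5) (fun x : Fin N → K => aeval x (D 5) = 0) ≡
      (-1) ^ j * cnt (lo N (5 + j)) (fun x : Fin N → K => aeval x (D (5 + j)) = 0)
      [ZMOD Fintype.card K] := by
  induction j with
  | zero =>
    refine ⟨h5, fun K _ _ => ?_⟩
    simp
  | succ j ih =>
    obtain ⟨ih1, ih2⟩ := ih (by omega)
    obtain ⟨hk, a, b, c, d, ha, hb, hc, hd, e1, e2⟩ := hs (5 + j) (by omega) (by omega)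
    rw [e1] at ih1
    have hh := (step_homog a b c d _ ha hb hc hd _ ih1).1
    refine ⟨?_, fun K _ _ => ?_⟩
    · have := homog_neg_poly _ _ e2 _ hh
      rwa [show N - (5 + j) - 1 = N - (5 + (j + 1)) by omega] at this
    · have st := step_cnt (K := K) (lo N (5 + j)) _ (notMem_lo hk) a b c d ha hb hc hd
        (N - (5 + j)) (by rw [card_lo (by omega), Fintype.card_fin]; omega) (by omega) ih1
      rw [← e1, insert_lo hk, ← cnt_neg_poly _ _ _ e2] at st
      have aux : ∀ u v w q : ℤ, u ≡ (-1) ^ j * v [ZMOD q] → v ≡ - w [ZMOD q] →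
          u ≡ (-1) ^ (j + 1) * w [ZMOD q] := by
        intro u v w q h1 h2
        refine (h1.trans (h2.mul_left _)).trans (modEq_of_eq ?_)
        ring
      rw [← add_assoc]
      exact aux _ _ _ _ (ih2 K) st

lemma quad_form {N : ℕ} (D : MvPolynomial (Fin N) ℤ) (hD : D.IsHomogeneous 2) (u v : Fin N)
    (huv : u ≠ v) (hvar : ∀ i ∈ D.vars, i = u ∨ i = v) :
    ∃ α β γ : ℤ, ∀ (K : Type) [Field K] (x : Fin N → K),
      aeval x D = (α : K) * x u ^ 2 + (β : K) * x u * x v + (γ : K) * x v ^ 2 := by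
  let f : ℕ → (Fin N →₀ ℕ) := fun i => Finsupp.single u i + Finsupp.single v (2 - i)
  have fu : ∀ i, f i u = i := fun i => by simp [f, huv.symm]
  have fv : ∀ i, f i v = 2 - i := fun i => by simp [f, huv]
  have finj : Set.InjOn f (Finset.range 3 : Finset ℕ) := by
    intro i _ j _ hij
    rw [← fu i, ← fu j, hij]
  have hsup : D.support ⊆ (Finset.range 3).image f := by
    intro d hd
    have hdeg : d.degree = 2 := by
      have := hD (mem_support_iff.1 hd)
      have hw : Finsupp.weight 1 d = d.degree :=
        (DFunLike.congr_fun (Finsupp.degree_eq_weight_one (R := ℕ) (σ := Fin N)) d).symm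
      rwa [hw] at this
    have h0 : ∀ i, i ≠ u → i ≠ v → d i = 0 := by
      intro i hu hv
      by_contra hne
      have : i ∈ D.vars := (mem_vars_iff_mem_support i).2 ⟨d, hd, Finsupp.mem_support_iff.2 hne⟩
      rcases hvar i this with h | h
      · exact hu h
      · exact hv h
    have hde : d = Finsupp.single u (d u) + Finsupp.single v (d v) := by
      ext i
      by_cases hu : i = u
      · subst hu; simp [huv.symm]
      · by_cases hv : i = v
        · subst hv; simp [huv]
        · simp [h0 i hu hv, Ne.symm hu, Ne.symm hv]
    have hsum : d u + d v = 2 := by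
      rw [hde, map_add, Finsupp.degree_single, Finsupp.degree_single] at hdeg
      exact hdeg
    refine Finset.mem_image.2 ⟨d u, Finset.mem_range.2 (by omega), ?_⟩
    rw [hde.trans (by rw [show d v = 2 - d u by omega])]
    simp [f, huv.symm]
  refine ⟨coeff (f 2) D, coeff (f 1) D, coeff (f 0) D, fun K _ x => ?_⟩
  have hprod : ∀ i, ∏ l, x l ^ (f i) l = x u ^ i * x v ^ (2 - i) := by
    intro i
    rw [← Finset.prod_subset (Finset.subset_univ {u, v}), Finset.prod_pair huv, fu, fv]
    intro l _ hl
    have hl' : l ≠ u ∧ l ≠ v := by simpa using hl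
    simp [f, hl'.1.symm, hl'.2.symm]
  rw [aeval_def, eval₂_eq', Finset.sum_subset hsup, Finset.sum_image finj]
  · simp only [hprod, Finset.sum_range_succ, Finset.sum_range_zero]
    simp
    ring
  · intro d _ hd
    rw [notMem_support_iff.1 hd]
    simp

lemma cnt_two {N : ℕ} (hN : 2 ≤ N) (K : Type) [Field K] [Fintype K] (P : K → K → Prop) :
    cnt (lo N (N - 2)) (fun x : Fin N → K => P (x ⟨N - 2, by omega⟩) (x ⟨N - 1, by omega⟩)) =
    ∑ s : K, ∑ t : K, if P s t then (1 : ℤ) else 0 := by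
  unfold cnt
  have hk1 : N - 2 < N := by omega
  have hk2 : N - 2 + 1 < N := by omega
  have hv : (⟨N - 1, by omega⟩ : Fin N) = ⟨N - 2 + 1, hk2⟩ := Fin.ext (by simp; omega)
  rw [hv]
  rw [sum_cbase (lo N (N - 2)) _ (notMem_lo hk1), insert_lo hk1,
    sum_cbase (lo N (N - 2 + 1)) _ (notMem_lo hk2), insert_lo hk2]
  have hb : cbase K (lo N (N - 2 + 1 + 1)) = {0} := by
    ext x
    rw [mem_cbase, Finset.mem_singleton]
    constructor
    · intro h
      funext i
      exact h i (mem_lo.2 (by have := i.2; omega))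
    · rintro rfl i _
      rfl
  rw [hb, Finset.sum_singleton, Finset.sum_comm]
  refine Finset.sum_congr rfl fun s _ => Finset.sum_congr rfl fun t _ => ?_
  have hne : (⟨N - 2 + 1, hk2⟩ : Fin N) ≠ ⟨N - 2, hk1⟩ := by
    intro h; rw [Fin.ext_iff] at h; simp at h
  beta_reduce
  rw [Function.update_self, Function.update_of_ne hne, Function.update_self]

end Iter

lemma main_cong {V : Type*} [Fintype V] [DecidableEq V] (G : SimpleGraph V)
    (hG : G.Connected) (hV : 3 ≤ Fintype.card V) (h : ℕ)
    {N : ℕ} (hN : N = 2 * h) (hVh : Fintype.card V = h + 1)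
    (ε : Fin N ≃ G.edgeSet) (src tgt : G.edgeSet → V) (v₀ : V)
    (D : ℕ → MvPolynomial (Fin N) ℤ) (ho : IsOrientation G src tgt)
    (hr : IsDenomReduction G ε src tgt v₀ (N - 2) D) :
    (D (N - 2)).IsHomogeneous 2 ∧ ∀ (K : Type) [Field K] [Fintype K],
      (Xcount G K : ℤ) ≡ (Fintype.card K : ℤ) ^ 2 *
        cnt (lo N (N - 2)) (fun x : Fin N → K => MvPolynomial.aeval x (D (N - 2)) = 0)
        [ZMOD (Fintype.card K : ℤ) ^ 3] := by
  obtain ⟨r1, r2, ⟨h5, r3⟩, r4, r5⟩ := hr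
  have h4 : 4 ≤ h := by omega
  have hne : Nonempty V := ⟨v₀⟩
  have hW : Fintype.card {u : V // u ≠ v₀} = h := by
    rw [Fintype.card_subtype_compl, hVh]; simp
  have hD5 : (D 5).IsHomogeneous (N - 5) :=
    homog_neg_poly _ _ r3 _ (fiveInv_homog G ε src tgt v₀ _ _ _ _ _ rfl rfl rfl rfl rfl h h4 hN hW)
  obtain ⟨i1, i2⟩ := denom_iter (n := N - 2) D (by omega) hD5 r5 (N - 7) (by omega)
  have e7 : 5 + (N - 7) = N - 2 := by omega
  rw [e7] at i1
  rw [show N - (N - 2) = 2 by omega] at i1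
  refine ⟨i1, fun K _ _ => ?_⟩
  have i3 := i2 K
  rw [e7, (show Odd (N - 7) from ⟨h - 4, by omega⟩).neg_one_pow] at i3
  have hne5 : ∀ a b : ℕ, ∀ (ha : a < N) (hb : b < N), a ≠ b → (⟨a, ha⟩ : Fin N) ≠ ⟨b, hb⟩ :=
    fun a b ha hb hab hh => hab (Fin.ext_iff.1 hh)
  have t1 := TOT_TT (K := K) (fun i => src (ε i)) (fun i => tgt (ε i)) (fun i => orient_ne ho (ε i))
    (connSys_of_connected ho ε hG) hV h h4 (by rw [Fintype.card_fin, hN]) hVh v₀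
    ⟨0, by omega⟩ ⟨1, by omega⟩ ⟨2, by omega⟩ (hne5 _ _ _ _ (by omega)) (hne5 _ _ _ _ (by omega))
    (hne5 _ _ _ _ (by omega))
  have t2 := TT_QQ (incE K (fun i => src (ε i)) (fun i => tgt (ε i)) v₀) h h4
    (by rw [Fintype.card_fin, hN]) hW
    ⟨0, by omega⟩ ⟨1, by omega⟩ ⟨2, by omega⟩ ⟨3, by omega⟩ ⟨4, by omega⟩
    (hne5 _ _ _ _ (by omega)) (hne5 _ _ _ _ (by omega)) (hne5 _ _ _ _ (by omega))
    (hne5 _ _ _ _ (by omega)) (hne5 _ _ _ _ (by omega)) (hne5 _ _ _ _ (by omega))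
    (hne5 _ _ _ _ (by omega)) (hne5 _ _ _ _ (by omega)) (hne5 _ _ _ _ (by omega))
    (hne5 _ _ _ _ (by omega))
  have hS : ({⟨4, by omega⟩, ⟨3, by omega⟩, ⟨2, by omega⟩, ⟨1, by omega⟩, ⟨0, by omega⟩} :
      Finset (Fin N)) = lo N 5 := by
    ext i
    simp only [Finset.mem_insert, Finset.mem_singleton, mem_lo, Fin.ext_iff]
    omega
  rw [hS] at t2
  have hq : cnt (lo N 5) (fun x : Fin N → K => MvPolynomial.aeval x (D 5) = 0) =
      cnt (lo N 5) (fun x => QQ (incE K (fun i => src (ε i)) (fun i => tgt (ε i)) v₀)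
        ⟨0, by omega⟩ ⟨1, by omega⟩ ⟨2, by omega⟩ ⟨3, by omega⟩ ⟨4, by omega⟩ x = 0) := by
    rw [cnt_neg_poly _ _ _ r3]
    refine cnt_congr fun x hx => ?_
    rw [fiveInv_eval G ε src tgt v₀ _ _ _ _ _ rfl rfl rfl rfl rfl x
      (hx _ (mem_lo.2 (by simp))), neg_eq_zero]
  rw [← hq] at t2
  have t3 := t2.trans i3.neg
  rw [neg_one_mul, neg_neg] at t3
  rw [Xcount_TOT ho ε v₀]
  refine t1.trans ?_
  rw [show (Fintype.card K : ℤ) ^ 3 = (Fintype.card K : ℤ) ^ 2 * (Fintype.card K : ℤ) by ring]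
  exact t3.mul_left'

theorem stmt13 {V : Type*} [Fintype V] [DecidableEq V] (G : SimpleGraph V)
    (hG : G.Connected) (hV : 3 ≤ Fintype.card V)
    (hlog : (Nat.card G.edgeSet : ℤ) =
      2 * ((Nat.card G.edgeSet : ℤ) - (Fintype.card V : ℤ) + 1))
    (hred : ∃ (N : ℕ) (ε : Fin N ≃ G.edgeSet) (src tgt : G.edgeSet → V) (v₀ : V)
        (D : ℕ → MvPolynomial (Fin N) ℤ),
      IsOrientation G src tgt ∧ IsDenomReduction G ε src tgt v₀ (N - 2) D) :
    (∀ (K : Type) [Field K] [Fintype K],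
      Xcount G K ≡ 0 [MOD (Fintype.card K) ^ 3]) ∨
    (∃ S : Finset ℕ, ∀ p : ℕ, p.Prime → p ∉ S → ∀ n₀ : ℕ, 1 ≤ n₀ →
      ∀ (K : Type) [Field K] [Fintype K], Fintype.card K = p ^ (2 * n₀) →
        (Xcount G K : ℤ) ≡ -(Fintype.card K : ℤ) ^ 2
          [ZMOD ((Fintype.card K : ℤ)) ^ 3]) := by
  obtain ⟨N, ε, src, tgt, v₀, D, ho, hr⟩ := hred
  have hcard : Nat.card G.edgeSet = N := by
    rw [← Nat.card_congr ε, Nat.card_eq_fintype_card, Fintype.card_fin]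
  rw [hcard] at hlog
  obtain ⟨h, hh⟩ : ∃ h, Fintype.card V = h + 1 := ⟨Fintype.card V - 1, by omega⟩
  have hN : N = 2 * h := by omega
  have hN7 : 5 ≤ N - 2 := hr.1
  obtain ⟨m1, m2⟩ := main_cong G hG hV h hN hh ε src tgt v₀ D ho hr
  have hu : N - 2 < N := by omega
  have hv : N - 1 < N := by omega
  obtain ⟨α, β, γ, hQ⟩ := quad_form (D (N - 2)) m1 ⟨N - 2, hu⟩ ⟨N - 1, hv⟩
    (by rw [Ne, Fin.ext_iff]; simp only; omega)
    (by
      intro i hi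
      have h1 := hr.2.2.2.1 (N - 2) hN7 le_rfl i hi
      have h2 := i.2
      rw [Fin.ext_iff, Fin.ext_iff]
      simp only
      omega)
  have m3 : ∀ (K : Type) [Field K] [Fintype K],
      (Xcount G K : ℤ) ≡ (Fintype.card K : ℤ) ^ 2 *
        (∑ s : K, ∑ t : K, if (α : K) * s ^ 2 + (β : K) * s * t + (γ : K) * t ^ 2 = 0
          then (1 : ℤ) else 0) [ZMOD (Fintype.card K : ℤ) ^ 3] := by
    intro K _ _
    refine (m2 K).trans (modEq_of_eq ?_)
    congr 1
    rw [← cnt_two (N := N) (by omega) K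
      (fun s t => (α : K) * s ^ 2 + (β : K) * s * t + (γ : K) * t ^ 2 = 0)]
    refine cnt_congr fun x _ => ?_
    rw [hQ K x]
  have e3 : ∀ q : ℤ, q ^ 3 = q ^ 2 * q := fun q => by ring
  by_cases hΔ : β ^ 2 - 4 * α * γ = 0
  · left
    intro K _ _
    have hz := quad_zero (α : K) (β : K) (γ : K) (by
      have := congrArg (Int.cast : ℤ → K) hΔ
      push_cast at this
      exact this)
    have h1 : (Xcount G K : ℤ) ≡ 0 [ZMOD (Fintype.card K : ℤ) ^ 3] := by
      refine (m3 K).trans ?_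
      rw [e3]
      have := hz.mul_left' (c := (Fintype.card K : ℤ) ^ 2)
      rwa [mul_zero] at this
    rw [← Int.natCast_modEq_iff]
    push_cast
    exact h1
  · right
    refine ⟨(2 * (β ^ 2 - 4 * α * γ)).natAbs.primeFactors, fun p hp hpS n₀ hn K _ _ hK => ?_⟩
    have hnd : ¬ p ∣ (2 * (β ^ 2 - 4 * α * γ)).natAbs := by
      intro hd
      apply hpS
      rw [Nat.mem_primeFactors]
      refine ⟨hp, hd, ?_⟩
      rw [Int.natAbs_ne_zero]
      exact mul_ne_zero two_ne_zero hΔ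
    rw [← Int.natCast_dvd] at hnd
    have hp2 : p ≠ 2 := by
      rintro rfl
      exact hnd (dvd_mul_right _ _)
    obtain ⟨h2, δ, hδ, hsq⟩ := int_square (K := K) p n₀ hp hp2 hK (β ^ 2 - 4 * α * γ)
      (fun hd => hnd (hd.mul_left 2))
    have hz := quad_sq (α : K) (β : K) (γ : K) δ h2 (by
      push_cast at hsq
      exact hsq) hδ
    refine (m3 K).trans ?_
    rw [e3]
    have := hz.mul_left' (c := (Fintype.card K : ℤ) ^ 2)
    rwa [mul_neg_one] at this
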